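/- Let n, k ∈ ℕ, p, q ∈ (1,∞) satisfy n(1/p − 1/q) < k, and let γ ∈ ℝ∖{0}. Then a locally integrable f : ℝ^n → ℝ has weak derivatives of order k with |∇^k f| ∈ L^p(ℝ^n) if and only if sup_{λ∈(0,∞)} λ (∫_{ℝ^n}[∫_{ℝ^n} 1_{E_{λ,γ/q,k}[f]}(x,h) |h|^{γ−n} dh]^{p/q} dx)^{1/p} < ∞. -/

import Mathlib

open MeasureTheory Filter Set
open scoped ENNReal NNReal BigOperators Topology Classical

noncomputable section

/-- `ℝ^n`. -/
abbrev En (n : ℕ) := EuclideanSpace ℝ (Fin n)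

variable {n : ℕ}

/-- The `k`-th order difference `Δ_h^k f (x) = ∑_{j=0}^k (-1)^{k-j} C(k,j) f (x + j h)`. -/
def kDiff (k : ℕ) (f : En n → ℝ) (h x : En n) : ℝ :=
  ∑ j ∈ Finset.range (k + 1), (-1 : ℝ) ^ (k - j) * (k.choose j : ℝ) * f (x + (j : ℝ) • h)

/-- Membership of `(x,h)` in `E_{λ,b,k,ℓ}[f]`. -/
def memE (k ℓ : ℕ) (lam b : ℝ) (f : En n → ℝ) (x h : En n) : Prop :=
  h ≠ 0 ∧ lam * ‖h‖ ^ ((ℓ : ℝ) + b) < |kDiff k f h x|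

/-- `∫_{ℝ^n} 1_{E_{λ,b,k,ℓ}[f]}(x,h) |h|^{γ-n} dh`. -/
def innerInt (k ℓ : ℕ) (lam b γ : ℝ) (f : En n → ℝ) (x : En n) : ℝ≥0∞ :=
  ∫⁻ h, if memE k ℓ lam b f x h then ENNReal.ofReal (‖h‖ ^ (γ - (n : ℝ))) else 0

/-- `λ (∫_{ℝ^n} (∫_{ℝ^n} 1_E |h|^{γ-n} dh)^{p/q} dx)^{1/p}`. -/
def bsvy (k ℓ : ℕ) (p q b γ : ℝ) (f : En n → ℝ) (lam : ℝ) : ℝ≥0∞ :=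
  ENNReal.ofReal lam * (∫⁻ x, (innerInt k ℓ lam b γ f x) ^ (p / q)) ^ (1 / p)

/-- First-order partial derivative in the `i`-th coordinate direction. -/
def pd (i : Fin n) (ψ : En n → ℝ) : En n → ℝ :=
  fun x => fderiv ℝ ψ x (EuclideanSpace.single i (1 : ℝ))

/-- Higher-order partial derivative `∂^α` associated with a multi-index `α`. -/
def mpd (α : Fin n → ℕ) (φ : En n → ℝ) : En n → ℝ :=
  (List.finRange n).foldr (fun i ψ => (pd i)^[α i] ψ) φ

/-- `g` is the family of `m`-th order weak partial derivatives of `f`. -/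
def HasWeakDerivs (m : ℕ) (f : En n → ℝ) (g : (Fin n → ℕ) → En n → ℝ) : Prop :=
  (∀ α : Fin n → ℕ, (∑ i, α i) = m → LocallyIntegrable (g α) volume) ∧
  ∀ α : Fin n → ℕ, (∑ i, α i) = m →
    ∀ φ : En n → ℝ, ContDiff ℝ (⊤ : ℕ∞) φ → HasCompactSupport φ →
      ∫ x, f x * mpd α φ x = (-1 : ℝ) ^ m * ∫ x, g α x * φ x

/-- `|∇^m f| = (∑_{|α| = m} |∂^α f|^2)^{1/2}`, given the family `g` of weak derivatives. -/
def gradLen (m : ℕ) (g : (Fin n → ℕ) → En n → ℝ) (x : En n) : ℝ :=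
  Real.sqrt (∑' α : Fin n → ℕ, if (∑ i, α i) = m then (g α x) ^ 2 else 0)

/-- The parameter range `Γ_{p,q}`. -/
def Gam (p q : ℝ) : Set ℝ := if p = 1 then Iio (-q) ∪ Ioi 0 else {(0 : ℝ)}ᶜ

/-- `‖ |∇^m f| ‖_{L^p}` as an `ℝ≥0∞`-valued quantity. -/
def gradLp (p : ℝ) (m : ℕ) (g : (Fin n → ℕ) → En n → ℝ) : ℝ≥0∞ :=
  (∫⁻ x, ENNReal.ofReal (gradLen m g x ^ p)) ^ (1 / p)

end

open MeasureTheory Set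
open scoped ENNReal

namespace BSVY

variable {n : ℕ}

/-- The directional derivative of `φ` along `v`. -/
noncomputable def dirD (v : En n) (φ : En n → ℝ) : En n → ℝ := fun x => fderiv ℝ φ x v

/-- Infinitely differentiable functions on `ℝ^n`. -/
abbrev Smooth (φ : En n → ℝ) : Prop := ContDiff ℝ (⊤ : ℕ∞) φ

lemma pd_eq_dirD (i : Fin n) : pd i = dirD (EuclideanSpace.single i (1 : ℝ)) := rfl

lemma Smooth.dirD {φ : En n → ℝ} (h : Smooth φ) (v : En n) : Smooth (dirD v φ) :=
  (h.fderiv_right (m := (⊤ : ℕ∞)) (by simp)).clm_apply contDiff_const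

lemma Smooth.pd {φ : En n → ℝ} (h : Smooth φ) (i : Fin n) : Smooth (pd i φ) := h.dirD _

lemma Smooth.differentiable' {φ : En n → ℝ} (h : Smooth φ) : Differentiable ℝ φ :=
  h.differentiable (by simp)

lemma dirD_comm {φ : En n → ℝ} (h : Smooth φ) (v w : En n) :
    dirD v (dirD w φ) = dirD w (dirD v φ) := by
  ext x
  have hd : DifferentiableAt ℝ (fderiv ℝ φ) x :=
    ((h.fderiv_right (m := (⊤ : ℕ∞)) (by simp)).differentiable (by simp)) x
  have key : ∀ a b : En n, BSVY.dirD a (BSVY.dirD b φ) x = fderiv ℝ (fderiv ℝ φ) x a b := by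
    intro a b
    unfold BSVY.dirD
    rw [fderiv_clm_apply hd (differentiableAt_const b)]
    simp
  rw [key, key]
  exact (h.contDiffAt.isSymmSndFDerivAt (by
    rw [minSmoothness_of_isRCLikeNormedField]
    exact WithTop.coe_le_coe.2 (le_top (a := (2 : ℕ∞))))) v w

lemma dirD_lincomb {ι : Type*} (s : Finset ι) (c : ι → ℝ) (F : ι → En n → ℝ)
    (hF : ∀ i ∈ s, Smooth (F i)) (v : En n) :
    dirD v (fun x => ∑ i ∈ s, c i * F i x) = fun x => ∑ i ∈ s, c i * dirD v (F i) x := by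
  ext x
  unfold dirD
  rw [fderiv_fun_sum (fun i hi => ((hF i hi).differentiable' x).const_mul (c i))]
  simp only [_root_.sum_apply]
  refine Finset.sum_congr rfl fun i hi => ?_
  rw [fderiv_const_mul ((hF i hi).differentiable' x)]
  simp

lemma dirD_eq_sum (φ : En n → ℝ) (h : En n) :
    dirD h φ = fun x => ∑ i, h i * pd i φ x := by
  ext x
  have : h = ∑ i, h i • EuclideanSpace.single i (1 : ℝ) := by
    ext j; simp [Finset.sum_apply, Pi.single_apply]
  unfold dirD pd
  conv_lhs => rw [this]
  simp [map_sum]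

/-- Iterated partial derivatives along the coordinates in a list. -/
noncomputable def lpd (l : List (Fin n)) (α : Fin n → ℕ) (φ : En n → ℝ) : En n → ℝ :=
  l.foldr (fun i ψ => (pd i)^[α i] ψ) φ

lemma mpd_eq_lpd (α : Fin n → ℕ) (φ : En n → ℝ) : mpd α φ = lpd (List.finRange n) α φ := rfl

lemma Smooth.iter_pd {φ : En n → ℝ} (h : Smooth φ) (i : Fin n) (m : ℕ) :
    Smooth ((_root_.pd i)^[m] φ) := by
  induction m generalizing φ with
  | zero => exact h
  | succ m ih => exact ih (h.pd i)

lemma Smooth.lpd {φ : En n → ℝ} (h : Smooth φ) (l : List (Fin n)) (α : Fin n → ℕ) :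
    Smooth (lpd l α φ) := by
  induction l with
  | nil => exact h
  | cons i l ih => exact ih.iter_pd i _

lemma Smooth.mpd {φ : En n → ℝ} (h : Smooth φ) (α : Fin n → ℕ) : Smooth (mpd α φ) := h.lpd _ _

lemma pd_iter_comm {φ : En n → ℝ} (h : Smooth φ) (i j : Fin n) (m : ℕ) :
    pd j ((pd i)^[m] φ) = (pd i)^[m] (pd j φ) := by
  induction m generalizing φ with
  | zero => rfl
  | succ m ih =>
    rw [Function.iterate_succ_apply, Function.iterate_succ_apply, ih (h.pd i)]
    congr 1
    exact dirD_comm h _ _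

lemma pd_lpd_comm {φ : En n → ℝ} (h : Smooth φ) (l : List (Fin n)) (α : Fin n → ℕ) (j : Fin n) :
    pd j (lpd l α φ) = lpd l α (pd j φ) := by
  induction l with
  | nil => rfl
  | cons i l ih =>
    change pd j ((pd i)^[α i] (lpd l α φ)) = (pd i)^[α i] (lpd l α (pd j φ))
    rw [pd_iter_comm (h.lpd l α), ih]

lemma lpd_add_single {φ : En n → ℝ} (h : Smooth φ) (l : List (Fin n)) (hl : l.Nodup)
    (α : Fin n → ℕ) (j : Fin n) :
    lpd l (α + Pi.single j 1) φ = if j ∈ l then lpd l α (pd j φ) else lpd l α φ := by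
  induction l with
  | nil => simp [lpd]
  | cons i l ih =>
    have hl' := (List.nodup_cons.1 hl)
    change (pd i)^[(α + Pi.single j 1 : Fin n → ℕ) i] (lpd l (α + Pi.single j 1) φ) = if j ∈ i :: l then
      (pd i)^[α i] (lpd l α (pd j φ)) else (pd i)^[α i] (lpd l α φ)
    rw [ih hl'.2]
    by_cases hij : j = i
    · subst hij
      simp only [hl'.1, if_false, List.mem_cons, true_or, if_true, Pi.add_apply, Pi.single_eq_same,
        Function.iterate_succ_apply]
      rw [pd_lpd_comm h]
    · have : (α + Pi.single j 1 : Fin n → ℕ) i = α i := by simp [Ne.symm hij]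
      rw [this]
      simp only [List.mem_cons, hij, false_or]
      split_ifs <;> rfl

lemma mpd_add_single {φ : En n → ℝ} (h : Smooth φ) (α : Fin n → ℕ) (j : Fin n) :
    mpd (α + Pi.single j 1) φ = mpd α (pd j φ) := by
  rw [mpd_eq_lpd, lpd_add_single h _ (List.nodup_finRange n)]
  simp [mpd_eq_lpd]

lemma mpd_zero (φ : En n → ℝ) : mpd 0 φ = φ := by
  rw [mpd_eq_lpd]
  induction List.finRange n with
  | nil => rfl
  | cons i l ih => exact ih

lemma mpd_lincomb {ι : Type*} (s : Finset ι) (c : ι → ℝ) (F : ι → En n → ℝ)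
    (hF : ∀ i ∈ s, Smooth (F i)) (α : Fin n → ℕ) :
    mpd α (fun x => ∑ i ∈ s, c i * F i x) = fun x => ∑ i ∈ s, c i * mpd α (F i) x := by
  have iter : ∀ (j : Fin n) (m : ℕ) (F : ι → En n → ℝ), (∀ i ∈ s, Smooth (F i)) →
      (pd j)^[m] (fun x => ∑ i ∈ s, c i * F i x) = fun x => ∑ i ∈ s, c i * (pd j)^[m] (F i) x := by
    intro j m
    induction m with
    | zero => intro F _; rfl
    | succ m ih =>
      intro F hF
      simp only [Function.iterate_succ_apply]
      rw [pd_eq_dirD, dirD_lincomb s c F hF, ← pd_eq_dirD]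
      exact ih _ fun i hi => (hF i hi).pd j
  simp only [mpd_eq_lpd]
  induction List.finRange n with
  | nil => rfl
  | cons j l ih =>
    change (pd j)^[α j] (lpd l α _) = fun x => ∑ i ∈ s, c i * (pd j)^[α j] (lpd l α (F i)) x
    rw [ih]
    exact iter j _ _ fun i hi => (hF i hi).lpd l α

/-- Multi-indices of length `m`. -/
def idx (n m : ℕ) : Finset (Fin n → ℕ) := Finset.piAntidiag Finset.univ m

lemma mem_idx {m : ℕ} {α : Fin n → ℕ} : α ∈ idx n m ↔ ∑ i, α i = m := by
  simp [idx, Finset.mem_piAntidiag]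

/-- The coefficient of `∂^α` in the `|α|`-th power of the directional derivative along `h`. -/
noncomputable def mono (α : Fin n → ℕ) (h : En n) : ℝ :=
  (Nat.multinomial Finset.univ α : ℝ) * ∏ i, h i ^ α i

/-- The functional on polynomials sending `X^α` to `∂^α φ (x)`. -/
noncomputable def evalD (φ : En n → ℝ) (x : En n) : MvPolynomial (Fin n) ℝ →ₗ[ℝ] ℝ :=
  (MvPolynomial.basisMonomials (Fin n) ℝ).constr ℝ (fun s => mpd (⇑s) φ x)

lemma evalD_monomial (φ : En n → ℝ) (x : En n) (s : Fin n →₀ ℕ) (c : ℝ) :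
    evalD φ x (MvPolynomial.monomial s c) = c * mpd (⇑s) φ x := by
  have h1 : evalD φ x (MvPolynomial.monomial s 1) = mpd (⇑s) φ x := by
    have := (MvPolynomial.basisMonomials (Fin n) ℝ).constr_basis ℝ (fun s => mpd (⇑s) φ x) s
    simpa [evalD] using this
  have h2 : MvPolynomial.monomial s c = c • MvPolynomial.monomial s (1 : ℝ) := by
    simp [MvPolynomial.smul_monomial]
  rw [h2, map_smul, h1, smul_eq_mul]

lemma evalD_dirD {φ : En n → ℝ} (hφ : Smooth φ) (x h : En n) (P : MvPolynomial (Fin n) ℝ) :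
    evalD (dirD h φ) x P =
      evalD φ x ((∑ i, MvPolynomial.C (h i) * MvPolynomial.X i) * P) := by
  induction P using MvPolynomial.induction_on' with
  | add p q hp hq => rw [map_add, hp, hq, mul_add, map_add]
  | monomial s c =>
    rw [evalD_monomial, Finset.sum_mul, map_sum, dirD_eq_sum,
      mpd_lincomb _ _ _ (fun i _ => hφ.pd i), Finset.mul_sum]
    refine Finset.sum_congr rfl fun i _ => ?_
    rw [MvPolynomial.C_mul_X_eq_monomial, MvPolynomial.monomial_mul, evalD_monomial,
      ← mpd_add_single hφ]
    have : (⇑(Finsupp.single i 1 + s : Fin n →₀ ℕ) : Fin n → ℕ) = ⇑s + Pi.single i 1 := by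
      ext j; simp [Finsupp.single_apply, Pi.single_apply, add_comm, eq_comm]
    rw [this]; ring

lemma iter_dirD_eq {φ : En n → ℝ} (hφ : Smooth φ) (x h : En n) (m : ℕ) :
    (dirD h)^[m] φ x = ∑ α ∈ idx n m, mono α h * mpd α φ x := by
  have key : (dirD h)^[m] φ x =
      evalD φ x ((∑ i, MvPolynomial.C (h i) * MvPolynomial.X i) ^ m) := by
    induction m generalizing φ with
    | zero =>
      have := evalD_monomial φ x 0 1
      simpa [mpd_zero] using this.symm
    | succ m ih => rw [Function.iterate_succ_apply, ih (hφ.dirD h), evalD_dirD hφ, pow_succ']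
  rw [key, Finset.sum_pow_eq_sum_piAntidiag, map_sum]
  refine Finset.sum_congr rfl fun α _ => ?_
  have : ((Nat.multinomial Finset.univ α : ℕ) : MvPolynomial (Fin n) ℝ) *
      ∏ i, (MvPolynomial.C (h i) * MvPolynomial.X i) ^ α i =
      MvPolynomial.monomial (Finsupp.equivFunOnFinite.symm α) (mono α h) := by
    rw [MvPolynomial.monomial_eq, Finsupp.prod_fintype _ _ (by simp)]
    simp [mono, mul_pow, Finset.prod_mul_distrib, mul_assoc]
  rw [this, evalD_monomial]
  rfl

lemma abs_mono_le (α : Fin n → ℕ) {m : ℕ} (hα : α ∈ idx n m) (h : En n) :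
    |mono α h| ≤ (Nat.multinomial Finset.univ α : ℝ) * ‖h‖ ^ m := by
  unfold mono
  rw [abs_mul, Nat.abs_cast, Finset.abs_prod]
  gcongr
  rw [← mem_idx.1 hα, ← Finset.prod_pow_eq_pow_sum]
  refine Finset.prod_le_prod (fun i _ => abs_nonneg _) fun i _ => ?_
  rw [abs_pow]
  gcongr
  exact PiLp.norm_apply_le h i

lemma mono_smul (α : Fin n → ℕ) {m : ℕ} (hα : α ∈ idx n m) (c : ℝ) (h : En n) :
    mono α (c • h) = c ^ m * mono α h := by
  unfold mono
  rw [← mem_idx.1 hα, ← Finset.prod_pow_eq_pow_sum]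
  simp [mul_pow, Finset.prod_mul_distrib]
  ring

lemma continuous_mono (α : Fin n → ℕ) : Continuous (mono α : En n → ℝ) := by
  unfold mono; fun_prop

lemma abs_iter_fwdDiff_sub_le (k : ℕ) (φ : ℝ → ℝ) (hφ : ContDiff ℝ (⊤ : ℕ∞) φ) (t c C : ℝ)
    (h : ∀ τ ∈ Icc t (t + k), |iteratedDeriv k φ τ - c| ≤ C) :
    |(fwdDiff 1)^[k] φ t - c| ≤ C := by
  induction k generalizing φ with
  | zero => simpa using h t (by simp)
  | succ k ih =>
    rw [Function.iterate_succ_apply]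
    have hs : ContDiff ℝ (⊤ : ℕ∞) (fun x => φ (x + 1)) := hφ.comp (contDiff_id.add contDiff_const)
    refine ih _ (hs.sub hφ) fun τ hτ => ?_
    have hle : ((k : ℕ∞) : WithTop ℕ∞) ≤ ((⊤ : ℕ∞) : WithTop ℕ∞) := WithTop.coe_le_coe.2 le_top
    have e : iteratedDeriv k (fwdDiff 1 φ) τ = iteratedDeriv k φ (τ + 1) - iteratedDeriv k φ τ := by
      have := iteratedDeriv_sub (n := k) (x := τ) (f := fun x => φ (x + 1)) (g := φ)
        (hs.contDiffAt.of_le hle) (hφ.contDiffAt.of_le hle)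
      rw [iteratedDeriv_comp_add_const] at this
      exact this
    have hdiff : Differentiable ℝ (iteratedDeriv k φ) :=
      hφ.differentiable_iteratedDeriv k (WithTop.coe_lt_coe.2 (ENat.natCast_lt_top k))
    obtain ⟨ξ, hξ, hξ'⟩ := exists_deriv_eq_slope (iteratedDeriv k φ) (lt_add_one τ)
      hdiff.continuous.continuousOn hdiff.differentiableOn
    rw [e, show iteratedDeriv k φ (τ + 1) - iteratedDeriv k φ τ = iteratedDeriv (k + 1) φ ξ by
      rw [iteratedDeriv_succ, hξ']; simp]
    refine h ξ ⟨hτ.1.trans hξ.1.le, ?_⟩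
    push_cast
    linarith [hτ.2, hξ.2]

lemma iteratedDeriv_line {F : En n → ℝ} (hF : Smooth F) (k : ℕ) (x h : En n) :
    iteratedDeriv k (fun τ : ℝ => F (x + τ • h)) = fun τ => (dirD h)^[k] F (x + τ • h) := by
  induction k generalizing F with
  | zero => simp
  | succ k ih =>
    change _ = fun τ => (dirD h)^[k] (dirD h F) (x + τ • h)
    rw [iteratedDeriv_succ', ← ih (hF.dirD h)]
    congr 1
    ext τ
    have h1 : HasDerivAt (fun τ : ℝ => x + τ • h) h τ := by
      simpa using ((hasDerivAt_id τ).smul_const h).const_add x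
    exact ((hF.differentiable' _).hasFDerivAt.comp_hasDerivAt τ h1).deriv

lemma kDiff_eq_fwdDiff (k : ℕ) (F : En n → ℝ) (h x : En n) :
    kDiff k F h x = (fwdDiff 1)^[k] (fun τ : ℝ => F (x + τ • h)) 0 := by
  rw [fwdDiff_iter_eq_sum_shift]
  unfold kDiff
  refine Finset.sum_congr rfl fun j _ => ?_
  simp

lemma abs_kDiff_sub_le {F : En n → ℝ} (hF : Smooth F) (k : ℕ) (x h : En n) (c C : ℝ)
    (hC : ∀ τ ∈ Icc (0 : ℝ) k, |(dirD h)^[k] F (x + τ • h) - c| ≤ C) :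
    |kDiff k F h x - c| ≤ C := by
  rw [kDiff_eq_fwdDiff]
  refine abs_iter_fwdDiff_sub_le k _ ?_ _ _ _ ?_
  · exact hF.comp (contDiff_const.add (contDiff_id.smul contDiff_const))
  · rw [iteratedDeriv_line hF]
    simpa using hC

lemma enorm_kDiff_sub_le {F : En n → ℝ} (hF : Smooth F) (k : ℕ) (x h : En n) (c : ℝ) (C : ℝ≥0∞)
    (hC : ∀ τ ∈ Icc (0 : ℝ) k, ‖(dirD h)^[k] F (x + τ • h) - c‖ₑ ≤ C) :
    ‖kDiff k F h x - c‖ₑ ≤ C := by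
  induction C with
  | top => exact le_top
  | coe C =>
    have key : ∀ a : ℝ, ‖a‖ₑ ≤ (C : ℝ≥0∞) ↔ |a| ≤ C := fun a => by
      rw [enorm_le_coe, ← NNReal.coe_le_coe, coe_nnnorm, Real.norm_eq_abs]
    rw [key]
    exact abs_kDiff_sub_le hF k x h c C fun τ hτ => (key _).1 (hC τ hτ)

/-- The convolution of a kernel `ψ` with `f`. -/
noncomputable def cv (ψ f : En n → ℝ) (y : En n) : ℝ := ∫ z, ψ z * f (y - z)

lemma cv_eq_convolution (ψ f : En n → ℝ) :
    cv ψ f = convolution ψ f (ContinuousLinearMap.mul ℝ ℝ) volume := rfl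

lemma integrable_cv {ψ f : En n → ℝ} (hψ : Continuous ψ) (hc : HasCompactSupport ψ)
    (hf : LocallyIntegrable f volume) (y : En n) : Integrable (fun z => ψ z * f (y - z)) :=
  hc.convolutionExists_left (ContinuousLinearMap.mul ℝ ℝ) hψ hf y

lemma cv_eq_flip (ψ f : En n → ℝ) (y : En n) : cv ψ f y = ∫ z, ψ (y - z) * f z := by
  unfold cv
  rw [← integral_sub_left_eq_self _ volume y]
  simp

lemma Smooth.cv {ψ f : En n → ℝ} (hψ : Smooth ψ) (hc : HasCompactSupport ψ)
    (hf : LocallyIntegrable f volume) : Smooth (cv ψ f) :=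
  hc.contDiff_convolution_left (ContinuousLinearMap.mul ℝ ℝ) hψ hf

lemma hasCompactSupport_dirD {ψ : En n → ℝ} (hc : HasCompactSupport ψ) (v : En n) :
    HasCompactSupport (dirD v ψ) := hc.fderiv_apply ℝ v

lemma hasCompactSupport_iter_dirD {ψ : En n → ℝ} (hc : HasCompactSupport ψ) (v : En n) (m : ℕ) :
    HasCompactSupport ((dirD v)^[m] ψ) := by
  induction m generalizing ψ with
  | zero => exact hc
  | succ m ih => exact ih (hasCompactSupport_dirD hc v)

lemma hasCompactSupport_mpd {ψ : En n → ℝ} (hc : HasCompactSupport ψ) (α : Fin n → ℕ) :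
    HasCompactSupport (mpd α ψ) := by
  rw [mpd_eq_lpd]
  induction List.finRange n with
  | nil => exact hc
  | cons i l ih => exact hasCompactSupport_iter_dirD ih _ _

lemma dirD_cv {ψ f : En n → ℝ} (hψ : Smooth ψ) (hc : HasCompactSupport ψ)
    (hf : LocallyIntegrable f volume) (v : En n) : dirD v (cv ψ f) = cv (dirD v ψ) f := by
  ext y
  have h1 := hc.hasFDerivAt_convolution_left (ContinuousLinearMap.mul ℝ ℝ)
    (hψ.of_le (by exact_mod_cast le_top)) hf y
  have hint : ConvolutionExistsAt (fderiv ℝ ψ) f y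
      ((ContinuousLinearMap.mul ℝ ℝ).precompL (En n)) volume :=
    (hc.fderiv ℝ).convolutionExists_left _ (hψ.continuous_fderiv (by simp)) hf y
  unfold dirD
  rw [cv_eq_convolution, h1.fderiv, convolution_def, ContinuousLinearMap.integral_apply hint]
  rfl

lemma iter_dirD_cv {ψ f : En n → ℝ} (hψ : Smooth ψ) (hc : HasCompactSupport ψ)
    (hf : LocallyIntegrable f volume) (v : En n) (m : ℕ) :
    (dirD v)^[m] (cv ψ f) = cv ((dirD v)^[m] ψ) f := by
  induction m generalizing ψ with
  | zero => rfl
  | succ m ih =>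
    rw [Function.iterate_succ_apply, dirD_cv hψ hc hf, ih (hψ.dirD v) (hasCompactSupport_dirD hc v)]
    rfl

lemma dirD_reflect {ψ : En n → ℝ} (hψ : Smooth ψ) (y v : En n) (c : ℝ) :
    dirD v (fun z => c * ψ (y - z)) = fun z => -c * dirD v ψ (y - z) := by
  ext z
  have h1 : HasFDerivAt (fun z : En n => y - z) (-ContinuousLinearMap.id ℝ (En n)) z :=
    (hasFDerivAt_id z).const_sub y
  have h2 := ((hψ.differentiable' (y - z)).hasFDerivAt.comp z h1).const_mul c
  unfold dirD
  have h3 : fderiv ℝ (fun z => c * ψ (y - z)) z =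
      c • (fderiv ℝ ψ (y - z)).comp (-ContinuousLinearMap.id ℝ (En n)) := h2.fderiv
  rw [h3]
  simp

lemma mpd_reflect {ψ : En n → ℝ} (hψ : Smooth ψ) (y : En n) (α : Fin n → ℕ) :
    mpd α (fun z => ψ (y - z)) = fun z => (-1 : ℝ) ^ (∑ i, α i) * mpd α ψ (y - z) := by
  have iter : ∀ (i : Fin n) (m : ℕ) (c : ℝ) (ψ : En n → ℝ), Smooth ψ →
      (pd i)^[m] (fun z => c * ψ (y - z)) = fun z => (c * (-1) ^ m) * (pd i)^[m] ψ (y - z) := by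
    intro i m
    induction m with
    | zero => intro c ψ _; simp
    | succ m ih =>
      intro c ψ hψ
      rw [Function.iterate_succ_apply, Function.iterate_succ_apply, pd_eq_dirD,
        dirD_reflect hψ, ← pd_eq_dirD, ih _ _ (hψ.pd i), pow_succ']
      ext z; ring
  simp only [mpd_eq_lpd, Fin.sum_univ_def]
  induction List.finRange n with
  | nil => simp [lpd]
  | cons i l ih =>
    change (pd i)^[α i] (lpd l α (fun z => ψ (y - z))) = fun z => _ * (pd i)^[α i] (lpd l α ψ) (y - z)
    rw [ih, iter _ _ _ _ (hψ.lpd l α)]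
    simp [pow_add, mul_comm]

lemma cv_mpd_eq {k : ℕ} {f : En n → ℝ} {g : (Fin n → ℕ) → En n → ℝ} (hg : HasWeakDerivs k f g)
    {ψ : En n → ℝ} (hψ : Smooth ψ) (hc : HasCompactSupport ψ) {α : Fin n → ℕ} (hα : α ∈ idx n k)
    (y : En n) : cv (mpd α ψ) f y = cv ψ (g α) y := by
  have hα' := mem_idx.1 hα
  have hs : Smooth (fun z => ψ (y - z)) := hψ.comp (contDiff_const.sub contDiff_id)
  have hcs : HasCompactSupport (fun z => ψ (y - z)) :=
    hc.comp_homeomorph (Homeomorph.subLeft y)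
  have := hg.2 α hα' _ hs hcs
  rw [mpd_reflect hψ, hα'] at this
  rw [cv_eq_flip, cv_eq_flip]
  have e : ∫ x, f x * ((-1 : ℝ) ^ k * mpd α ψ (y - x)) =
      (-1 : ℝ) ^ k * ∫ z, mpd α ψ (y - z) * f z := by
    rw [← integral_const_mul]; congr 1; ext z; ring
  rw [e] at this
  have := mul_left_cancel₀ (pow_ne_zero k (by norm_num : (-1 : ℝ) ≠ 0)) this
  rw [this]; congr 1; ext z; ring

lemma iter_dirD_cv_eq {k : ℕ} {f : En n → ℝ} {g : (Fin n → ℕ) → En n → ℝ}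
    (hf : LocallyIntegrable f volume) (hg : HasWeakDerivs k f g)
    {ψ : En n → ℝ} (hψ : Smooth ψ) (hc : HasCompactSupport ψ) (h y : En n) :
    (dirD h)^[k] (cv ψ f) y = ∑ α ∈ idx n k, mono α h * cv ψ (g α) y := by
  rw [iter_dirD_cv hψ hc hf]
  have : cv ((dirD h)^[k] ψ) f y = ∑ α ∈ idx n k, mono α h * cv (mpd α ψ) f y := by
    unfold cv
    simp_rw [iter_dirD_eq hψ, Finset.sum_mul, mul_assoc]
    rw [integral_finsetSum]
    · simp_rw [integral_const_mul]
    · intro α _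
      exact (integrable_cv (hψ.mpd α).continuous (hasCompactSupport_mpd hc α) hf y).const_mul _
  rw [this]
  exact Finset.sum_congr rfl fun α hα => by rw [cv_mpd_eq hg hψ hc hα]

lemma enorm_cv_sub_le {ψ u : En n → ℝ} (hψ : Continuous ψ) (hc : HasCompactSupport ψ)
    (hu : LocallyIntegrable u volume) (h1 : ∫ z, ψ z = 1) {A R : ℝ} (hA : ∀ z, |ψ z| ≤ A)
    (hR : ∀ z, R ≤ ‖z‖ → ψ z = 0) (a : ℝ) (y : En n) :
    ‖cv ψ u y - a‖ₑ ≤ ENNReal.ofReal A * ∫⁻ z in Metric.ball y R, ‖u z - a‖ₑ := by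
  have e : cv ψ u y - a = ∫ z, ψ z * (u (y - z) - a) := by
    simp_rw [mul_sub]
    rw [integral_sub (integrable_cv hψ hc hu y)
      ((hψ.integrable_of_hasCompactSupport hc).mul_const a), integral_mul_const, h1, one_mul]
    rfl
  rw [e, ← integral_sub_left_eq_self _ volume y]
  refine (enorm_integral_le_lintegral_enorm _).trans ?_
  rw [← lintegral_const_mul' _ _ ENNReal.ofReal_ne_top, ← lintegral_indicator Metric.isOpen_ball.measurableSet]
  refine lintegral_mono fun z => ?_
  by_cases hz : z ∈ Metric.ball y R
  · rw [Set.indicator_of_mem hz, enorm_mul, sub_sub_cancel, ← ofReal_norm (ψ _)]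
    gcongr
    exact hA _
  · have : ψ (y - z) = 0 := hR _ (by
      rw [Metric.mem_ball, not_lt, dist_comm, dist_eq_norm] at hz; exact hz)
    simp [this]

/-- The total deviation of the family `g` from the constants `a`. -/
noncomputable def dev (k : ℕ) (g : (Fin n → ℕ) → En n → ℝ) (a : (Fin n → ℕ) → ℝ) (z : En n) : ℝ≥0∞ :=
  ∑ α ∈ idx n k, ‖g α z - a α‖ₑ

/-- The homogeneous polynomial with coefficients `a`. -/
noncomputable def form (k : ℕ) (a : (Fin n → ℕ) → ℝ) (h : En n) : ℝ := ∑ α ∈ idx n k, mono α h * a α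

lemma enorm_kDiff_cv_sub_le {k : ℕ} {f : En n → ℝ} {g : (Fin n → ℕ) → En n → ℝ}
    (hf : LocallyIntegrable f volume) (hg : HasWeakDerivs k f g)
    {ψ : En n → ℝ} (hψ : Smooth ψ) (hc : HasCompactSupport ψ) (h1 : ∫ z, ψ z = 1) {A R : ℝ}
    (hA : ∀ z, |ψ z| ≤ A) (hR : ∀ z, R ≤ ‖z‖ → ψ z = 0) (a : (Fin n → ℕ) → ℝ) (h y : En n) :
    ‖kDiff k (cv ψ f) h y - form k a h‖ₑ ≤
      ENNReal.ofReal ((∑ α ∈ idx n k, (Nat.multinomial Finset.univ α : ℝ)) * ‖h‖ ^ k * A) *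
        ∫⁻ z in Metric.ball y (R + k * ‖h‖), dev k g a z := by
  have hA0 : 0 ≤ A := (abs_nonneg _).trans (hA 0)
  refine enorm_kDiff_sub_le (hψ.cv hc hf) k y h _ _ fun τ hτ => ?_
  rw [iter_dirD_cv_eq hf hg hψ hc, form, ← Finset.sum_sub_distrib]
  simp_rw [← mul_sub]
  have hm : ∀ α ∈ idx n k, Integrable (fun z => ψ z) := fun _ _ =>
    hψ.continuous.integrable_of_hasCompactSupport hc
  have hmeas : ∀ α ∈ idx n k, AEMeasurable (fun z => ‖g α z - a α‖ₑ)
      (volume.restrict (Metric.ball y (R + k * ‖h‖))) := fun α hα =>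
    ((hg.1 α (mem_idx.1 hα)).aestronglyMeasurable.aemeasurable.sub_const _).enorm.restrict
  have hint : ∫⁻ z in Metric.ball y (R + k * ‖h‖), dev k g a z =
      ∑ α ∈ idx n k, ∫⁻ z in Metric.ball y (R + k * ‖h‖), ‖g α z - a α‖ₑ :=
    lintegral_finsetSum' _ hmeas
  rw [hint, Finset.mul_sum]
  refine (enorm_sum_le _ _).trans (Finset.sum_le_sum fun α hα => ?_)
  rw [enorm_mul, ENNReal.ofReal_mul (by positivity), mul_assoc]
  have hm1 : ‖mono α h‖ₑ ≤
      ENNReal.ofReal ((∑ α ∈ idx n k, (Nat.multinomial Finset.univ α : ℝ)) * ‖h‖ ^ k) := by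
    rw [← ofReal_norm]
    refine ENNReal.ofReal_le_ofReal ((abs_mono_le α hα h).trans ?_)
    gcongr
    exact Finset.single_le_sum (f := fun α => (Nat.multinomial Finset.univ α : ℝ))
      (fun _ _ => by positivity) hα
  refine mul_le_mul' hm1 ((enorm_cv_sub_le hψ.continuous hc (hg.1 α (mem_idx.1 hα)) h1 hA hR
    (a α) _).trans ?_)
  gcongr
  refine Metric.ball_subset_ball' ?_
  rw [dist_eq_norm, add_sub_cancel_left, norm_smul, Real.norm_of_nonneg hτ.1]
  gcongr
  exact hτ.2

lemma exists_bump (n : ℕ) : ∃ φ : En n → ℝ, Smooth φ ∧ HasCompactSupport φ ∧ (∫ z, φ z = 1) ∧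
    (∀ z, 0 ≤ φ z) ∧ (∀ z, 1 ≤ ‖z‖ → φ z = 0) ∧ ∃ A, ∀ z, φ z ≤ A := by
  let b : ContDiffBump (0 : En n) := ⟨1 / 2, 1, by norm_num, by norm_num⟩
  have hs : Smooth (b.normed volume) := b.contDiff_normed
  refine ⟨b.normed volume, hs, b.hasCompactSupport_normed, b.integral_normed,
    b.nonneg_normed, fun z hz => ?_, ?_⟩
  · by_contra h
    have : z ∈ Function.support (b.normed volume) := h
    rw [b.support_normed_eq, mem_ball_zero_iff] at this
    exact absurd this (not_lt.2 hz)
  · obtain ⟨C, hC⟩ := hs.continuous.bounded_above_of_compact_support b.hasCompactSupport_normed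
    exact ⟨C, fun z => (le_abs_self _).trans (hC z)⟩

/-- The dilation `s⁻ⁿ φ(z / s)`. -/
noncomputable def dil (s : ℝ) (φ : En n → ℝ) (z : En n) : ℝ := (s ^ n)⁻¹ * φ (s⁻¹ • z)

lemma Smooth.dil {φ : En n → ℝ} (hφ : Smooth φ) (s : ℝ) : Smooth (dil s φ) :=
  contDiff_const.mul (hφ.comp (contDiff_const_smul s⁻¹))

lemma hasCompactSupport_dil {φ : En n → ℝ} (hc : HasCompactSupport φ) {s : ℝ} (hs : 0 < s) :
    HasCompactSupport (dil s φ) :=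
  (hc.comp_homeomorph (Homeomorph.smulOfNeZero s⁻¹ (inv_ne_zero hs.ne'))).mul_left

lemma integral_dil_mul (φ u : En n → ℝ) {s : ℝ} (hs : 0 < s) :
    ∫ z, dil s φ z * u z = ∫ z, φ z * u (s • z) := by
  have := Measure.integral_comp_inv_smul (E := En n) volume (fun z => φ z * u (s • z)) s
  simp only [smul_inv_smul₀ hs.ne', finrank_euclideanSpace_fin] at this
  unfold dil
  simp_rw [mul_assoc]
  rw [integral_const_mul, this, abs_of_pos (by positivity), smul_eq_mul, inv_mul_cancel_left₀]
  positivity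

/-- A kernel reproducing polynomials of degree less than `K`. -/
noncomputable def ker (K : ℕ) (φ : En n → ℝ) (ρ : ℝ) (z : En n) : ℝ :=
  ∑ j ∈ Finset.range K, (-1 : ℝ) ^ j * (K.choose (j + 1) : ℝ) * dil ((j + 1) * ρ) φ z

lemma cv_ker {φ : En n → ℝ} (hφ : Smooth φ) (hc : HasCompactSupport φ) (K : ℕ) {ρ : ℝ}
    (hρ : 0 < ρ) {F : En n → ℝ} (hF : Continuous F) (y : En n) :
    cv (ker K φ ρ) F y = ∑ j ∈ Finset.range K, (-1 : ℝ) ^ j * (K.choose (j + 1) : ℝ) *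
      ∫ z, φ z * F (y - (((j : ℝ) + 1) * ρ) • z) := by
  have hd : ∀ j : ℕ, 0 < ((j : ℝ) + 1) * ρ := fun j => by positivity
  unfold cv ker
  simp_rw [Finset.sum_mul, mul_assoc ((-1 : ℝ) ^ _ * _)]
  rw [integral_finsetSum]
  · refine Finset.sum_congr rfl fun j _ => ?_
    rw [integral_const_mul, integral_dil_mul _ (fun z => F (y - z)) (hd j)]
  · intro j _
    exact (integrable_cv (hφ.dil _).continuous (hasCompactSupport_dil hc (hd j))
      hF.locallyIntegrable y).const_mul _

lemma sub_cv_ker {φ : En n → ℝ} (hφ : Smooth φ) (hc : HasCompactSupport φ) (h1 : ∫ z, φ z = 1)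
    (K : ℕ) {ρ : ℝ} (hρ : 0 < ρ) {F : En n → ℝ} (hF : Continuous F) (y : En n) :
    F y - cv (ker K φ ρ) F y = ∫ z, φ z * ((-1 : ℝ) ^ K * kDiff K F (-(ρ • z)) y) := by
  have hint : ∀ j : ℕ, Integrable fun z => φ z * F (y + (j : ℝ) • -(ρ • z)) := fun j =>
    ((hφ.continuous.mul (hF.comp (by fun_prop))).integrable_of_hasCompactSupport hc.mul_right)
  have e : ∀ z, φ z * ((-1 : ℝ) ^ K * kDiff K F (-(ρ • z)) y) =
      ∑ j ∈ Finset.range (K + 1), ((-1 : ℝ) ^ j * (K.choose j : ℝ)) *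
        (φ z * F (y + (j : ℝ) • -(ρ • z))) := fun z => by
    unfold kDiff
    rw [Finset.mul_sum, Finset.mul_sum]
    refine Finset.sum_congr rfl fun j hj => ?_
    have hj' : j ≤ K := Nat.lt_succ_iff.1 (Finset.mem_range.1 hj)
    have : (-1 : ℝ) ^ K = (-1) ^ (K - j) * (-1) ^ j := by rw [← pow_add, Nat.sub_add_cancel hj']
    rw [this]
    have h2 : (-1 : ℝ) ^ (K - j) * (-1) ^ (K - j) = 1 := by
      rw [← mul_pow]; simp
    linear_combination ((-1) ^ j * (K.choose j : ℝ) * φ z * F (y + (j : ℝ) • -(ρ • z))) * h2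
  simp_rw [e]
  rw [integral_finsetSum _ fun j _ => (hint j).const_mul _]
  simp_rw [integral_const_mul]
  rw [Finset.sum_range_succ', cv_ker hφ hc K hρ hF]
  simp only [pow_zero, Nat.choose_zero_right, Nat.cast_one, mul_one, one_mul, Nat.cast_zero,
    zero_smul, add_zero, integral_mul_const, h1]
  rw [add_comm, sub_eq_add_neg, ← Finset.sum_neg_distrib]
  congr 1
  refine Finset.sum_congr rfl fun j _ => ?_
  have : ∀ z : En n, y + ((j + 1 : ℕ) : ℝ) • -(ρ • z) = y - (((j : ℝ) + 1) * ρ) • z := fun z => by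
    push_cast; rw [smul_neg, smul_smul, sub_eq_add_neg]
  simp_rw [this, pow_succ]
  ring

lemma enorm_sub_cv_ker_le {φ : En n → ℝ} (hφ : Smooth φ) (hc : HasCompactSupport φ)
    (h1 : ∫ z, φ z = 1) (h0 : ∀ z, 0 ≤ φ z) (hR : ∀ z, 1 ≤ ‖z‖ → φ z = 0)
    (K : ℕ) {ρ : ℝ} (hρ : 0 < ρ) {F : En n → ℝ} (hF : Continuous F) (y : En n) (C : ℝ≥0∞)
    (hC : ∀ h : En n, ‖h‖ ≤ ρ → ‖kDiff K F h y‖ₑ ≤ C) :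
    ‖F y - cv (ker K φ ρ) F y‖ₑ ≤ C := by
  rw [sub_cv_ker hφ hc h1 K hρ hF]
  refine (enorm_integral_le_lintegral_enorm _).trans ?_
  have hl : ∫⁻ z, ENNReal.ofReal (φ z) = 1 := by
    rw [← ofReal_integral_eq_lintegral_ofReal (hφ.continuous.integrable_of_hasCompactSupport hc)
      (ae_of_all _ h0), h1, ENNReal.ofReal_one]
  calc ∫⁻ z, ‖φ z * ((-1 : ℝ) ^ K * kDiff K F (-(ρ • z)) y)‖ₑ
      ≤ ∫⁻ z, ENNReal.ofReal (φ z) * C := by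
        refine lintegral_mono fun z => ?_
        rcases le_or_gt 1 ‖z‖ with hz | hz
        · simp [hR z hz]
        · rw [enorm_mul, enorm_mul, ← ofReal_norm (φ z), Real.norm_of_nonneg (h0 z)]
          simp only [enorm_pow, enorm_neg, enorm_one, one_pow, one_mul]
          gcongr
          refine hC _ ?_
          rw [norm_neg, norm_smul, Real.norm_of_nonneg hρ.le]
          nlinarith
    _ = C := by
      rw [lintegral_mul_const _ (hφ.continuous.measurable.ennreal_ofReal), hl, one_mul]

lemma Smooth.ker {φ : En n → ℝ} (hφ : Smooth φ) (K : ℕ) (ρ : ℝ) : Smooth (ker K φ ρ) :=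
  ContDiff.sum fun _ _ => contDiff_const.mul (hφ.dil _)

lemma integral_ker {φ : En n → ℝ} (hφ : Smooth φ) (hc : HasCompactSupport φ) (h1 : ∫ z, φ z = 1)
    {K : ℕ} (hK : 0 < K) {ρ : ℝ} (hρ : 0 < ρ) : ∫ z, ker K φ ρ z = 1 := by
  have h := cv_ker hφ hc K hρ (F := fun _ => (1 : ℝ)) continuous_const 0
  simp only [cv, mul_one, h1] at h
  rw [h]
  have h2 := Int.alternating_sum_range_choose_of_ne hK.ne'
  rw [Finset.sum_range_succ'] at h2
  have h3 : ((∑ j ∈ Finset.range K, (-1 : ℤ) ^ (j + 1) * (K.choose (j + 1) : ℤ) : ℤ) : ℝ) = -1 := by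
    have : (∑ j ∈ Finset.range K, (-1 : ℤ) ^ (j + 1) * (K.choose (j + 1) : ℤ) : ℤ) = -1 := by
      simp at h2; linarith
    rw [this]; norm_num
  push_cast at h3
  simp_rw [pow_succ] at h3
  have h4 : ∑ j ∈ Finset.range K, (-1 : ℝ) ^ j * (-1) * (K.choose (j + 1) : ℝ) =
      -∑ j ∈ Finset.range K, (-1 : ℝ) ^ j * (K.choose (j + 1) : ℝ) := by
    rw [← Finset.sum_neg_distrib]; refine Finset.sum_congr rfl fun j _ => by ring
  linarith

lemma ker_eq_zero {φ : En n → ℝ} (hR : ∀ z, 1 ≤ ‖z‖ → φ z = 0) (K : ℕ) {ρ : ℝ} (hρ : 0 < ρ)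
    (z : En n) (hz : K * ρ ≤ ‖z‖) : ker K φ ρ z = 0 := by
  refine Finset.sum_eq_zero fun j hj => ?_
  have hj' : ((j : ℝ) + 1) ≤ K := by exact_mod_cast Finset.mem_range.1 hj
  have : φ ((((j : ℝ) + 1) * ρ)⁻¹ • z) = 0 := by
    apply hR
    rw [norm_smul, norm_inv, Real.norm_of_nonneg (by positivity), ← div_eq_inv_mul,
      le_div_iff₀ (by positivity), one_mul]
    exact (mul_le_mul_of_nonneg_right hj' hρ.le).trans hz
  simp only [dil, this, mul_zero]

lemma hasCompactSupport_ker {φ : En n → ℝ} (hR : ∀ z, 1 ≤ ‖z‖ → φ z = 0) (K : ℕ) {ρ : ℝ}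
    (hρ : 0 < ρ) : HasCompactSupport (ker K φ ρ) := by
  refine HasCompactSupport.intro (isCompact_closedBall (0 : En n) (K * ρ)) fun z hz => ?_
  rw [mem_closedBall_zero_iff, not_le] at hz
  exact ker_eq_zero hR K hρ z hz.le

lemma abs_ker_le {φ : En n → ℝ} (h0 : ∀ z, 0 ≤ φ z) {A : ℝ} (hA : ∀ z, φ z ≤ A) (K : ℕ) {ρ : ℝ}
    (hρ : 0 < ρ) (z : En n) :
    |ker K φ ρ z| ≤ ((∑ j ∈ Finset.range K, (K.choose (j + 1) : ℝ)) * A) / ρ ^ n := by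
  have hA0 : 0 ≤ A := (h0 0).trans (hA 0)
  unfold ker
  refine (Finset.abs_sum_le_sum_abs _ _).trans ?_
  rw [mul_div_assoc, Finset.sum_mul]
  refine Finset.sum_le_sum fun j _ => ?_
  rw [abs_mul, abs_mul, abs_pow, abs_neg, abs_one, one_pow, one_mul, Nat.abs_cast]
  refine mul_le_mul_of_nonneg_left ?_ (by positivity)
  unfold dil
  rw [abs_mul, abs_of_nonneg (h0 _), abs_of_pos (by positivity), div_eq_inv_mul]
  refine mul_le_mul (inv_anti₀ (by positivity) ?_) (hA _) (h0 _) (by positivity)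
  gcongr
  nlinarith [(Nat.cast_nonneg j : (0 : ℝ) ≤ j)]

lemma cv_comm {ψ₁ ψ₂ f : En n → ℝ} (h₁ : Continuous ψ₁) (hc₁ : HasCompactSupport ψ₁)
    (h₂ : Continuous ψ₂) (hc₂ : HasCompactSupport ψ₂) (hf : LocallyIntegrable f volume) :
    cv ψ₁ (cv ψ₂ f) = cv ψ₂ (cv ψ₁ f) := by
  have hfn : LocallyIntegrable (fun x => ‖f x‖) volume := fun x =>
    (hf x).imp fun s hs => ⟨hs.1, hs.2.norm⟩
  have assoc : ∀ ψ₁ ψ₂ : En n → ℝ, Continuous ψ₁ → HasCompactSupport ψ₁ → Continuous ψ₂ →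
      HasCompactSupport ψ₂ → cv (cv ψ₁ ψ₂) f = cv ψ₁ (cv ψ₂ f) := by
    intro ψ₁ ψ₂ h₁ hc₁ h₂ hc₂
    ext y
    refine convolution_assoc (𝕜 := ℝ) (ContinuousLinearMap.mul ℝ ℝ) (ContinuousLinearMap.mul ℝ ℝ)
      (ContinuousLinearMap.mul ℝ ℝ) (ContinuousLinearMap.mul ℝ ℝ) (μ := volume) (ν := volume)
      (fun x y z => mul_assoc x y z) h₁.aestronglyMeasurable h₂.aestronglyMeasurable
      hf.aestronglyMeasurable ?_ ?_ ?_
    · exact ae_of_all _ fun y => hc₁.convolutionExists_left _ h₁ h₂.locallyIntegrable y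
    · exact ae_of_all _ fun y => hc₂.norm.convolutionExists_left _ h₂.norm hfn y
    · refine hc₁.norm.convolutionExists_left _ h₁.norm ?_ y
      exact (hc₂.norm.continuous_convolution_left _ h₂.norm hfn).locallyIntegrable
  rw [← assoc _ _ h₁ hc₁ h₂ hc₂, ← assoc _ _ h₂ hc₂ h₁ hc₁]
  congr 1
  ext y
  rw [cv_eq_flip]
  simp only [cv, mul_comm]

/-- `y` is a Lebesgue point of `u`. -/
def Leb (u : En n → ℝ) (y : En n) : Prop :=
  Tendsto (fun r : ℝ => ENNReal.ofReal (1 / r ^ n) * ∫⁻ z in Metric.ball y r, ‖u z - u y‖ₑ)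
    (𝓝[>] 0) (𝓝 0)

lemma ae_leb {u : En n → ℝ} (hu : LocallyIntegrable u volume) : ∀ᵐ y, Leb u y := by
  filter_upwards [(Besicovitch.vitaliFamily (volume : Measure (En n))).ae_tendsto_lintegral_enorm_sub_div hu]
    with y hy
  have h1 := hy.comp (Besicovitch.tendsto_filterAt volume y)
  have hω : volume (Metric.ball (0 : En n) 1) ≠ ⊤ := measure_ball_lt_top.ne
  have h2 := ENNReal.Tendsto.const_mul h1 (Or.inr hω)
  rw [mul_zero] at h2
  refine tendsto_of_tendsto_of_tendsto_of_le_of_le' tendsto_const_nhds h2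
    (Eventually.of_forall fun _ => zero_le) ?_
  filter_upwards [self_mem_nhdsWithin] with r hr
  have hr : 0 < r := hr
  have hω0 : volume (Metric.ball (0 : En n) 1) ≠ 0 := (Metric.measure_ball_pos _ _ one_pos).ne'
  simp only [Function.comp]
  rw [Measure.addHaar_closedBall volume y hr.le, finrank_euclideanSpace_fin, ENNReal.div_eq_inv_mul,
    ENNReal.mul_inv (Or.inr hω) (Or.inr hω0), one_div, ENNReal.ofReal_inv_of_pos (by positivity)]
  calc (ENNReal.ofReal (r ^ n))⁻¹ * ∫⁻ z in Metric.ball y r, ‖u z - u y‖ₑ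
      ≤ (ENNReal.ofReal (r ^ n))⁻¹ * ∫⁻ z in Metric.closedBall y r, ‖u z - u y‖ₑ := by
        gcongr
        exact Metric.ball_subset_closedBall
    _ = _ := by
      rw [mul_left_comm, mul_assoc, ← mul_assoc (volume (Metric.ball (0 : En n) 1))⁻¹, ENNReal.inv_mul_cancel hω0 hω, one_mul]

lemma kDiff_succ (k : ℕ) (F : En n → ℝ) (h y : En n) :
    kDiff (k + 1) F h y = kDiff k F h (y + h) - kDiff k F h y := by
  have e : kDiff k F h (y + h) = (fwdDiff 1)^[k] (fun τ : ℝ => F (y + τ • h)) 1 := by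
    rw [fwdDiff_iter_eq_sum_shift]
    unfold kDiff
    refine Finset.sum_congr rfl fun j _ => ?_
    simp [add_smul, add_assoc]
  rw [e, kDiff_eq_fwdDiff, kDiff_eq_fwdDiff, Function.iterate_succ_apply', fwdDiff, zero_add]

lemma enorm_kDiff_sub_kDiff_le (k : ℕ) (f F : En n → ℝ) (h x : En n) :
    ‖kDiff k f h x - kDiff k F h x‖ₑ ≤ ∑ j ∈ Finset.range (k + 1),
      ENNReal.ofReal (2 ^ k) * ‖f (x + (j : ℝ) • h) - F (x + (j : ℝ) • h)‖ₑ := by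
  unfold kDiff
  rw [← Finset.sum_sub_distrib]
  simp_rw [← mul_sub]
  refine (enorm_sum_le _ _).trans (Finset.sum_le_sum fun j _ => ?_)
  rw [enorm_mul]
  gcongr
  rw [← ofReal_norm]
  refine ENNReal.ofReal_le_ofReal ?_
  rw [norm_mul, norm_pow, norm_neg, norm_one, one_pow, one_mul, Real.norm_natCast]
  exact_mod_cast Nat.choose_le_two_pow k j

/-- The constant of the local polynomial approximation. -/
noncomputable def msum (n k : ℕ) : ℝ := ∑ α ∈ idx n k, (Nat.multinomial Finset.univ α : ℝ)

lemma msum_nonneg (n k : ℕ) : 0 ≤ msum n k := Finset.sum_nonneg fun _ _ => by positivity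

lemma enorm_kDiff_ker_sub_le {k : ℕ} {f : En n → ℝ} {g : (Fin n → ℕ) → En n → ℝ}
    (hf : LocallyIntegrable f volume) (hg : HasWeakDerivs k f g) {φ : En n → ℝ} (hφ : Smooth φ)
    (hc : HasCompactSupport φ) (h1 : ∫ z, φ z = 1) (hR : ∀ z, 1 ≤ ‖z‖ → φ z = 0) {A : ℝ}
    (hA : ∀ ρ, 0 < ρ → ∀ z, |ker (k + 1) φ ρ z| ≤ A / ρ ^ n) (a : (Fin n → ℕ) → ℝ) {ρ s : ℝ}
    (hs : 0 < s) (hsρ : s ≤ ρ) (hρs : ρ ≤ 2 * s) (h y y₀ : En n) (hh : ‖h‖ ≤ ρ)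
    (hy : ‖y - y₀‖ ≤ ρ) :
    ‖kDiff k (cv (ker (k + 1) φ s) f) h y - form k a h‖ₑ ≤
      ENNReal.ofReal (msum n k * (2 ^ n * A) * ρ ^ k / ρ ^ n) *
        ∫⁻ z in Metric.ball y₀ ((2 * k + 2) * ρ), dev k g a z := by
  have hρ : 0 < ρ := hs.trans_le hsρ
  have hA0 : 0 ≤ A := by
    have := (abs_nonneg _).trans (hA 1 one_pos 0)
    simpa using this
  refine (enorm_kDiff_cv_sub_le hf hg (hφ.ker (k + 1) s) (hasCompactSupport_ker hR (k + 1) hs)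
    (integral_ker hφ hc h1 (Nat.succ_pos k) hs) (hA s hs) (R := (k + 1) * s)
    (fun z hz => ker_eq_zero hR (k + 1) hs z (by push_cast; exact hz)) a h y).trans ?_
  refine mul_le_mul' (ENNReal.ofReal_le_ofReal ?_) (lintegral_mono_set (Metric.ball_subset_ball' ?_))
  · have hm : 0 ≤ (∑ α ∈ idx n k, (Nat.multinomial Finset.univ α : ℝ)) := msum_nonneg n k
    have e : A / s ^ n ≤ 2 ^ n * A / ρ ^ n := by
      rw [div_le_div_iff₀ (by positivity) (by positivity)]
      have : ρ ^ n ≤ (2 * s) ^ n := by gcongr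
      rw [mul_pow] at this
      nlinarith
    calc (∑ α ∈ idx n k, (Nat.multinomial Finset.univ α : ℝ)) * ‖h‖ ^ k * (A / s ^ n)
        ≤ (∑ α ∈ idx n k, (Nat.multinomial Finset.univ α : ℝ)) * ρ ^ k * (2 ^ n * A / ρ ^ n) := by
          gcongr
      _ = _ := by unfold msum; ring
  · rw [dist_eq_norm]
    have : (k : ℝ) * ‖h‖ ≤ k * ρ := by gcongr
    have : ((k : ℝ) + 1) * s ≤ (k + 1) * ρ := by gcongr
    nlinarith

lemma enorm_cv_half_sub_le {k : ℕ} {f : En n → ℝ} {g : (Fin n → ℕ) → En n → ℝ}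
    (hf : LocallyIntegrable f volume) (hg : HasWeakDerivs k f g) {φ : En n → ℝ} (hφ : Smooth φ)
    (hc : HasCompactSupport φ) (h1 : ∫ z, φ z = 1) (h0 : ∀ z, 0 ≤ φ z)
    (hR : ∀ z, 1 ≤ ‖z‖ → φ z = 0) {A : ℝ}
    (hA : ∀ ρ, 0 < ρ → ∀ z, |ker (k + 1) φ ρ z| ≤ A / ρ ^ n) (a : (Fin n → ℕ) → ℝ) {ρ : ℝ}
    (hρ : 0 < ρ) (y : En n) :
    ‖cv (ker (k + 1) φ (ρ / 2)) f y - cv (ker (k + 1) φ ρ) f y‖ₑ ≤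
      ENNReal.ofReal (4 * (msum n k * (2 ^ n * A)) * ρ ^ k / ρ ^ n) *
        ∫⁻ z in Metric.ball y ((2 * k + 2) * ρ), dev k g a z := by
  have hρ2 : 0 < ρ / 2 := by positivity
  set X := ENNReal.ofReal (msum n k * (2 ^ n * A) * ρ ^ k / ρ ^ n) *
        ∫⁻ z in Metric.ball y ((2 * k + 2) * ρ), dev k g a z with hX
  have hk : ∀ s, 0 < s → Smooth (ker (k + 1) φ s) := fun s _ => hφ.ker _ _
  have hck : ∀ s, 0 < s → HasCompactSupport (ker (k + 1) φ s) := fun s hs =>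
    hasCompactSupport_ker hR _ hs
  have bd : ∀ s, 0 < s → s ≤ ρ → ρ ≤ 2 * s → ∀ h : En n, ‖h‖ ≤ ρ →
      ‖kDiff (k + 1) (cv (ker (k + 1) φ s) f) h y‖ₑ ≤ X + X := by
    intro s hs hsρ hρs h hh
    have e : kDiff (k + 1) (cv (ker (k + 1) φ s) f) h y =
        (kDiff k (cv (ker (k + 1) φ s) f) h (y + h) - form k a h) -
        (kDiff k (cv (ker (k + 1) φ s) f) h y - form k a h) := by rw [kDiff_succ]; ring
    rw [e]
    refine (enorm_sub_le).trans (add_le_add ?_ ?_)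
    · exact enorm_kDiff_ker_sub_le hf hg hφ hc h1 hR hA a hs hsρ hρs h (y + h) y hh (by simpa using hh)
    · exact enorm_kDiff_ker_sub_le hf hg hφ hc h1 hR hA a hs hsρ hρs h y y hh (by simpa using hρ.le)
  have e : cv (ker (k + 1) φ (ρ / 2)) f y - cv (ker (k + 1) φ ρ) f y =
      (cv (ker (k + 1) φ (ρ / 2)) f y - cv (ker (k + 1) φ ρ) (cv (ker (k + 1) φ (ρ / 2)) f) y) -
      (cv (ker (k + 1) φ ρ) f y - cv (ker (k + 1) φ (ρ / 2)) (cv (ker (k + 1) φ ρ) f) y) := by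
    rw [cv_comm (hk _ hρ).continuous (hck _ hρ) (hk _ hρ2).continuous (hck _ hρ2) hf]
    ring
  rw [e]
  have hF : ∀ s, 0 < s → Continuous (cv (ker (k + 1) φ s) f) := fun s hs =>
    ((hk s hs).cv (hck s hs) hf).continuous
  refine (enorm_sub_le).trans ((add_le_add
    (enorm_sub_cv_ker_le hφ hc h1 h0 hR (k + 1) hρ (hF _ hρ2) y (X + X)
      fun h hh => bd _ hρ2 (by linarith) (by linarith) h hh)
    (enorm_sub_cv_ker_le hφ hc h1 h0 hR (k + 1) hρ2 (hF _ hρ) y (X + X)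
      fun h hh => bd _ hρ le_rfl (by linarith) h (hh.trans (by linarith)))).trans ?_)
  have e4 : ENNReal.ofReal (4 * (msum n k * (2 ^ n * A)) * ρ ^ k / ρ ^ n) =
      4 * ENNReal.ofReal (msum n k * (2 ^ n * A) * ρ ^ k / ρ ^ n) := by
    rw [mul_assoc 4, mul_div_assoc 4, ENNReal.ofReal_mul (by norm_num)]
    simp
  rw [e4, mul_assoc, ← hX]
  apply le_of_eq
  ring

lemma tendsto_cv_ker {k : ℕ} {f : En n → ℝ} (hf : LocallyIntegrable f volume)
    {φ : En n → ℝ} (hφ : Smooth φ)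
    (hc : HasCompactSupport φ) (h1 : ∫ z, φ z = 1) (hR : ∀ z, 1 ≤ ‖z‖ → φ z = 0) {A : ℝ}
    (hA : ∀ ρ, 0 < ρ → ∀ z, |ker (k + 1) φ ρ z| ≤ A / ρ ^ n) {y : En n} (hy : Leb f y) :
    Tendsto (fun ρ => cv (ker (k + 1) φ ρ) f y) (𝓝[>] 0) (𝓝 (f y)) := by
  have hA0 : 0 ≤ A := by
    have := (abs_nonneg _).trans (hA 1 one_pos 0)
    simpa using this
  have hk0 : (0 : ℝ) < k + 1 := by positivity
  have hsc : Tendsto (fun ρ : ℝ => (k + 1 : ℝ) * ρ) (𝓝[>] 0) (𝓝[>] 0) := by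
    refine tendsto_nhdsWithin_iff.2 ⟨?_, ?_⟩
    · have : Tendsto (fun ρ : ℝ => (k + 1 : ℝ) * ρ) (𝓝 0) (𝓝 ((k + 1 : ℝ) * 0)) :=
        (continuous_const.mul continuous_id).tendsto 0
      rw [mul_zero] at this
      exact this.mono_left nhdsWithin_le_nhds
    · filter_upwards [self_mem_nhdsWithin] with ρ hρ
      exact mul_pos hk0 hρ
  have h2 := ENNReal.Tendsto.const_mul (hy.comp hsc)
    (Or.inr (ENNReal.ofReal_ne_top (r := A * (k + 1) ^ n)))
  rw [mul_zero] at h2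
  rw [tendsto_iff_edist_tendsto_0]
  refine tendsto_of_tendsto_of_tendsto_of_le_of_le' tendsto_const_nhds h2
    (Eventually.of_forall fun _ => zero_le) ?_
  filter_upwards [self_mem_nhdsWithin] with ρ hρ
  have hρ : 0 < ρ := hρ
  rw [edist_eq_enorm_sub]
  refine (enorm_cv_sub_le (hφ.ker (k + 1) ρ).continuous (hasCompactSupport_ker hR _ hρ) hf
    (integral_ker hφ hc h1 (Nat.succ_pos k) hρ) (hA ρ hρ) (R := (k + 1) * ρ)
    (fun z hz => ker_eq_zero hR (k + 1) hρ z (by push_cast; exact hz)) (f y) y).trans ?_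
  simp only [Function.comp]
  rw [← mul_assoc, ← ENNReal.ofReal_mul (by positivity)]
  refine mul_le_mul_left (ENNReal.ofReal_le_ofReal (le_of_eq ?_)) _
  rw [mul_pow]
  field_simp

theorem enorm_kDiff_sub_form_le (n k : ℕ) : ∃ C : ℝ, 0 < C ∧
    ∀ (f : En n → ℝ) (g : (Fin n → ℕ) → En n → ℝ), LocallyIntegrable f volume →
    HasWeakDerivs k f g → ∀ (a : (Fin n → ℕ) → ℝ) (x h : En n) (ρ : ℝ), 0 < ρ → ‖h‖ ≤ ρ →
    (∀ j ∈ Finset.range (k + 1), Leb f (x + (j : ℝ) • h)) →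
    ‖kDiff k f h x - form k a h‖ₑ ≤ ∑ j ∈ Finset.range (k + 1), ∑' i : ℕ,
      ENNReal.ofReal (C * (ρ / 2 ^ i) ^ k / (ρ / 2 ^ i) ^ n) *
        ∫⁻ z in Metric.ball (x + (j : ℝ) • h) ((2 * k + 2) * (ρ / 2 ^ i)), dev k g a z := by
  obtain ⟨φ, hφ, hc, h1, h0, hR, A, hA'⟩ := exists_bump n
  obtain ⟨B, hA⟩ : ∃ B, ∀ ρ, 0 < ρ → ∀ z, |ker (k + 1) φ ρ z| ≤ B / ρ ^ n :=
    ⟨_, fun ρ hρ z => abs_ker_le h0 hA' (k + 1) hρ z⟩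
  have hB0 : 0 ≤ B := by
    have := (abs_nonneg _).trans (hA 1 one_pos 0)
    simpa using this
  set D := msum n k * (2 ^ n * B) with hD
  have hD0 : 0 ≤ D := mul_nonneg (msum_nonneg n k) (by positivity)
  refine ⟨1 + D + 2 ^ k * (4 * D), by positivity, ?_⟩
  intro f g hf hg a x h ρ hρ hh hL
  set E : ℝ → En n → ℝ≥0∞ := fun r y => ENNReal.ofReal (r ^ k / r ^ n) *
    ∫⁻ z in Metric.ball y ((2 * k + 2) * r), dev k g a z with hE
  have hri : ∀ i : ℕ, 0 < ρ / 2 ^ i := fun i => by positivity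
  have resc : ∀ (c r : ℝ), 0 ≤ c → ∀ y, ENNReal.ofReal (c * r ^ k / r ^ n) *
    ∫⁻ z in Metric.ball y ((2 * k + 2) * r), dev k g a z = ENNReal.ofReal c * E r y := by
    intro c r hc0 y
    rw [hE, mul_div_assoc, ENNReal.ofReal_mul hc0, mul_assoc]
  have tele : ∀ y, Leb f y → ‖f y - cv (ker (k + 1) φ ρ) f y‖ₑ ≤
      ENNReal.ofReal (4 * D) * ∑' i : ℕ, E (ρ / 2 ^ i) y := by
    intro y hy
    have ht : Tendsto (fun i : ℕ => cv (ker (k + 1) φ (ρ / 2 ^ i)) f y) atTop (𝓝 (f y)) := by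
      refine (tendsto_cv_ker hf hφ hc h1 hR hA hy).comp (tendsto_nhdsWithin_iff.2 ⟨?_, ?_⟩)
      · have := (tendsto_pow_atTop_nhds_zero_of_lt_one (r := (1 / 2 : ℝ)) (by norm_num)
          (by norm_num)).const_mul ρ
        rw [mul_zero] at this
        refine this.congr fun i => ?_
        rw [one_div, inv_pow]; rfl
      · exact Eventually.of_forall hri
    have := edist_le_tsum_of_edist_le_of_tendsto₀
      (fun i : ℕ => ENNReal.ofReal (4 * D) * E (ρ / 2 ^ i) y) (fun i => ?_) ht
    · rw [edist_comm, edist_eq_enorm_sub, ENNReal.tsum_mul_left] at this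
      simpa using this
    · rw [edist_comm, edist_eq_enorm_sub, ← resc _ _ (by positivity)]
      have e : ρ / 2 ^ i.succ = ρ / 2 ^ i / 2 := by rw [pow_succ]; field_simp
      rw [e]
      exact enorm_cv_half_sub_le hf hg hφ hc h1 h0 hR hA a (hri i) y
  have e : kDiff k f h x - form k a h = (kDiff k (cv (ker (k + 1) φ ρ) f) h x - form k a h) +
      (kDiff k f h x - kDiff k (cv (ker (k + 1) φ ρ) f) h x) := by ring
  simp_rw [resc _ _ (show 0 ≤ 1 + D + 2 ^ k * (4 * D) by positivity)]
  set S : ℕ → ℝ≥0∞ := fun j => ∑' i : ℕ, E (ρ / 2 ^ i) (x + (j : ℝ) • h) with hS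
  have m1 : ‖kDiff k (cv (ker (k + 1) φ ρ) f) h x - form k a h‖ₑ ≤ ENNReal.ofReal D *
      ∑ j ∈ Finset.range (k + 1), S j := by
    refine (enorm_kDiff_ker_sub_le hf hg hφ hc h1 hR hA a hρ le_rfl (by linarith) h x x hh
      (by simpa using hρ.le)).trans ?_
    rw [← hD, resc _ _ hD0]
    gcongr
    refine le_trans ?_ (Finset.single_le_sum (f := S) (fun _ _ => zero_le)
      (Finset.mem_range.2 (Nat.succ_pos k)))
    rw [hS]
    refine le_trans (le_of_eq ?_) (ENNReal.le_tsum 0)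
    simp
  have m2 : ‖kDiff k f h x - kDiff k (cv (ker (k + 1) φ ρ) f) h x‖ₑ ≤
      ENNReal.ofReal (2 ^ k * (4 * D)) * ∑ j ∈ Finset.range (k + 1), S j := by
    refine (enorm_kDiff_sub_kDiff_le k f _ h x).trans ?_
    rw [ENNReal.ofReal_mul (by positivity), mul_assoc, Finset.mul_sum, Finset.mul_sum]
    refine Finset.sum_le_sum fun j hj => ?_
    gcongr
    exact tele _ (hL j hj)
  rw [e]
  refine (enorm_add_le _ _).trans ((add_le_add m1 m2).trans ?_)
  rw [← add_mul, ← ENNReal.ofReal_add hD0 (by positivity)]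
  simp_rw [ENNReal.tsum_mul_left, ← Finset.mul_sum]
  gcongr
  linarith

/-- The volume of the unit ball. -/
noncomputable def om (n : ℕ) : ℝ := (volume (Metric.ball (0 : En n) 1)).toReal

lemma om_pos (n : ℕ) : 0 < om n :=
  ENNReal.toReal_pos (Metric.measure_ball_pos _ _ one_pos).ne' measure_ball_lt_top.ne

lemma volume_ball (y : En n) {r : ℝ} (hr : 0 < r) :
    volume (Metric.ball y r) = ENNReal.ofReal (om n * r ^ n) := by
  rw [Measure.addHaar_ball_of_pos volume y hr, finrank_euclideanSpace_fin, mul_comm (om n),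
    ENNReal.ofReal_mul (by positivity), om, ENNReal.ofReal_toReal measure_ball_lt_top.ne]

lemma measurable_lintegral_ball {v : En n → ℝ≥0∞} (hv : Measurable v) {Y : En n → En n}
    (hY : Measurable Y) (r : ℝ) : Measurable fun h => ∫⁻ z in Metric.ball (Y h) r, v z := by
  have hs : MeasurableSet {p : En n × En n | dist p.2 (Y p.1) < r} :=
    measurableSet_lt (measurable_snd.dist (hY.comp measurable_fst)) measurable_const
  have : (fun h => ∫⁻ z in Metric.ball (Y h) r, v z) =
      fun h => ∫⁻ z, {p : En n × En n | dist p.2 (Y p.1) < r}.indicator (fun p => v p.2) (h, z) := by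
    ext h
    rw [← lintegral_indicator Metric.isOpen_ball.measurableSet]
    rfl
  rw [this]
  exact ((hv.comp measurable_snd).indicator hs).lintegral_prod_right'

lemma lintegral_lintegral_ball_le {v : En n → ℝ≥0∞} (hv : Measurable v) (x : En n) {r ρ R : ℝ}
    (hr : 0 < r) (j : ℕ) (hj : 0 < j) (hR : r + j * ρ ≤ R) :
    ∫⁻ h in Metric.ball (0 : En n) ρ, ∫⁻ z in Metric.ball (x + (j : ℝ) • h) r, v z ≤
      ENNReal.ofReal (om n * r ^ n) * ∫⁻ z in Metric.ball x R, v z := by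
  have hj1 : (1 : ℝ) ≤ j := by exact_mod_cast hj
  have hs : MeasurableSet {p : En n × En n | dist p.2 (x + (j : ℝ) • p.1) < r} :=
    measurableSet_lt (by fun_prop) measurable_const
  have key : ∀ h ∈ Metric.ball (0 : En n) ρ, ∫⁻ z in Metric.ball (x + (j : ℝ) • h) r, v z ≤
      ∫⁻ z in Metric.ball x R, {p : En n × En n | dist p.2 (x + (j : ℝ) • p.1) < r}.indicator
        (fun p => v p.2) (h, z) := by
    intro h hh
    rw [← lintegral_indicator Metric.isOpen_ball.measurableSet,
      ← lintegral_indicator Metric.isOpen_ball.measurableSet]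
    refine lintegral_mono fun z => ?_
    by_cases hz : z ∈ Metric.ball (x + (j : ℝ) • h) r
    · have hz2 : z ∈ Metric.ball x R := by
        refine Metric.ball_subset_ball' ?_ hz
        rw [dist_eq_norm, add_sub_cancel_left, norm_smul, Real.norm_natCast]
        refine le_trans ?_ hR
        have := (mem_ball_zero_iff.1 hh).le
        gcongr
      rw [indicator_of_mem hz, indicator_of_mem hz2, indicator_of_mem]
      exact hz
    · rw [indicator_of_notMem hz]
      exact zero_le
  refine (setLIntegral_mono' Metric.isOpen_ball.measurableSet key).trans ?_
  refine (lintegral_mono' Measure.restrict_le_self le_rfl).trans ?_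
  rw [lintegral_lintegral_swap (f := fun h z => {p : En n × En n |
    dist p.2 (x + (j : ℝ) • p.1) < r}.indicator (fun p => v p.2) (h, z))
      ((hv.comp measurable_snd).indicator hs).aemeasurable,
    ← lintegral_const_mul _ hv]
  refine setLIntegral_mono' Metric.isOpen_ball.measurableSet fun z _ => ?_
  have e : ∀ h : En n, {p : En n × En n | dist p.2 (x + (j : ℝ) • p.1) < r}.indicator
      (fun p => v p.2) (h, z) = (Metric.ball ((j : ℝ)⁻¹ • (z - x)) (r / j)).indicator
        (fun _ => v z) h := by
    intro h
    have : (dist z (x + (j : ℝ) • h) < r) ↔ h ∈ Metric.ball ((j : ℝ)⁻¹ • (z - x)) (r / j) := by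
      rw [Metric.mem_ball, lt_div_iff₀ (by positivity), dist_comm, dist_eq_norm, dist_eq_norm]
      have e2 : x + (j : ℝ) • h - z = (j : ℝ) • (h - (j : ℝ)⁻¹ • (z - x)) := by
        rw [smul_sub, smul_inv_smul₀ (by positivity)]; abel
      rw [e2, norm_smul, Real.norm_natCast, mul_comm]
    simp only [indicator_apply, mem_ofPred_eq, this]
  simp_rw [e]
  rw [lintegral_indicator_const Metric.isOpen_ball.measurableSet, volume_ball _ (by positivity),
    mul_comm]
  have := om_pos n
  gcongr
  exact div_le_self hr.le hj1

lemma measure_piece_le {v : En n → ℝ≥0∞} (hv : Measurable v) (x : En n) {r ρ R : ℝ} {k : ℕ}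
    (hr : 0 < r) (hρ : 0 < ρ) (hρR : ρ ≤ R) (j : ℕ) (hj : j ≤ k) (hR : r + k * ρ ≤ R) {M : ℝ}
    (hM : 0 ≤ M) (H : ∀ r', 0 < r' → r' ≤ R → ∫⁻ z in Metric.ball x r', v z ≤ ENNReal.ofReal (M * r' ^ n))
    {N e : ℝ} (hN : 0 < N) (he : 0 ≤ e) :
    volume {h : En n | ‖h‖ < ρ ∧ ENNReal.ofReal N < ∫⁻ z in Metric.ball (x + (j : ℝ) • h) r, v z} ≤
      ENNReal.ofReal (om n * r ^ n * (M * R ^ n / N) ^ (1 + e)) := by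
  have hR0 : 0 < R := hρ.trans_le hρR
  have hω := om_pos n
  have hjk : (j : ℝ) ≤ k := by exact_mod_cast hj
  have hjR : r + j * ρ ≤ R := le_trans (by gcongr) hR
  rcases eq_empty_or_nonempty
    {h : En n | ‖h‖ < ρ ∧ ENNReal.ofReal N < ∫⁻ z in Metric.ball (x + (j : ℝ) • h) r, v z} with h0 | ⟨h₀, hh₀, hN₀⟩
  · rw [h0]; simp
  have hX : 1 ≤ M * R ^ n / N := by
    rw [one_le_div hN]
    have : ENNReal.ofReal N < ENNReal.ofReal (M * R ^ n) := by
      refine hN₀.trans_le (le_trans (lintegral_mono_set (Metric.ball_subset_ball' ?_)) (H R hR0 le_rfl))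
      rw [dist_eq_norm, add_sub_cancel_left, norm_smul, Real.norm_natCast]
      refine le_trans ?_ hjR
      gcongr
    exact ((ENNReal.ofReal_lt_ofReal_iff_of_nonneg hN.le).1 this).le
  have hI : ∫⁻ h in Metric.ball (0 : En n) ρ, ∫⁻ z in Metric.ball (x + (j : ℝ) • h) r, v z ≤
      ENNReal.ofReal (om n * r ^ n * (M * R ^ n)) := by
    rcases Nat.eq_zero_or_pos j with rfl | hj0
    · simp only [Nat.cast_zero, zero_smul, add_zero, lintegral_const, Measure.restrict_apply_univ]
      rw [volume_ball _ hρ]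
      refine (mul_le_mul_left (H r hr (le_trans (by nlinarith) hjR)) _).trans ?_
      rw [← ENNReal.ofReal_mul (by positivity)]
      refine ENNReal.ofReal_le_ofReal ?_
      calc M * r ^ n * (om n * ρ ^ n) ≤ M * r ^ n * (om n * R ^ n) := by gcongr
        _ = _ := by ring
    · refine (lintegral_lintegral_ball_le hv x hr j hj0 hjR).trans ?_
      rw [ENNReal.ofReal_mul (p := om n * r ^ n) (by positivity)]
      gcongr
      exact H R hR0 le_rfl
  have hset : {h : En n | ‖h‖ < ρ ∧ ENNReal.ofReal N < ∫⁻ z in Metric.ball (x + (j : ℝ) • h) r, v z} ⊆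
      {h | ENNReal.ofReal N ≤ ∫⁻ z in Metric.ball (x + (j : ℝ) • h) r, v z} ∩ Metric.ball 0 ρ :=
    fun h hh => ⟨hh.2.le, mem_ball_zero_iff.2 hh.1⟩
  have hmk := mul_meas_ge_le_lintegral₀ (μ := volume.restrict (Metric.ball (0 : En n) ρ))
    (measurable_lintegral_ball hv (Y := fun h => x + (j : ℝ) • h) (by fun_prop) r).aemeasurable
    (ENNReal.ofReal N)
  rw [Measure.restrict_apply' Metric.isOpen_ball.measurableSet] at hmk
  have h3 : ENNReal.ofReal N * volume
      {h : En n | ‖h‖ < ρ ∧ ENNReal.ofReal N < ∫⁻ z in Metric.ball (x + (j : ℝ) • h) r, v z} ≤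
      ENNReal.ofReal N * ENNReal.ofReal (om n * r ^ n * (M * R ^ n / N)) := by
    refine (mul_le_mul_right (measure_mono hset) _).trans (hmk.trans (hI.trans (le_of_eq ?_)))
    rw [← ENNReal.ofReal_mul hN.le]
    congr 1
    field_simp
  refine ((ENNReal.mul_le_mul_iff_right (by simpa using hN) ENNReal.ofReal_ne_top).1 h3).trans
    (ENNReal.ofReal_le_ofReal ?_)
  have : M * R ^ n / N ≤ (M * R ^ n / N) ^ (1 + e) := Real.self_le_rpow_of_one_le hX (by linarith)
  gcongr

lemma lintegral_ball_rpow_le {u : En n → ℝ≥0∞} (hu : Measurable u) (y : En n) {r t : ℝ}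
    (hr : 0 < r) (ht : 1 ≤ t) :
    (∫⁻ z in Metric.ball y r, u z) ^ t ≤
      ENNReal.ofReal ((om n * r ^ n) ^ (t - 1)) * ∫⁻ z in Metric.ball y r, u z ^ t := by
  have hω := om_pos n
  rcases ht.eq_or_lt with rfl | ht
  · simp
  have hh := ENNReal.lintegral_mul_le_Lp_mul_Lq (volume.restrict (Metric.ball y r))
    (Real.HolderConjugate.conjExponent ht) hu.aemeasurable (g := fun _ => 1) aemeasurable_const
  simp only [Pi.mul_apply, mul_one, ENNReal.one_rpow, lintegral_const, Measure.restrict_apply_univ,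
    one_mul] at hh
  rw [volume_ball _ hr] at hh
  refine (ENNReal.rpow_le_rpow hh (by linarith)).trans (le_of_eq ?_)
  rw [ENNReal.mul_rpow_of_nonneg _ _ (by linarith), ← ENNReal.rpow_mul, ← ENNReal.rpow_mul,
    one_div_mul_cancel (by linarith), ENNReal.rpow_one, mul_comm,
    ENNReal.ofReal_rpow_of_nonneg (by positivity)]
  · congr 3
    rw [Real.conjExponent]
    field_simp
  · have : 0 < t.conjExponent := by unfold Real.conjExponent; exact div_pos (by linarith) (by linarith)
    positivity

lemma level_algebra {ω R₀ R₁ C₀ c M ρ μ τ t s β : ℝ} (n k : ℕ) (hω : 0 < ω) (hR₀ : 0 < R₀)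
    (hR₁ : 0 < R₁) (hC₀ : 0 < C₀) (hc : 0 < c) (hM : 0 < M) (hρ : 0 < ρ) (hμ : 0 < μ) (hτ : 0 < τ)
    (ht : 0 < t) :
    ω * (R₀ * (ρ * τ)) ^ n * (M * (R₁ * ρ) ^ n / ((c * τ ^ β * μ * (ρ * τ) ^ n / (C₀ * (ρ * τ) ^ k)) ^ t /
      (ω * (R₀ * (ρ * τ)) ^ n) ^ (t - 1))) ^ (1 + (s / t - 1)) =
    ω * R₀ ^ n * (R₁ ^ (n / t) * (ω * R₀ ^ n) ^ (1 - 1 / t) * C₀ / c) ^ s *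
      (ρ ^ n * (M ^ (1 / t) * ρ ^ k / μ) ^ s) * τ ^ (s * (k - n / t - β) + n) := by
  apply Real.log_injOn_pos
  · rw [mem_Ioi]; positivity
  · rw [mem_Ioi]; positivity
  have e1 : Real.log ((c * τ ^ β * μ * (ρ * τ) ^ n / (C₀ * (ρ * τ) ^ k)) ^ t) =
    t * (Real.log c + β * Real.log τ + Real.log μ + n * (Real.log ρ + Real.log τ) - (Real.log C₀ +
      k * (Real.log ρ + Real.log τ))) := by
    rw [Real.log_rpow (by positivity), Real.log_div (by positivity) (by positivity), Real.log_mul (by positivity) (by positivity), Real.log_mul (by positivity) (by positivity), Real.log_mul (by positivity) (by positivity), Real.log_mul (by positivity) (by positivity), Real.log_pow, Real.log_pow,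
      Real.log_mul (by positivity) (by positivity), Real.log_rpow hτ]
  have e2 : Real.log (ω * (R₀ * (ρ * τ)) ^ n) = Real.log ω + n * (Real.log R₀ + (Real.log ρ + Real.log τ)) := by
    rw [Real.log_mul (by positivity) (by positivity), Real.log_pow,
      Real.log_mul (by positivity) (by positivity), Real.log_mul (by positivity) (by positivity)]
  rw [Real.log_mul (by positivity) (by positivity), e2, Real.log_rpow (by positivity),
    Real.log_div (by positivity) (by positivity), Real.log_div (by positivity) (by positivity), e1,
    Real.log_rpow (by positivity), e2, Real.log_mul (by positivity) (by positivity), Real.log_pow,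
    Real.log_mul (by positivity) (by positivity), Real.log_mul (by positivity) (by positivity),
    Real.log_mul (by positivity) (by positivity), Real.log_mul (by positivity) (by positivity),
    Real.log_mul (by positivity) (by positivity),
    Real.log_rpow (by positivity), Real.log_div (by positivity) (by positivity),
    Real.log_mul (by positivity) (by positivity), Real.log_mul (by positivity) (by positivity),
    Real.log_rpow hR₁, Real.log_rpow (by positivity), Real.log_mul (by positivity) (by positivity),
    Real.log_mul (by positivity) (by positivity), Real.log_rpow (by positivity),
    Real.log_div (by positivity) (by positivity), Real.log_mul (by positivity) (by positivity),
    Real.log_rpow hM, Real.log_rpow hτ, Real.log_pow, Real.log_pow, Real.log_pow]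
  field_simp
  ring

lemma ae_comp_add_smul {P : En n → Prop} (h : ∀ᵐ y, P y) (x : En n) {c : ℝ} (hc : c ≠ 0) :
    ∀ᵐ v : En n, P (x + c • v) := by
  have h1 : ∀ᵐ v : En n, P (x + v) :=
    (measurePreserving_add_left volume x).quasiMeasurePreserving.ae h
  rw [ae_iff] at h1 ⊢
  have := Measure.addHaar_preimage_smul (volume : Measure (En n)) hc {v | ¬ P (x + v)}
  rw [h1, mul_zero] at this
  exact this

lemma ae_forall_leb {f : En n → ℝ} (hf : LocallyIntegrable f volume) {x : En n} (hx : Leb f x)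
    (s : Finset ℕ) : ∀ᵐ h : En n, ∀ j ∈ s, Leb f (x + (j : ℝ) • h) := by
  rw [Finset.eventually_all]
  intro j _
  rcases Nat.eq_zero_or_pos j with rfl | hj
  · simpa using hx
  · exact ae_comp_add_smul (ae_leb hf) x (by positivity)

lemma measurable_dev {k : ℕ} {g : (Fin n → ℕ) → En n → ℝ} (hg : ∀ α, Measurable (g α))
    (a : (Fin n → ℕ) → ℝ) : Measurable (dev k g a) := by
  unfold dev
  exact Finset.measurable_fun_sum _ fun α _ => ((hg α).sub_const _).enorm

theorem measure_level_le (n k : ℕ) {t s : ℝ} (ht : 1 ≤ t) (hts : t ≤ s)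
    (hn : n * (1 / t - 1 / s) < k) : ∃ C : ℝ, 0 < C ∧
    ∀ (f : En n → ℝ) (g : (Fin n → ℕ) → En n → ℝ), LocallyIntegrable f volume →
    HasWeakDerivs k f g → (∀ α, Measurable (g α)) → ∀ (a : (Fin n → ℕ) → ℝ) (x : En n)
    (ρ M μ : ℝ), 0 < ρ → 0 < M → 0 < μ → Leb f x →
    (∀ r, 0 < r → r ≤ (3 * k + 2) * ρ →
      ∫⁻ z in Metric.ball x r, dev k g a z ^ t ≤ ENNReal.ofReal (M * r ^ n)) →
    volume {h : En n | ‖h‖ < ρ ∧ μ < |kDiff k f h x - form k a h|} ≤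
      ENNReal.ofReal (C * (ρ ^ n * (M ^ (1 / t) * ρ ^ k / μ) ^ s)) := by
  obtain ⟨C₀, hC₀, core⟩ := enorm_kDiff_sub_form_le n k
  have ht0 : 0 < t := by linarith
  have hs0 : 0 < s := by linarith
  have hω := om_pos n
  set β : ℝ := (k - n * (1 / t - 1 / s)) / 2 with hβ
  have hβ0 : 0 < β := by rw [hβ]; linarith
  set b : ℝ := (1 / 2 : ℝ) ^ β with hb
  have hb0 : 0 < b := by positivity
  have hb1 : b < 1 := Real.rpow_lt_one (by norm_num) (by norm_num) hβ0
  set c : ℝ := (1 - b) / (k + 1) with hc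
  have hc0 : 0 < c := div_pos (by linarith) (by positivity)
  set d : ℝ := (1 / 2 : ℝ) ^ (s * β) with hd
  have hd0 : 0 < d := by positivity
  have hd1 : d < 1 := Real.rpow_lt_one (by norm_num) (by norm_num) (by positivity)
  set C₁ : ℝ := om n * (2 * k + 2) ^ n *
    ((3 * k + 2) ^ (n / t) * (om n * (2 * k + 2) ^ n) ^ (1 - 1 / t) * C₀ / c) ^ s with hC₁
  have hC₁0 : 0 < C₁ := by positivity
  refine ⟨(k + 1) * (C₁ * (1 - d)⁻¹), mul_pos (by positivity) (mul_pos hC₁0 (inv_pos.2 (by linarith))), ?_⟩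
  intro f g hf hg hgm a x ρ M μ hρ hM hμ hx H
  have hu := measurable_dev (k := k) hgm a
  have hv : Measurable fun z => dev k g a z ^ t := hu.pow_const t
  set X : ℝ := ρ ^ n * (M ^ (1 / t) * ρ ^ k / μ) ^ s with hX
  have hX0 : 0 < X := by positivity
  let r : ℕ → ℝ := fun i => (2 * k + 2) * (ρ / 2 ^ i)
  have hri : ∀ i, 0 < ρ / 2 ^ i := fun i => by positivity
  have hr : ∀ i, 0 < r i := fun i => by positivity
  let Nq : ℕ → ℝ := fun i => c * ((1 / 2 : ℝ) ^ i) ^ β * μ * (ρ * (1 / 2) ^ i) ^ n / (C₀ * (ρ * (1 / 2) ^ i) ^ k)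
  have hNq : ∀ i, 0 < Nq i := fun i => by positivity
  have hρ2 : ∀ i : ℕ, ρ / 2 ^ i = ρ * (1 / 2) ^ i := fun i => by rw [one_div, inv_pow]; rfl
  let N : ℕ → ℝ := fun i => Nq i ^ t / (om n * r i ^ n) ^ (t - 1)
  have hN : ∀ i, 0 < N i := fun i => div_pos (Real.rpow_pos_of_pos (hNq i) _)
    (Real.rpow_pos_of_pos (mul_pos hω (pow_pos (hr i) n)) _)
  let T : ℕ → ℕ → Set (En n) := fun j i => {h | ‖h‖ < ρ ∧
    ENNReal.ofReal (N i) < ∫⁻ z in Metric.ball (x + (j : ℝ) • h) (r i), dev k g a z ^ t}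
  have hT : ∀ j ∈ Finset.range (k + 1), ∀ i, volume (T j i) ≤ ENNReal.ofReal (C₁ * X * d ^ i) := by
    intro j hj i
    have hri' : ρ / 2 ^ i ≤ ρ := div_le_self hρ.le (one_le_pow₀ (by norm_num))
    refine (measure_piece_le hv x (hr i) hρ (R := (3 * k + 2) * ρ) (k := k) (by nlinarith) j
      (Nat.lt_succ_iff.1 (Finset.mem_range.1 hj)) ?_ hM.le H (hN i) (e := s / t - 1) ?_).trans ?_
    · simp only [r]; nlinarith
    · rw [sub_nonneg, one_le_div ht0]; exact hts
    · refine ENNReal.ofReal_le_ofReal (le_of_eq ?_)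
      simp only [N, r, Nq, hρ2]
      rw [level_algebra n k hω (by positivity) (by positivity) hC₀ hc0 hM hρ hμ (by positivity) ht0]
      rw [← hC₁, ← hX]
      congr 1
      rw [hd, ← Real.rpow_natCast, ← Real.rpow_natCast, ← Real.rpow_mul (by norm_num),
        ← Real.rpow_mul (by norm_num), mul_comm (s * β)]
      congr 2
      have : β = k - n * (1 / t - 1 / s) - β := by rw [hβ]; ring
      have h2 : s * (n / s) = n := by field_simp
      linear_combination s * this - h2
  have hsub : ∀ᵐ h : En n, h ∈ {h : En n | ‖h‖ < ρ ∧ μ < |kDiff k f h x - form k a h|} →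
      h ∈ ⋃ j ∈ Finset.range (k + 1), ⋃ i, T j i := by
    filter_upwards [ae_forall_leb hf hx (Finset.range (k + 1))] with h hL hh
    by_contra hcon
    simp only [mem_iUnion, not_exists] at hcon
    have bound : ∀ j ∈ Finset.range (k + 1), ∀ i,
        ENNReal.ofReal (C₀ * (ρ / 2 ^ i) ^ k / (ρ / 2 ^ i) ^ n) *
        ∫⁻ z in Metric.ball (x + (j : ℝ) • h) ((2 * k + 2) * (ρ / 2 ^ i)), dev k g a z ≤
          ENNReal.ofReal (c * μ * b ^ i) := by
      intro j hj i
      have h1 := hcon j hj i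
      have h2 : ∫⁻ z in Metric.ball (x + (j : ℝ) • h) (r i), dev k g a z ^ t ≤ ENNReal.ofReal (N i) := by
        by_contra h3
        exact h1 ⟨hh.1, not_le.1 h3⟩
      have h3 := (lintegral_ball_rpow_le hu (x + (j : ℝ) • h) (hr i) ht).trans
        (mul_le_mul_right h2 _)
      have hA : 0 < (om n * r i ^ n) ^ (t - 1) :=
        Real.rpow_pos_of_pos (mul_pos hω (pow_pos (hr i) n)) _
      rw [← ENNReal.ofReal_mul hA.le, mul_div_cancel₀ _ hA.ne',
        ← ENNReal.ofReal_rpow_of_pos (hNq i), ENNReal.rpow_le_rpow_iff ht0] at h3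
      refine (mul_le_mul_right h3 _).trans ?_
      rw [← ENNReal.ofReal_mul (by positivity)]
      refine ENNReal.ofReal_le_ofReal (le_of_eq ?_)
      simp only [Nq, hρ2]
      rw [hb, ← Real.rpow_natCast ((1 / 2 : ℝ) ^ β), ← Real.rpow_mul (by norm_num), mul_comm β,
        Real.rpow_mul (by norm_num), Real.rpow_natCast]
      field_simp
    have h5 := core f g hf hg a x h ρ hρ hh.1.le hL
    have h6 : ∑ j ∈ Finset.range (k + 1), ∑' i : ℕ,
        ENNReal.ofReal (C₀ * (ρ / 2 ^ i) ^ k / (ρ / 2 ^ i) ^ n) *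
        ∫⁻ z in Metric.ball (x + (j : ℝ) • h) ((2 * k + 2) * (ρ / 2 ^ i)), dev k g a z ≤
        ENNReal.ofReal μ := by
      refine (Finset.sum_le_sum fun j hj => ENNReal.tsum_le_tsum (bound j hj)).trans ?_
      rw [← ENNReal.ofReal_tsum_of_nonneg (fun i => by positivity)
        ((summable_geometric_of_lt_one hb0.le hb1).mul_left _), tsum_mul_left,
        tsum_geometric_of_lt_one hb0.le hb1, Finset.sum_const, Finset.card_range, nsmul_eq_mul]
      rw [← ENNReal.ofReal_natCast, ← ENNReal.ofReal_mul (by positivity)]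
      refine ENNReal.ofReal_le_ofReal (le_of_eq ?_)
      rw [hc]
      have : 1 - b ≠ 0 := by linarith
      push_cast
      field_simp
    have h7 := h5.trans h6
    rw [← ofReal_norm, ENNReal.ofReal_le_ofReal_iff hμ.le, Real.norm_eq_abs] at h7
    exact absurd hh.2 (not_lt.2 h7)
  refine (measure_mono_ae hsub).trans ((measure_biUnion_finset_le _ _).trans ?_)
  have : ∀ j ∈ Finset.range (k + 1), volume (⋃ i, T j i) ≤ ENNReal.ofReal (C₁ * X * (1 - d)⁻¹) := by
    intro j hj
    refine (measure_iUnion_le _).trans ((ENNReal.tsum_le_tsum (hT j hj)).trans ?_)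
    rw [← ENNReal.ofReal_tsum_of_nonneg (fun i => by positivity)
        ((summable_geometric_of_lt_one hd0.le hd1).mul_left _), tsum_mul_left,
        tsum_geometric_of_lt_one hd0.le hd1]
  refine (Finset.sum_le_sum this).trans ?_
  rw [Finset.sum_const, Finset.card_range, nsmul_eq_mul, ← ENNReal.ofReal_natCast,
    ← ENNReal.ofReal_mul (by positivity)]
  refine ENNReal.ofReal_le_ofReal (le_of_eq ?_)
  push_cast
  ring

lemma lintegral_Ioc_rpow {δ : ℝ} (hδ : 0 < δ) {N : ℝ} (hN : 0 ≤ N) :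
    ∫⁻ l in Ioc 0 N, ENNReal.ofReal (l ^ (δ - 1)) = ENNReal.ofReal (N ^ δ / δ) := by
  have hi : IntervalIntegrable (fun l : ℝ => l ^ (δ - 1)) volume 0 N :=
    intervalIntegral.intervalIntegrable_rpow' (by linarith)
  rw [← ofReal_integral_eq_lintegral_ofReal ((intervalIntegrable_iff_integrableOn_Ioc_of_le hN).1 hi)
    ((ae_restrict_iff' measurableSet_Ioc).2 (ae_of_all _ fun l hl => Real.rpow_nonneg hl.1.le _)),
    ← intervalIntegral.integral_of_le hN, integral_rpow (Or.inl (by linarith))]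
  simp [Real.zero_rpow hδ.ne']

/-- The layer cake weight. -/
noncomputable def layer (δ : ℝ) (w : ℝ≥0∞) : ℝ≥0∞ :=
  ∫⁻ l in Ioi (0 : ℝ), ENNReal.ofReal (l ^ (δ - 1)) * {l | ENNReal.ofReal l < w}.indicator 1 l

lemma rpow_le_layer {δ : ℝ} (hδ : 0 < δ) (w : ℝ≥0∞) : w ^ δ ≤ ENNReal.ofReal δ * layer δ w := by
  have key : ∀ N : ℝ, 0 < N → ENNReal.ofReal N ≤ w → ENNReal.ofReal N ^ δ ≤ ENNReal.ofReal δ * layer δ w := by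
    intro N hN hNw
    have : ENNReal.ofReal (N ^ δ / δ) ≤ layer δ w := by
      rw [← lintegral_Ioc_rpow hδ hN.le, ← setLIntegral_congr Ioo_ae_eq_Ioc]
      refine (setLIntegral_mono' measurableSet_Ioo fun l hl => ?_).trans
        (lintegral_mono_set (fun l hl => hl.1 : Ioo (0 : ℝ) N ⊆ Ioi 0))
      rw [indicator_of_mem]
      · simp
      · exact lt_of_lt_of_le ((ENNReal.ofReal_lt_ofReal_iff hN).2 hl.2) hNw
    rw [ENNReal.ofReal_rpow_of_pos hN]
    refine le_trans (le_of_eq ?_) (mul_le_mul_right this _)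
    rw [← ENNReal.ofReal_mul hδ.le, mul_div_cancel₀ _ hδ.ne']
  induction w with
  | top =>
    rw [ENNReal.top_rpow_of_pos hδ, top_le_iff]
    refine ENNReal.eq_top_of_forall_nnreal_le fun r => ?_
    have h := key ((r : ℝ) ^ (1 / δ) + 1) (by positivity) le_top
    refine le_trans ?_ h
    rw [ENNReal.ofReal_rpow_of_pos (by positivity), ← ENNReal.ofReal_coe_nnreal]
    refine ENNReal.ofReal_le_ofReal ?_
    calc (r : ℝ) = ((r : ℝ) ^ (1 / δ)) ^ δ := by
          rw [← Real.rpow_mul r.coe_nonneg, one_div_mul_cancel hδ.ne', Real.rpow_one]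
      _ ≤ _ := by gcongr; linarith
  | coe w =>
    rcases eq_or_ne w 0 with rfl | hw
    · simp [ENNReal.zero_rpow_of_pos hδ]
    · have := key w (by positivity) (by simp)
      simpa using this

lemma layer_le_rpow {δ : ℝ} (hδ : 0 < δ) (w : ℝ≥0∞) : layer δ w ≤ ENNReal.ofReal (1 / δ) * w ^ δ := by
  induction w with
  | top => rw [ENNReal.top_rpow_of_pos hδ, ENNReal.mul_top (by simpa using hδ)]; exact le_top
  | coe w =>
    have : layer δ w ≤ ∫⁻ l in Ioc (0 : ℝ) w, ENNReal.ofReal (l ^ (δ - 1)) := by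
      unfold layer
      rw [← lintegral_indicator measurableSet_Ioi, ← lintegral_indicator measurableSet_Ioc]
      refine lintegral_mono fun l => ?_
      by_cases h1 : l ∈ Ioi (0 : ℝ)
      · by_cases h2 : ENNReal.ofReal l < w
        · have : l ∈ Ioc (0 : ℝ) w := by
            refine ⟨h1, ?_⟩
            rw [← ENNReal.ofReal_coe_nnreal] at h2
            exact ((ENNReal.ofReal_lt_ofReal_iff_of_nonneg (le_of_lt h1)).1 h2).le
          rw [indicator_of_mem h1, indicator_of_mem this, indicator_of_mem]
          · simp
          · exact h2
        · rw [indicator_of_mem h1, indicator_of_notMem (by exact h2), mul_zero]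
          exact zero_le
      · rw [indicator_of_notMem h1]; exact zero_le
    refine this.trans (le_of_eq ?_)
    rw [lintegral_Ioc_rpow hδ w.coe_nonneg, ← ENNReal.ofReal_coe_nnreal,
      ENNReal.ofReal_rpow_of_nonneg w.coe_nonneg hδ.le, ← ENNReal.ofReal_mul (by positivity)]
    congr 1
    ring

/-- The Hardy–Littlewood maximal function, over balls with rational radii. -/
noncomputable def Mf (u : En n → ℝ≥0∞) (x : En n) : ℝ≥0∞ :=
  ⨆ r : {r : ℚ // 0 < r}, ENNReal.ofReal (1 / (r : ℝ) ^ n) * ∫⁻ z in Metric.ball x (r : ℝ), u z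

lemma measurable_Mf {u : En n → ℝ≥0∞} (hu : Measurable u) : Measurable (Mf u) :=
  Measurable.iSup fun _ => (measurable_lintegral_ball hu measurable_id _).const_mul _

lemma lintegral_ball_le_Mf (u : En n → ℝ≥0∞) (x : En n) {r : ℝ} (hr : 0 < r) :
    ∫⁻ z in Metric.ball x r, u z ≤ ENNReal.ofReal (2 ^ n * r ^ n) * Mf u x := by
  obtain ⟨q, hq1, hq2⟩ := exists_rat_btwn (show r < 2 * r by linarith)
  have hq0 : (0 : ℝ) < q := hr.trans hq1
  have hq0' : 0 < q := by exact_mod_cast hq0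
  calc ∫⁻ z in Metric.ball x r, u z ≤ ∫⁻ z in Metric.ball x q, u z :=
        lintegral_mono_set (Metric.ball_subset_ball hq1.le)
    _ = ENNReal.ofReal ((q : ℝ) ^ n) * (ENNReal.ofReal (1 / (q : ℝ) ^ n) * ∫⁻ z in Metric.ball x q, u z) := by
        rw [← mul_assoc, ← ENNReal.ofReal_mul (by positivity), mul_one_div_cancel (by positivity),
          ENNReal.ofReal_one, one_mul]
    _ ≤ ENNReal.ofReal (2 ^ n * r ^ n) * Mf u x := by
        refine mul_le_mul' (ENNReal.ofReal_le_ofReal ?_) ?_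
        · rw [← mul_pow]; gcongr
        · exact le_iSup (fun r : {r : ℚ // 0 < r} => ENNReal.ofReal (1 / (r : ℝ) ^ n) *
            ∫⁻ z in Metric.ball x (r : ℝ), u z) ⟨q, hq0'⟩

lemma weak_Mf (hn : 0 < n) (u : En n → ℝ≥0∞) {l : ℝ} (hl : 0 < l) :
    ENNReal.ofReal l * volume {x | ENNReal.ofReal l < Mf u x} ≤
      ENNReal.ofReal (om n * 4 ^ n) * ∫⁻ z, u z := by
  have hω := om_pos n
  rcases eq_or_ne (∫⁻ z, u z) ⊤ with hI | hI
  · rw [hI, ENNReal.mul_top (by simpa using by positivity)]; exact le_top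
  have ex : ∀ x ∈ {x | ENNReal.ofReal l < Mf u x}, ∃ r : ℝ, 0 < r ∧
      ENNReal.ofReal (l * r ^ n) ≤ ∫⁻ z in Metric.ball x r, u z := by
    intro x hx
    obtain ⟨r, hr⟩ := lt_iSup_iff.1 (show ENNReal.ofReal l < Mf u x from hx)
    have hr0 : (0 : ℝ) < (r : ℚ) := by exact_mod_cast r.2
    refine ⟨(r : ℚ), hr0, ?_⟩
    rw [ENNReal.ofReal_mul hl.le]
    refine (mul_le_mul_left hr.le _).trans (le_of_eq ?_)
    rw [mul_right_comm, ← ENNReal.ofReal_mul (by positivity), one_div_mul_cancel (by positivity),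
      ENNReal.ofReal_one, one_mul]
  choose! r hr0 hr using ex
  set I := (∫⁻ z, u z).toReal with hIdef
  have hbd : ∀ x ∈ {x | ENNReal.ofReal l < Mf u x}, r x ≤ max 1 (I / l) := by
    intro x hx
    rcases le_total (r x) 1 with h | h
    · exact h.trans (le_max_left _ _)
    · refine le_trans ?_ (le_max_right _ _)
      rw [le_div_iff₀ hl]
      have h1 := (hr x hx).trans (setLIntegral_le_lintegral _ _)
      rw [ENNReal.ofReal_le_iff_le_toReal hI] at h1
      refine le_trans ?_ h1
      rw [mul_comm]
      exact mul_le_mul_of_nonneg_left (le_self_pow₀ h hn.ne') hl.le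
  obtain ⟨T, hTs, hTd, hTc⟩ := Vitali.exists_disjoint_subfamily_covering_enlargement_ball
    {x | ENNReal.ofReal l < Mf u x} id r _ hbd 4 (by norm_num)
  have hTcount : T.Countable := hTd.countable_of_isOpen (fun _ _ => Metric.isOpen_ball)
    fun x hx => Metric.nonempty_ball.2 (hr0 x (hTs hx))
  have hcov : {x | ENNReal.ofReal l < Mf u x} ⊆ ⋃ b ∈ T, Metric.ball b (4 * r b) := by
    intro x hx
    obtain ⟨b, hb, hsub⟩ := hTc x hx
    exact mem_biUnion hb (hsub (Metric.mem_ball_self (hr0 x hx)))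
  have : Countable T := hTcount.to_subtype
  calc ENNReal.ofReal l * volume {x | ENNReal.ofReal l < Mf u x}
      ≤ ENNReal.ofReal l * ∑' b : T, volume (Metric.ball (b : En n) (4 * r b)) := by
        gcongr
        exact (measure_mono hcov).trans (measure_biUnion_le _ hTcount _)
    _ = ∑' b : T, ENNReal.ofReal (om n * 4 ^ n) * ENNReal.ofReal (l * r b ^ n) := by
        rw [← ENNReal.tsum_mul_left]
        refine tsum_congr fun b => ?_
        have := hr0 b (hTs b.2)
        rw [volume_ball _ (by positivity), ← ENNReal.ofReal_mul hl.le,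
          ← ENNReal.ofReal_mul (by positivity), mul_pow]
        congr 1; ring
    _ ≤ ∑' b : T, ENNReal.ofReal (om n * 4 ^ n) * ∫⁻ z in Metric.ball (b : En n) (r b), u z := by
        refine ENNReal.tsum_le_tsum fun b => ?_
        gcongr
        exact hr b (hTs b.2)
    _ = ENNReal.ofReal (om n * 4 ^ n) * ∫⁻ z in ⋃ b ∈ T, Metric.ball b (r b), u z := by
        rw [ENNReal.tsum_mul_left, lintegral_biUnion hTcount
          (fun _ _ => Metric.isOpen_ball.measurableSet)
          (show T.PairwiseDisjoint (fun a => Metric.ball a (r a)) from hTd)]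
    _ ≤ _ := by gcongr; exact Measure.restrict_le_self

lemma weak_Mf_trunc (hn : 0 < n) {u : En n → ℝ≥0∞} (hu : Measurable u) {l : ℝ} (hl : 0 < l) :
    volume {x | ENNReal.ofReal l < Mf u x} ≤ ENNReal.ofReal (2 * om n * 4 ^ n / l) *
      ∫⁻ z, {z | ENNReal.ofReal (l / (2 * om n)) < u z}.indicator u z := by
  have hω := om_pos n
  set v := {z | ENNReal.ofReal (l / (2 * om n)) < u z}.indicator u with hv
  have hvm : Measurable v := hu.indicator (measurableSet_lt measurable_const hu)
  have huv : ∀ z, u z ≤ v z + ENNReal.ofReal (l / (2 * om n)) := by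
    intro z
    by_cases h : z ∈ {z | ENNReal.ofReal (l / (2 * om n)) < u z}
    · rw [hv, indicator_of_mem h]; exact le_self_add
    · exact le_add_left (not_lt.1 h)
  have hM : ∀ x, Mf u x ≤ Mf v x + ENNReal.ofReal (l / 2) := by
    intro x
    refine iSup_le fun r => ?_
    have hr0 : (0 : ℝ) < (r : ℚ) := by exact_mod_cast r.2
    calc ENNReal.ofReal (1 / ((r : ℚ) : ℝ) ^ n) * ∫⁻ z in Metric.ball x (r : ℚ), u z
        ≤ ENNReal.ofReal (1 / ((r : ℚ) : ℝ) ^ n) * ∫⁻ z in Metric.ball x (r : ℚ),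
          (v z + ENNReal.ofReal (l / (2 * om n))) := by gcongr; exact huv _
      _ = ENNReal.ofReal (1 / ((r : ℚ) : ℝ) ^ n) * (∫⁻ z in Metric.ball x (r : ℚ), v z) +
          ENNReal.ofReal (l / 2) := by
        rw [lintegral_add_right _ measurable_const, mul_add]
        congr 1
        rw [setLIntegral_const, volume_ball _ hr0, ← ENNReal.ofReal_mul (by positivity),
          ← ENNReal.ofReal_mul (by positivity)]
        congr 1; field_simp
      _ ≤ _ := by
        gcongr
        exact le_iSup (fun r : {r : ℚ // 0 < r} => ENNReal.ofReal (1 / (r : ℝ) ^ n) *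
          ∫⁻ z in Metric.ball x (r : ℝ), v z) r
  have hsub : {x | ENNReal.ofReal l < Mf u x} ⊆ {x | ENNReal.ofReal (l / 2) < Mf v x} := by
    intro x hx
    have h1 : ENNReal.ofReal l < Mf v x + ENNReal.ofReal (l / 2) := lt_of_lt_of_le hx (hM x)
    rw [show l = l / 2 + l / 2 by ring, ENNReal.ofReal_add (by positivity) (by positivity)] at h1
    simp only [add_halves] at h1
    exact (ENNReal.add_lt_add_iff_right ENNReal.ofReal_ne_top).1 h1
  refine (measure_mono hsub).trans ?_
  have h2 := weak_Mf hn v (half_pos hl)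
  have h3 := mul_le_mul_right h2 (ENNReal.ofReal (2 / l))
  rw [← mul_assoc, ← mul_assoc, ← ENNReal.ofReal_mul (by positivity),
    ← ENNReal.ofReal_mul (by positivity)] at h3
  rw [show 2 / l * (l / 2) = 1 by field_simp, ENNReal.ofReal_one, one_mul] at h3
  refine h3.trans (le_of_eq ?_)
  congr 2
  ring

theorem strong_Mf (hn : 0 < n) {a : ℝ} (ha : 1 < a) : ∃ C : ℝ, 0 < C ∧ ∀ u : En n → ℝ≥0∞,
    Measurable u → ∫⁻ x, Mf u x ^ a ≤ ENNReal.ofReal C * ∫⁻ x, u x ^ a := by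
  have hω := om_pos n
  have ha0 : 0 < a := by linarith
  have ha1 : 0 < a - 1 := by linarith
  refine ⟨a * (2 * om n * 4 ^ n * (1 / (a - 1) * (2 * om n) ^ (a - 1))), by positivity, fun u hu => ?_⟩
  have hMm := measurable_Mf hu
  have m1 : Measurable fun p : En n × ℝ => ENNReal.ofReal (p.2 ^ (a - 1)) *
      {p : En n × ℝ | ENNReal.ofReal p.2 < Mf u p.1}.indicator 1 p :=
    (measurable_snd.pow_const _).ennreal_ofReal.mul (measurable_one.indicator
      (measurableSet_lt measurable_snd.ennreal_ofReal (hMm.comp measurable_fst)))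
  have m2 : Measurable fun p : En n × ℝ => ENNReal.ofReal (p.2 ^ (a - 1 - 1)) *
      {p : En n × ℝ | ENNReal.ofReal p.2 < ENNReal.ofReal (2 * om n) * u p.1}.indicator 1 p * u p.1 :=
    ((measurable_snd.pow_const _).ennreal_ofReal.mul (measurable_one.indicator
      (measurableSet_lt measurable_snd.ennreal_ofReal ((hu.comp measurable_fst).const_mul _)))).mul
      (hu.comp measurable_fst)
  have s1 : ∫⁻ x, Mf u x ^ a ≤ ENNReal.ofReal a * ∫⁻ l in Ioi (0 : ℝ), ENNReal.ofReal (l ^ (a - 1)) *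
      volume {x | ENNReal.ofReal l < Mf u x} := by
    refine (lintegral_mono fun x => rpow_le_layer ha0 _).trans (le_of_eq ?_)
    unfold layer
    rw [lintegral_const_mul' _ _ ENNReal.ofReal_ne_top]
    congr 1
    rw [lintegral_lintegral_swap (f := fun x l => ENNReal.ofReal (l ^ (a - 1)) *
      {l | ENNReal.ofReal l < Mf u x}.indicator 1 l) m1.aemeasurable]
    refine lintegral_congr fun l => ?_
    rw [lintegral_const_mul' _ _ ENNReal.ofReal_ne_top]
    congr 1
    rw [← lintegral_indicator_one (measurableSet_lt measurable_const hMm)]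
    rfl
  have s2 : ∫⁻ l in Ioi (0 : ℝ), ENNReal.ofReal (l ^ (a - 1)) * volume {x | ENNReal.ofReal l < Mf u x} ≤
      ∫⁻ l in Ioi (0 : ℝ), ENNReal.ofReal (2 * om n * 4 ^ n) * ∫⁻ x, ENNReal.ofReal (l ^ (a - 1 - 1)) *
        {p : En n × ℝ | ENNReal.ofReal p.2 < ENNReal.ofReal (2 * om n) * u p.1}.indicator 1 (x, l) * u x := by
    refine setLIntegral_mono' measurableSet_Ioi fun l hl => ?_
    have hl : 0 < l := hl
    refine (mul_le_mul_right (weak_Mf_trunc hn hu hl) _).trans (le_of_eq ?_)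
    simp_rw [mul_assoc (ENNReal.ofReal (l ^ (a - 1 - 1)))]
    rw [lintegral_const_mul' _ _ ENNReal.ofReal_ne_top, ← mul_assoc, ← mul_assoc,
      ← ENNReal.ofReal_mul (by positivity), ← ENNReal.ofReal_mul (by positivity)]
    congr 1
    · congr 1
      rw [Real.rpow_sub_one hl.ne' (a - 1)]; ring
    · refine lintegral_congr fun x => ?_
      have : (ENNReal.ofReal (l / (2 * om n)) < u x) ↔ ENNReal.ofReal l < ENNReal.ofReal (2 * om n) * u x := by
        rw [ENNReal.ofReal_div_of_pos (by positivity), ENNReal.div_lt_iff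
          (Or.inl (by simpa using by positivity)) (Or.inl ENNReal.ofReal_ne_top), mul_comm]
      simp only [indicator_apply, mem_ofPred_eq, this, Pi.one_apply]
      split_ifs <;> simp
  refine s1.trans ((mul_le_mul_right s2 _).trans ?_)
  rw [lintegral_const_mul' _ _ ENNReal.ofReal_ne_top,
    lintegral_lintegral_swap (f := fun l x => ENNReal.ofReal (l ^ (a - 1 - 1)) *
        {p : En n × ℝ | ENNReal.ofReal p.2 < ENNReal.ofReal (2 * om n) * u p.1}.indicator 1 (x, l) * u x)
      (m2.comp measurable_swap).aemeasurable, ← mul_assoc, ← ENNReal.ofReal_mul ha0.le]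
  have s3 : ∀ x, ∫⁻ l in Ioi (0 : ℝ), ENNReal.ofReal (l ^ (a - 1 - 1)) *
        {p : En n × ℝ | ENNReal.ofReal p.2 < ENNReal.ofReal (2 * om n) * u p.1}.indicator 1 (x, l) * u x ≤
      ENNReal.ofReal (1 / (a - 1) * (2 * om n) ^ (a - 1)) * u x ^ a := by
    intro x
    have hm : Measurable fun l : ℝ => ENNReal.ofReal (l ^ (a - 1 - 1)) *
        {p : En n × ℝ | ENNReal.ofReal p.2 < ENNReal.ofReal (2 * om n) * u p.1}.indicator
          (1 : En n × ℝ → ℝ≥0∞) (x, l) :=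
      (measurable_id.pow_const _).ennreal_ofReal.mul
        ((measurable_one.indicator (measurableSet_lt measurable_snd.ennreal_ofReal
          ((hu.comp measurable_fst).const_mul _))).comp measurable_prodMk_left)
    rw [lintegral_mul_const _ hm]
    refine (mul_le_mul_left (layer_le_rpow ha1 (ENNReal.ofReal (2 * om n) * u x)) _).trans (le_of_eq ?_)
    rw [ENNReal.mul_rpow_of_nonneg _ _ ha1.le, ENNReal.ofReal_rpow_of_pos (by positivity), ← mul_assoc,
      ← ENNReal.ofReal_mul (by positivity), mul_assoc]
    congr 1
    conv_rhs => rw [show a = (a - 1) + 1 by ring]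
    rw [ENNReal.rpow_add_of_nonneg _ _ ha1.le zero_le_one, ENNReal.rpow_one]
  refine (mul_le_mul_right (lintegral_mono s3) _).trans (le_of_eq ?_)
  rw [lintegral_const_mul' _ _ ENNReal.ofReal_ne_top, ← mul_assoc, ← ENNReal.ofReal_mul (by positivity)]
  congr 2
  ring

lemma summable_pow_natAbs {d : ℝ} (hd0 : 0 ≤ d) (hd1 : d < 1) : Summable fun l : ℤ => d ^ l.natAbs := by
  refine Summable.of_nat_of_neg ?_ ?_
  · simpa using summable_geometric_of_lt_one hd0 hd1
  · simpa using summable_geometric_of_lt_one hd0 hd1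

lemma geom_sum_of_one_lt {θ q s : ℝ} (hθ : 1 < θ) (hq : 0 < q) (hs : q < s) :
    ∃ C : ℝ, 0 < C ∧ ∀ B : ℝ, 0 < B →
      ∑' l : ℤ, ENNReal.ofReal (min ((θ ^ l) ^ q) (B ^ s * (θ ^ l) ^ (q - s))) ≤
        ENNReal.ofReal (C * B ^ q) := by
  have hθ0 : 0 < θ := by linarith
  set d := max (θ ^ (-q)) (θ ^ (q - s)) with hd
  have hd0 : 0 < d := lt_max_of_lt_left (by positivity)
  have hd1 : d < 1 := max_lt (Real.rpow_lt_one_of_one_lt_of_neg hθ (by linarith))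
    (Real.rpow_lt_one_of_one_lt_of_neg hθ (by linarith))
  have hS := summable_pow_natAbs hd0.le hd1
  refine ⟨θ ^ (s - q) * ∑' l : ℤ, d ^ l.natAbs, ?_, fun B hB => ?_⟩
  · refine mul_pos (by positivity) ?_
    exact hS.tsum_pos (fun _ => by positivity) 0 (by simp)
  obtain ⟨m, hm1, hm2⟩ := exists_mem_Ico_zpow hB hθ
  have key : ∀ l : ℤ, min ((θ ^ (l + m)) ^ q) (B ^ s * (θ ^ (l + m)) ^ (q - s)) ≤
      (θ ^ (s - q) * B ^ q) * d ^ l.natAbs := by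
    intro l
    have h1 : 1 ≤ θ ^ (s - q) := Real.one_le_rpow hθ.le (by linarith)
    rcases le_total l 0 with hl | hl
    · refine (min_le_left _ _).trans ?_
      have e : d ^ l.natAbs ≥ (θ ^ l) ^ q := by
        have : l = -(l.natAbs : ℤ) := by omega
        calc (θ ^ l) ^ q = (θ ^ (-q)) ^ l.natAbs := by
              rw [this, zpow_neg, zpow_natCast, Int.natAbs_neg, Int.natAbs_natCast, ← Real.rpow_natCast,
                ← Real.rpow_natCast, ← Real.rpow_neg hθ0.le, ← Real.rpow_mul hθ0.le,
                ← Real.rpow_mul hθ0.le]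
              ring_nf
          _ ≤ _ := by gcongr; exact le_max_left _ _
      calc (θ ^ (l + m)) ^ q = (θ ^ l) ^ q * (θ ^ m) ^ q := by
            rw [zpow_add₀ hθ0.ne', Real.mul_rpow (by positivity) (by positivity)]
        _ ≤ d ^ l.natAbs * B ^ q := by gcongr
        _ = 1 * B ^ q * d ^ l.natAbs := by ring
        _ ≤ _ := by gcongr
    · refine (min_le_right _ _).trans ?_
      have e : (θ ^ l) ^ (q - s) ≤ d ^ l.natAbs := by
        have : l = (l.natAbs : ℤ) := by omega
        calc (θ ^ l) ^ (q - s) = (θ ^ (q - s)) ^ l.natAbs := by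
              rw [this, zpow_natCast, Int.natAbs_natCast, ← Real.rpow_natCast,
                ← Real.rpow_natCast, ← Real.rpow_mul hθ0.le, ← Real.rpow_mul hθ0.le]
              ring_nf
          _ ≤ _ := by gcongr; exact le_max_right _ _
      have e2 : (θ ^ m) ^ (q - s) ≤ θ ^ (s - q) * B ^ (q - s) := by
        have : B / θ ≤ θ ^ m := by
          rw [div_le_iff₀ hθ0, ← zpow_add_one₀ hθ0.ne']; exact hm2.le
        calc (θ ^ m) ^ (q - s) ≤ (B / θ) ^ (q - s) :=
              Real.rpow_le_rpow_of_nonpos (by positivity) this (by linarith)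
          _ = _ := by
            rw [Real.div_rpow hB.le hθ0.le, show q - s = -(s - q) by ring, Real.rpow_neg hθ0.le,
              div_inv_eq_mul, mul_comm]
      calc B ^ s * (θ ^ (l + m)) ^ (q - s) = B ^ s * ((θ ^ l) ^ (q - s) * (θ ^ m) ^ (q - s)) := by
            rw [zpow_add₀ hθ0.ne', Real.mul_rpow (by positivity) (by positivity)]
        _ ≤ B ^ s * (d ^ l.natAbs * (θ ^ (s - q) * B ^ (q - s))) := by gcongr
        _ = θ ^ (s - q) * (B ^ s * B ^ (q - s)) * d ^ l.natAbs := by ring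
        _ = _ := by rw [← Real.rpow_add hB]; ring_nf
  rw [← (Equiv.addRight m).tsum_eq]
  calc ∑' l : ℤ, ENNReal.ofReal (min ((θ ^ (l + m)) ^ q) (B ^ s * (θ ^ (l + m)) ^ (q - s)))
      ≤ ∑' l : ℤ, ENNReal.ofReal ((θ ^ (s - q) * B ^ q) * d ^ l.natAbs) :=
        ENNReal.tsum_le_tsum fun l => ENNReal.ofReal_le_ofReal (key l)
    _ = ENNReal.ofReal (∑' l : ℤ, (θ ^ (s - q) * B ^ q) * d ^ l.natAbs) :=
        (ENNReal.ofReal_tsum_of_nonneg (fun _ => by positivity) (hS.mul_left _)).symm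
    _ = _ := by rw [tsum_mul_left]; congr 1; ring

lemma geom_sum {θ q s : ℝ} (hθ0 : 0 < θ) (hθ : θ ≠ 1) (hq : 0 < q) (hs : q < s) :
    ∃ C : ℝ, 0 < C ∧ ∀ B : ℝ, 0 < B →
      ∑' l : ℤ, ENNReal.ofReal (min ((θ ^ l) ^ q) (B ^ s * (θ ^ l) ^ (q - s))) ≤
        ENNReal.ofReal (C * B ^ q) := by
  rcases lt_or_gt_of_ne hθ with h | h
  · obtain ⟨C, hC, H⟩ := geom_sum_of_one_lt (θ := θ⁻¹) (one_lt_inv_iff₀.2 ⟨hθ0, h⟩) hq hs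
    refine ⟨C, hC, fun B hB => ?_⟩
    rw [← (Equiv.neg ℤ).tsum_eq]
    simpa [zpow_neg, inv_zpow] using H B hB
  · exact geom_sum_of_one_lt h hq hs

/-- Dyadic decomposition of `innerInt`. -/
lemma innerInt_le_tsum (k : ℕ) (lam b γ : ℝ) (f : En n → ℝ) (x : En n) :
    innerInt k k lam b γ f x ≤ ∑' l : ℤ, ENNReal.ofReal (max 1 (2 ^ (γ - n)) * ((2 : ℝ) ^ l) ^ (γ - n)) *
      volume {h : En n | (2 : ℝ) ^ l ≤ ‖h‖ ∧ ‖h‖ < 2 ^ (l + 1) ∧ memE k k lam b f x h} := by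
  unfold innerInt
  set S : ℤ → Set (En n) := fun l =>
    {h : En n | (2 : ℝ) ^ l ≤ ‖h‖ ∧ ‖h‖ < 2 ^ (l + 1) ∧ memE k k lam b f x h}
  have h1 : ∀ h : En n, (if memE k k lam b f x h then ENNReal.ofReal (‖h‖ ^ (γ - (n : ℝ))) else 0) ≤
      ∑' l : ℤ, (S l).indicator
        (fun _ => ENNReal.ofReal (max 1 (2 ^ (γ - n)) * ((2 : ℝ) ^ l) ^ (γ - n))) h := by
    intro h
    split_ifs with hE
    swap; · exact zero_le
    have hh : 0 < ‖h‖ := norm_pos_iff.2 hE.1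
    obtain ⟨m, hm1, hm2⟩ := exists_mem_Ico_zpow hh one_lt_two
    refine le_trans ?_ (ENNReal.le_tsum m)
    rw [indicator_of_mem (show h ∈ S m from ⟨hm1, hm2, hE⟩)]
    refine ENNReal.ofReal_le_ofReal ?_
    have h2 : (0 : ℝ) < 2 ^ m := by positivity
    rcases le_total 0 (γ - n) with h0 | h0
    · calc ‖h‖ ^ (γ - n) ≤ (2 * 2 ^ m) ^ (γ - n) := by
            refine Real.rpow_le_rpow hh.le ?_ h0
            rw [zpow_add_one₀ two_ne_zero] at hm2; linarith
        _ = 2 ^ (γ - n) * (2 ^ m) ^ (γ - n) := Real.mul_rpow zero_le_two h2.le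
        _ ≤ _ := by gcongr; exact le_max_right _ _
    · calc ‖h‖ ^ (γ - n) ≤ (2 ^ m) ^ (γ - n) := Real.rpow_le_rpow_of_nonpos h2 hm1 h0
        _ = 1 * (2 ^ m) ^ (γ - n) := (one_mul _).symm
        _ ≤ _ := by gcongr; exact le_max_left _ _
  refine (lintegral_mono h1).trans ?_
  calc _ ≤ ∫⁻ h, ∑' l : ℤ, (toMeasurable volume (S l)).indicator
        (fun _ => ENNReal.ofReal (max 1 (2 ^ (γ - n)) * ((2 : ℝ) ^ l) ^ (γ - n))) h := by
        refine lintegral_mono fun h => ENNReal.tsum_le_tsum fun l => ?_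
        exact indicator_le_indicator_of_subset (subset_toMeasurable _ _) (fun _ => zero_le) h
    _ = _ := by
        rw [lintegral_tsum fun l => (measurable_const.indicator (measurableSet_toMeasurable _ _)).aemeasurable]
        refine tsum_congr fun l => ?_
        rw [lintegral_indicator_const (measurableSet_toMeasurable _ _), measure_toMeasurable]

lemma innerInt_le_rpow (n k : ℕ) {q γ t s : ℝ} (hq : 0 < q) (hγ : γ ≠ 0) (ht : 1 ≤ t) (hts : t ≤ s)
    (hqs : q < s) (hnk : n * (1 / t - 1 / s) < k) :
    ∃ C : ℝ, 0 < C ∧ ∀ (f : En n → ℝ) (g : (Fin n → ℕ) → En n → ℝ), LocallyIntegrable f volume →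
      HasWeakDerivs k f g → (∀ α, Measurable (g α)) → ∀ (x : En n) (M lam : ℝ), 0 < M → 0 < lam →
      Leb f x →
      (∀ r : ℝ, 0 < r → ∫⁻ z in Metric.ball x r, dev k g 0 z ^ t ≤ ENNReal.ofReal (M * r ^ n)) →
      innerInt k k lam (γ / q) γ f x ≤ ENNReal.ofReal (C * (M ^ (1 / t) / lam) ^ q) := by
  obtain ⟨C1, hC1, H1⟩ := measure_level_le n k ht hts hnk
  have hθ0 : (0 : ℝ) < 2 ^ (γ / q) := by positivity
  have hθ1 : (2 : ℝ) ^ (γ / q) ≠ 1 := by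
    intro h
    have h2 := congrArg Real.log h
    rw [Real.log_rpow two_pos, Real.log_one] at h2
    exact mul_ne_zero (div_ne_zero hγ hq.ne') (Real.log_pos one_lt_two).ne' h2
  obtain ⟨C2, hC2, H2⟩ := geom_sum hθ0 hθ1 hq hqs
  have hω := om_pos n
  set c0 : ℝ := min 1 (2 ^ (k + γ / q)) with hc0
  have hc0p : 0 < c0 := by positivity
  set K0 : ℝ := max 1 (2 ^ (γ - n)) with hK0
  have hK0p : 0 < K0 := by positivity
  set K : ℝ := K0 * 2 ^ n * max (om n) (C1 * (2 ^ k / c0) ^ s) with hK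
  have hKp : 0 < K := by positivity
  refine ⟨K * C2, by positivity, fun f g hf hw hgm x M lam hM hl hL hball => ?_⟩
  set B := M ^ (1 / t) / lam with hB
  have hBp : 0 < B := by positivity
  refine (innerInt_le_tsum k lam (γ / q) γ f x).trans ?_
  rw [mul_assoc, ENNReal.ofReal_mul hKp.le]
  refine le_trans ?_ (mul_le_mul_right (H2 B hBp) _)
  rw [← ENNReal.tsum_mul_left]
  refine ENNReal.tsum_le_tsum fun l => ?_
  have hy : (0 : ℝ) < 2 ^ l := by positivity
  have hu : ((2 : ℝ) ^ (γ / q)) ^ l = ((2 : ℝ) ^ l) ^ (γ / q) := by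
    rw [← Real.rpow_intCast, ← Real.rpow_intCast, ← Real.rpow_mul zero_le_two,
      ← Real.rpow_mul zero_le_two, mul_comm]
  rw [hu, zpow_add_one₀ two_ne_zero]
  set y : ℝ := (2 : ℝ) ^ l with hydef
  set u := y ^ (γ / q) with hudef
  have hup : 0 < u := by positivity
  have huq : u ^ q = y ^ γ := by
    rw [hudef, ← Real.rpow_mul hy.le, div_mul_cancel₀ _ hq.ne']
  set V := volume {h : En n | y ≤ ‖h‖ ∧ ‖h‖ < y * 2 ∧ memE k k lam (γ / q) f x h} with hV
  have hyg : y ^ (γ - n) * y ^ n = y ^ γ := by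
    rw [← Real.rpow_natCast, ← Real.rpow_add hy]; ring_nf
  have V1 : V ≤ ENNReal.ofReal (om n * (y * 2) ^ n) := by
    rw [← volume_ball (0 : En n) (by positivity)]
    refine measure_mono fun h hh => ?_
    simpa using hh.2.1
  have V2 : V ≤ ENNReal.ofReal (C1 * ((y * 2) ^ n * (B * (2 ^ k / c0) / u) ^ s)) := by
    have := H1 f g hf hw hgm 0 x (y * 2) M (lam * c0 * (y ^ k * u)) (by positivity) hM (by positivity) hL
      (fun r hr _ => hball r hr)
    have e : M ^ (1 / t) * (y * 2) ^ k / (lam * c0 * (y ^ k * u)) = B * (2 ^ k / c0) / u := by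
      rw [hB, mul_pow]; field_simp
    rw [e] at this
    rw [hV]
    refine le_trans (measure_mono ?_) this
    intro h hh
    refine ⟨hh.2.1, ?_⟩
    have hf0 : form k (0 : (Fin n → ℕ) → ℝ) h = 0 := by simp [form]
    rw [hf0, sub_zero]
    refine lt_of_le_of_lt ?_ hh.2.2.2
    rw [mul_assoc]
    refine mul_le_mul_of_nonneg_left ?_ hl.le
    have e2 : y ^ k * u = y ^ ((k : ℝ) + γ / q) := by
      rw [hudef, Real.rpow_add hy, Real.rpow_natCast]
    rw [e2]
    have hh0 : 0 < ‖h‖ := hy.trans_le hh.1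
    rcases le_total 0 ((k : ℝ) + γ / q) with h0 | h0
    · calc c0 * y ^ ((k : ℝ) + γ / q) ≤ 1 * y ^ ((k : ℝ) + γ / q) := by
            gcongr; exact min_le_left _ _
        _ ≤ _ := by rw [one_mul]; exact Real.rpow_le_rpow hy.le hh.1 h0
    · calc c0 * y ^ ((k : ℝ) + γ / q) ≤ 2 ^ ((k : ℝ) + γ / q) * y ^ ((k : ℝ) + γ / q) := by
            gcongr; exact min_le_right _ _
        _ = (y * 2) ^ ((k : ℝ) + γ / q) := by rw [mul_comm, Real.mul_rpow hy.le zero_le_two]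
        _ ≤ _ := Real.rpow_le_rpow_of_nonpos hh0 hh.2.1.le h0
  rw [← ENNReal.ofReal_mul hKp.le]
  rcases le_total (u ^ q) (B ^ s * u ^ (q - s)) with h | h
  · rw [min_eq_left h]
    refine (mul_le_mul_right V1 _).trans ?_
    rw [← ENNReal.ofReal_mul (by positivity)]
    refine ENNReal.ofReal_le_ofReal ?_
    calc K0 * y ^ (γ - n) * (om n * (y * 2) ^ n) = K0 * 2 ^ n * om n * (y ^ (γ - n) * y ^ n) := by
          rw [mul_pow]; ring
      _ = K0 * 2 ^ n * om n * u ^ q := by rw [hyg, huq]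
      _ ≤ _ := by rw [hK]; gcongr; exact le_max_left _ _
  · rw [min_eq_right h]
    refine (mul_le_mul_right V2 _).trans ?_
    rw [← ENNReal.ofReal_mul (by positivity)]
    refine ENNReal.ofReal_le_ofReal ?_
    calc K0 * y ^ (γ - n) * (C1 * ((y * 2) ^ n * (B * (2 ^ k / c0) / u) ^ s))
        = K0 * 2 ^ n * (C1 * (2 ^ k / c0) ^ s) * (B ^ s * ((y ^ (γ - n) * y ^ n) / u ^ s)) := by
          rw [mul_pow, Real.div_rpow (by positivity) hup.le, Real.mul_rpow hBp.le (by positivity)]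
          ring
      _ = K0 * 2 ^ n * (C1 * (2 ^ k / c0) ^ s) * (B ^ s * u ^ (q - s)) := by
          rw [hyg, ← huq, ← Real.rpow_sub hup]
      _ ≤ _ := by rw [hK]; gcongr; exact le_max_right _ _

/-- Room between the exponents. -/
lemma exists_exponents {n k : ℕ} (hk : 0 < k) {p q : ℝ} (hp : 1 < p) (hq : 1 < q)
    (hpq : (n : ℝ) * (1 / p - 1 / q) < k) :
    ∃ t s : ℝ, 1 ≤ t ∧ t < p ∧ t ≤ s ∧ q < s ∧ n * (1 / t - 1 / s) < k := by
  rcases lt_or_ge q p with h | h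
  · refine ⟨(q + p) / 2, (q + p) / 2, by linarith, by linarith, le_rfl, by linarith, ?_⟩
    simpa using hk
  · have hc : Tendsto (fun ε : ℝ => (n : ℝ) * (1 / (p - ε) - 1 / (q + ε))) (𝓝[>] 0)
        (𝓝 ((n : ℝ) * (1 / (p - 0) - 1 / (q + 0)))) := by
      refine tendsto_nhdsWithin_of_tendsto_nhds ?_
      refine ContinuousAt.tendsto (f := fun ε : ℝ => (n : ℝ) * (1 / (p - ε) - 1 / (q + ε))) ?_
      have h1 : p - 0 ≠ 0 := by linarith
      have h2 : q + 0 ≠ 0 := by linarith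
      fun_prop (disch := assumption)
    have h1 := hc.eventually_lt_const (by simpa using hpq)
    have h2 : ∀ᶠ ε : ℝ in 𝓝[>] 0, ε ∈ Ioo 0 (p - 1) := Ioo_mem_nhdsGT (by linarith)
    obtain ⟨ε, h3, h4⟩ := (h1.and h2).exists
    exact ⟨p - ε, q + ε, by linarith [h4.2], by linarith [h4.1], by linarith [h4.1],
      by linarith [h4.1], h3⟩

lemma gradLen_eq (m : ℕ) (g : (Fin n → ℕ) → En n → ℝ) (x : En n) :
    gradLen m g x = Real.sqrt (∑ α ∈ idx n m, g α x ^ 2) := by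
  unfold gradLen
  congr 1
  rw [tsum_eq_sum (s := idx n m)]
  · refine Finset.sum_congr rfl fun α hα => ?_
    rw [if_pos (mem_idx.1 hα)]
  · intro α hα
    rw [if_neg fun h => hα (mem_idx.2 h)]

lemma gradLp_congr {p : ℝ} {m : ℕ} {g g' : (Fin n → ℕ) → En n → ℝ}
    (h : ∀ α ∈ idx n m, g α =ᵐ[volume] g' α) : gradLp p m g = gradLp p m g' := by
  unfold gradLp
  congr 1
  refine lintegral_congr_ae ?_
  filter_upwards [(Finset.eventually_all (idx n m)).2 h] with x hx
  rw [gradLen_eq, gradLen_eq, Finset.sum_congr rfl fun α hα => by rw [hx α hα]]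

/-- Weak derivatives may be taken measurable. -/
lemma exists_measurable_weakDerivs {m : ℕ} {f : En n → ℝ} {g : (Fin n → ℕ) → En n → ℝ}
    (hg : HasWeakDerivs m f g) : ∃ g' : (Fin n → ℕ) → En n → ℝ, HasWeakDerivs m f g' ∧
      (∀ α, Measurable (g' α)) ∧ ∀ α ∈ idx n m, g α =ᵐ[volume] g' α := by
  set g' : (Fin n → ℕ) → En n → ℝ := fun α =>
    if h : ∑ i, α i = m then (hg.1 α h).aestronglyMeasurable.mk (g α) else 0 with hg'
  have hae : ∀ α, ∑ i, α i = m → g α =ᵐ[volume] g' α := by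
    intro α h
    simp only [hg', h, dif_pos]
    exact (hg.1 α h).aestronglyMeasurable.ae_eq_mk
  refine ⟨g', ⟨fun α h => ?_, fun α h φ hφ hc => ?_⟩, fun α => ?_, fun α h => hae α (mem_idx.1 h)⟩
  · exact (hg.1 α h).congr (hae α h)
  · rw [hg.2 α h φ hφ hc]
    congr 1
    refine integral_congr_ae ?_
    filter_upwards [hae α h] with x hx
    rw [hx]
  · by_cases h : ∑ i, α i = m
    · simp only [hg', h, dif_pos]
      exact (hg.1 α h).aestronglyMeasurable.stronglyMeasurable_mk.measurable
    · simp only [hg', h, dif_neg, not_false_eq_true]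
      exact measurable_const

lemma dev_zero_le (k : ℕ) (g : (Fin n → ℕ) → En n → ℝ) (x : En n) :
    dev k g 0 x ≤ (idx n k).card * ENNReal.ofReal (gradLen k g x) := by
  unfold dev
  rw [← nsmul_eq_mul]
  refine Finset.sum_le_card_nsmul _ _ _ fun α hα => ?_
  rw [Pi.zero_apply, sub_zero, gradLen_eq, Real.enorm_eq_ofReal_abs]
  refine ENNReal.ofReal_le_ofReal (Real.abs_le_sqrt ?_)
  exact Finset.single_le_sum (f := fun α => g α x ^ 2) (fun _ _ => sq_nonneg _) hα

lemma lintegral_dev_rpow_lt_top {k : ℕ} {p : ℝ} (hp : 0 < p) {g : (Fin n → ℕ) → En n → ℝ}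
    (hg : gradLp p k g < ⊤) : ∫⁻ x, dev k g 0 x ^ p < ⊤ := by
  have h1 : ∫⁻ x, ENNReal.ofReal (gradLen k g x ^ p) ≠ ⊤ := by
    intro h
    unfold gradLp at hg
    rw [h, ENNReal.top_rpow_of_pos (by positivity)] at hg
    exact lt_irrefl _ hg
  calc ∫⁻ x, dev k g 0 x ^ p
      ≤ ∫⁻ x, ((idx n k).card : ℝ≥0∞) ^ p * ENNReal.ofReal (gradLen k g x ^ p) := by
        refine lintegral_mono fun x => ?_
        rw [← ENNReal.ofReal_rpow_of_nonneg (show 0 ≤ gradLen k g x from Real.sqrt_nonneg _) hp.le,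
          ← ENNReal.mul_rpow_of_nonneg _ _ hp.le]
        exact ENNReal.rpow_le_rpow (dev_zero_le k g x) hp.le
    _ = ((idx n k).card : ℝ≥0∞) ^ p * ∫⁻ x, ENNReal.ofReal (gradLen k g x ^ p) :=
        lintegral_const_mul' _ _ (ENNReal.rpow_ne_top_of_nonneg hp.le (ENNReal.natCast_ne_top _))
    _ < ⊤ := ENNReal.mul_lt_top (ENNReal.rpow_lt_top_of_nonneg hp.le (ENNReal.natCast_ne_top _)) h1.lt_top

lemma le_const_mul_rpow_of_forall {v W : ℝ≥0∞} {c e : ℝ} (hc : 0 < c) (he : 0 < e)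
    (h : ∀ M : ℝ, 0 < M → W ≤ ENNReal.ofReal M → v ≤ ENNReal.ofReal (c * M ^ e)) :
    v ≤ ENNReal.ofReal c * W ^ e := by
  induction W with
  | top => rw [ENNReal.top_rpow_of_pos he, ENNReal.mul_top (by simpa using hc)]; exact le_top
  | coe w =>
    have hT : Tendsto (fun M : ℝ => ENNReal.ofReal (c * M ^ e)) (𝓝[>] (w : ℝ))
        (𝓝 (ENNReal.ofReal (c * (w : ℝ) ^ e))) := by
      refine tendsto_nhdsWithin_of_tendsto_nhds (ENNReal.tendsto_ofReal ?_)
      exact ((Real.continuousAt_rpow_const _ _ (Or.inr he.le)).tendsto).const_mul c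
    have : v ≤ ENNReal.ofReal (c * (w : ℝ) ^ e) := by
      refine ge_of_tendsto hT ?_
      filter_upwards [self_mem_nhdsWithin] with M hM
      have hM : (w : ℝ) < M := hM
      refine h M (w.coe_nonneg.trans_lt hM) ?_
      rw [← ENNReal.ofReal_coe_nnreal]
      exact ENNReal.ofReal_le_ofReal hM.le
    rwa [ENNReal.ofReal_mul hc.le, ← ENNReal.ofReal_rpow_of_nonneg w.coe_nonneg he.le,
      ENNReal.ofReal_coe_nnreal] at this

theorem iSup_bsvy_lt_top {k : ℕ} (hn : 0 < n) (hk : 0 < k) {p q γ : ℝ}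
    (hp : 1 < p) (hq : 1 < q) (hpq : (n : ℝ) * (1 / p - 1 / q) < (k : ℝ))
    (hγ : γ ≠ 0) {f : En n → ℝ} (hf : LocallyIntegrable f volume)
    {g : (Fin n → ℕ) → En n → ℝ} (hw : HasWeakDerivs k f g) (hg : gradLp p k g < ⊤) :
    (⨆ lam ∈ Ioi (0 : ℝ), bsvy k k p q (γ / q) γ f lam) < ⊤ := by
  obtain ⟨g', hw', hgm, hgae⟩ := exists_measurable_weakDerivs hw
  rw [gradLp_congr hgae] at hg
  clear hgae hw
  have hp0 : 0 < p := by linarith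
  have hq0 : 0 < q := by linarith
  obtain ⟨t, s, ht, htp, hts, hqs, hnk⟩ := exists_exponents hk hp hq hpq
  have ht0 : 0 < t := by linarith
  obtain ⟨C, hC, H⟩ := innerInt_le_rpow n k hq0 hγ ht hts hqs hnk
  obtain ⟨D, hD, HD⟩ := strong_Mf hn (a := p / t) (by rwa [one_lt_div ht0])
  set u : En n → ℝ≥0∞ := fun z => dev k g' 0 z ^ t with hu
  have hum : Measurable u := (measurable_dev hgm 0).pow_const t
  have hI : ∫⁻ x, dev k g' 0 x ^ p < ⊤ := lintegral_dev_rpow_lt_top hp0 hg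
  have hup : ∀ x, u x ^ (p / t) = dev k g' 0 x ^ p := by
    intro x; rw [hu, ← ENNReal.rpow_mul, mul_div_cancel₀ _ ht0.ne']
  have hMf := HD u hum
  simp_rw [hup] at hMf
  set K : ℝ≥0∞ := ENNReal.ofReal (C ^ (p / q)) * (ENNReal.ofReal (2 ^ n) ^ (p / t) *
    (ENNReal.ofReal D * ∫⁻ x, dev k g' 0 x ^ p)) with hK
  have hKtop : K < ⊤ := ENNReal.mul_lt_top ENNReal.ofReal_lt_top (ENNReal.mul_lt_top
    (ENNReal.rpow_lt_top_of_nonneg (by positivity) ENNReal.ofReal_ne_top)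
    (ENNReal.mul_lt_top ENNReal.ofReal_lt_top hI))
  refine lt_of_le_of_lt (iSup₂_le fun lam hlam => ?_)
    (ENNReal.rpow_lt_top_of_nonneg (y := 1 / p) (by positivity) hKtop.ne)
  have hl : 0 < lam := hlam
  have hpt : ∀ᵐ x, innerInt k k lam (γ / q) γ f x ^ (p / q) ≤
      ENNReal.ofReal (C ^ (p / q) * lam ^ (-p)) * (ENNReal.ofReal (2 ^ n) * Mf u x) ^ (p / t) := by
    filter_upwards [ae_leb hf] with x hx
    refine le_const_mul_rpow_of_forall (by positivity) (by positivity) fun M hM hWM => ?_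
    have := H f g' hf hw' hgm x M lam hM hl hx fun r hr => by
      refine (lintegral_ball_le_Mf u x hr).trans ?_
      rw [ENNReal.ofReal_mul (by positivity), mul_assoc, mul_left_comm,
        mul_comm M, ENNReal.ofReal_mul (by positivity)]
      gcongr
    refine (ENNReal.rpow_le_rpow this (by positivity : 0 ≤ p / q)).trans (le_of_eq ?_)
    rw [ENNReal.ofReal_rpow_of_pos (by positivity)]
    congr 1
    rw [Real.mul_rpow hC.le (by positivity), ← Real.rpow_mul (by positivity),
      mul_div_cancel₀ _ hq0.ne', Real.div_rpow (by positivity) hl.le, ← Real.rpow_mul hM.le,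
      Real.rpow_neg hl.le, div_mul_eq_mul_div, one_mul]
    ring
  have hint : ∫⁻ x, innerInt k k lam (γ / q) γ f x ^ (p / q) ≤ ENNReal.ofReal (lam ^ (-p)) * K := by
    refine (lintegral_mono_ae hpt).trans ?_
    rw [lintegral_const_mul' _ _ ENNReal.ofReal_ne_top]
    simp_rw [ENNReal.mul_rpow_of_nonneg _ _ (show 0 ≤ p / t by positivity)]
    rw [lintegral_const_mul' _ _
      (ENNReal.rpow_ne_top_of_nonneg (by positivity) ENNReal.ofReal_ne_top),
      mul_comm (C ^ (p / q)), ENNReal.ofReal_mul (by positivity), mul_assoc, hK]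
    gcongr
  unfold bsvy
  refine (mul_le_mul_right (ENNReal.rpow_le_rpow hint (by positivity)) _).trans (le_of_eq ?_)
  rw [ENNReal.mul_rpow_of_nonneg _ _ (by positivity), ENNReal.ofReal_rpow_of_pos (by positivity),
    ← Real.rpow_mul hl.le, ← mul_assoc, ← ENNReal.ofReal_mul hl.le,
    show -p * (1 / p) = -1 by field_simp, Real.rpow_neg_one, mul_inv_cancel₀ hl.ne',
    ENNReal.ofReal_one, one_mul]

section Pointwise


open scoped Pointwise


/-- The open annulus `1 < ‖h‖ < 2`. -/
def Ann (n : ℕ) : Set (En n) := {h | 1 < ‖h‖ ∧ ‖h‖ < 2}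

lemma isOpen_Ann : IsOpen (Ann n) :=
  (isOpen_lt continuous_const continuous_norm).inter (isOpen_lt continuous_norm continuous_const)

lemma measurableSet_Ann : MeasurableSet (Ann n) := isOpen_Ann.measurableSet

lemma volume_Ann_lt_top : volume (Ann n) < ⊤ := by
  refine lt_of_le_of_lt (measure_mono ?_) (measure_ball_lt_top (x := (0 : En n)) (r := 2))
  intro h hh
  simpa using hh.2

instance : IsFiniteMeasure (volume.restrict (Ann n)) := ⟨by
  rw [Measure.restrict_apply_univ]; exact volume_Ann_lt_top⟩

lemma measurable_kDiff_smul {f : En n → ℝ} (hf : Measurable f) (k : ℕ) (c : ℝ) :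
    Measurable fun z : En n × En n => kDiff k f (c • z.2) z.1 := by
  unfold kDiff
  refine Finset.measurable_fun_sum _ fun j _ => ?_
  refine measurable_const.mul (hf.comp ?_)
  exact measurable_fst.add ((measurable_snd.const_smul c).const_smul (j : ℝ))

lemma measurable_kDiff {f : En n → ℝ} (hf : Measurable f) (k : ℕ) :
    Measurable fun z : En n × En n => kDiff k f z.2 z.1 := by
  simpa using measurable_kDiff_smul hf k 1

lemma measurable_innerInt {f : En n → ℝ} (hf : Measurable f) (k : ℕ) (lam b γ : ℝ) :
    Measurable (innerInt k k lam b γ f) := by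
  unfold innerInt
  refine Measurable.lintegral_prod_right' (f := fun z : En n × En n =>
    if memE k k lam b f z.1 z.2 then ENNReal.ofReal (‖z.2‖ ^ (γ - (n : ℝ))) else 0) ?_
  refine Measurable.ite ?_ (measurable_snd.norm.pow_const _).ennreal_ofReal measurable_const
  have h1 : MeasurableSet {z : En n × En n | z.2 ≠ 0} :=
    measurable_snd (measurableSet_singleton (0 : En n)).compl
  exact h1.inter (measurableSet_lt ((measurable_snd.norm.pow_const _).const_mul lam)
    (measurable_kDiff hf k).abs)

lemma annulus_le_innerInt {f : En n → ℝ} (hf : Measurable f) (k : ℕ) {lam b γ σ : ℝ}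
    (hl : 0 < lam) (hσ : 0 < σ) (x : En n) :
    ENNReal.ofReal (min 1 (2 ^ (γ - n)) * σ ^ γ) *
      volume {h ∈ Ann n | max 1 (2 ^ ((k : ℝ) + b)) * lam * σ ^ ((k : ℝ) + b) < |kDiff k f (σ • h) x|} ≤
      innerInt k k lam b γ f x := by
  set S := {h ∈ Ann n | max 1 (2 ^ ((k : ℝ) + b)) * lam * σ ^ ((k : ℝ) + b) < |kDiff k f (σ • h) x|}
    with hS
  set e : ℝ := (k : ℝ) + b with he
  have hSm : MeasurableSet S := measurableSet_Ann.inter (measurableSet_lt measurable_const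
    ((measurable_kDiff_smul hf k σ).comp measurable_prodMk_left).abs)
  have hσSm : MeasurableSet (σ • S) := hSm.const_smul_of_ne_zero hσ.ne'
  have hvol : volume (σ • S) = ENNReal.ofReal (σ ^ n) * volume S := by
    rw [Measure.addHaar_smul]
    simp [abs_of_pos hσ]
  calc _ = ENNReal.ofReal (min 1 (2 ^ (γ - n)) * σ ^ (γ - n)) * volume (σ • S) := by
        rw [hvol, ← mul_assoc, ← ENNReal.ofReal_mul (by positivity), mul_assoc (min _ _),
          ← Real.rpow_natCast, ← Real.rpow_add hσ, sub_add_cancel]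
    _ = ∫⁻ h, (σ • S).indicator (fun _ => ENNReal.ofReal (min 1 (2 ^ (γ - n)) * σ ^ (γ - n))) h :=
        (lintegral_indicator_const hσSm _).symm
    _ ≤ _ := by
        unfold innerInt
        refine lintegral_mono fun h => ?_
        by_cases hh : h ∈ σ • S
        swap; · rw [indicator_of_notMem hh]; exact zero_le
        rw [indicator_of_mem hh]
        obtain ⟨v, hv, rfl⟩ := hh
        have hv1 : 1 < ‖v‖ := hv.1.1
        have hv2 : ‖v‖ < 2 := hv.1.2
        have hv0 : 0 < ‖v‖ := by linarith
        have hv3 : v ≠ 0 := norm_pos_iff.1 hv0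
        have hnorm : ‖σ • v‖ = σ * ‖v‖ := by rw [norm_smul, Real.norm_of_nonneg hσ.le]
        have hE : memE k k lam b f x (σ • v) := by
          refine ⟨smul_ne_zero hσ.ne' hv3, lt_of_le_of_lt ?_ hv.2⟩
          rw [hnorm, Real.mul_rpow hσ.le hv0.le, ← he]
          have : ‖v‖ ^ e ≤ max 1 (2 ^ e) := by
            rcases le_total 0 e with h0 | h0
            · exact (Real.rpow_le_rpow hv0.le hv2.le h0).trans (le_max_right _ _)
            · exact (Real.rpow_le_one_of_one_le_of_nonpos hv1.le h0).trans (le_max_left _ _)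
          calc lam * (σ ^ e * ‖v‖ ^ e) ≤ lam * (σ ^ e * max 1 (2 ^ e)) := by gcongr
            _ = _ := by ring
        simp only
        rw [if_pos hE, hnorm]
        refine ENNReal.ofReal_le_ofReal ?_
        rw [Real.mul_rpow hσ.le hv0.le, mul_comm]
        gcongr
        rcases le_total 0 (γ - n) with h0 | h0
        · exact (min_le_left _ _).trans (Real.one_le_rpow hv1.le h0)
        · exact (min_le_right _ _).trans (Real.rpow_le_rpow_of_nonpos hv0 hv2.le h0)

/-- Only the a.e. class of `f` matters for `innerInt`. -/
lemma innerInt_congr_ae {f f' : En n → ℝ} (h : f =ᵐ[volume] f') (k : ℕ) (lam b γ : ℝ) :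
    ∀ᵐ x, innerInt k k lam b γ f x = innerInt k k lam b γ f' x := by
  filter_upwards [h] with x hx
  unfold innerInt
  refine lintegral_congr_ae ?_
  have h1 : ∀ᵐ v : En n, ∀ j : ℕ, f (x + (j : ℝ) • v) = f' (x + (j : ℝ) • v) := by
    rw [ae_all_iff]
    intro j
    rcases Nat.eq_zero_or_pos j with rfl | hj
    · simp [hx]
    · exact ae_comp_add_smul h x (Nat.cast_ne_zero.2 hj.ne')
  filter_upwards [h1] with v hv
  have : kDiff k f v x = kDiff k f' v x := by
    unfold kDiff
    exact Finset.sum_congr rfl fun j _ => by rw [hv j]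
  exact if_congr (by simp only [memE, this]) rfl rfl

lemma bsvy_congr_ae {f f' : En n → ℝ} (h : f =ᵐ[volume] f') (k : ℕ) (p q b γ lam : ℝ) :
    bsvy k k p q b γ f lam = bsvy k k p q b γ f' lam := by
  unfold bsvy
  congr 2
  refine lintegral_congr_ae ?_
  filter_upwards [innerInt_congr_ae h k lam b γ] with x hx
  rw [hx]

lemma hasWeakDerivs_congr_ae {f f' : En n → ℝ} (h : f =ᵐ[volume] f') {m : ℕ}
    {g : (Fin n → ℕ) → En n → ℝ} (hg : HasWeakDerivs m f g) : HasWeakDerivs m f' g := by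
  refine ⟨hg.1, fun α hα φ hφ hc => ?_⟩
  rw [← hg.2 α hα φ hφ hc]
  refine integral_congr_ae ?_
  filter_upwards [h] with x hx
  rw [hx]

lemma exists_lintegral_innerInt_le {k : ℕ} {p q b γ : ℝ} (hp : 0 < p) {f : En n → ℝ}
    (h : (⨆ lam ∈ Ioi (0 : ℝ), bsvy k k p q b γ f lam) < ⊤) :
    ∃ K : ℝ, 0 < K ∧ ∀ lam : ℝ, 0 < lam →
      ∫⁻ x, innerInt k k lam b γ f x ^ (p / q) ≤ ENNReal.ofReal (K * lam ^ (-p)) := by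
  set A := ⨆ lam ∈ Ioi (0 : ℝ), bsvy k k p q b γ f lam with hA
  refine ⟨(A.toReal + 1) ^ p, by positivity, fun lam hl => ?_⟩
  have h1 : bsvy k k p q b γ f lam ≤ ENNReal.ofReal (A.toReal + 1) := by
    have h2 : bsvy k k p q b γ f lam ≤ A :=
      le_iSup₂_of_le (f := fun lam (_ : lam ∈ Ioi (0 : ℝ)) => bsvy k k p q b γ f lam) lam hl le_rfl
    refine h2.trans ?_
    calc A = ENNReal.ofReal A.toReal := (ENNReal.ofReal_toReal h.ne).symm
      _ ≤ _ := ENNReal.ofReal_le_ofReal (by linarith)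
  unfold bsvy at h1
  set I := ∫⁻ x, innerInt k k lam b γ f x ^ (p / q)
  have h2 : I ^ (1 / p) ≤ ENNReal.ofReal ((A.toReal + 1) * lam⁻¹) := by
    calc I ^ (1 / p) = ENNReal.ofReal lam⁻¹ * (ENNReal.ofReal lam * I ^ (1 / p)) := by
          rw [← mul_assoc, ← ENNReal.ofReal_mul (by positivity), inv_mul_cancel₀ hl.ne',
            ENNReal.ofReal_one, one_mul]
      _ ≤ ENNReal.ofReal lam⁻¹ * ENNReal.ofReal (A.toReal + 1) := by gcongr
      _ = _ := by rw [← ENNReal.ofReal_mul (by positivity), mul_comm]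
  calc I = (I ^ (1 / p)) ^ p := by rw [← ENNReal.rpow_mul, one_div_mul_cancel hp.ne', ENNReal.rpow_one]
    _ ≤ ENNReal.ofReal ((A.toReal + 1) * lam⁻¹) ^ p := ENNReal.rpow_le_rpow h2 hp.le
    _ = _ := by
      rw [ENNReal.ofReal_rpow_of_pos (by positivity), Real.mul_rpow (by positivity) (by positivity),
        Real.inv_rpow hl.le, Real.rpow_neg hl.le]

/-- Uniform weak-type bound for normalised differences. -/
lemma exists_lintegral_level_le {k : ℕ} {p q γ K : ℝ} (hp : 0 < p) (hq : 0 < q) {f : En n → ℝ}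
    (hf : Measurable f) (hK : 0 < K)
    (h : ∀ lam : ℝ, 0 < lam →
      ∫⁻ x, innerInt k k lam (γ / q) γ f x ^ (p / q) ≤ ENNReal.ofReal (K * lam ^ (-p))) :
    ∃ K' : ℝ, 0 < K' ∧ ∀ σ L : ℝ, 0 < σ → 0 < L →
      ∫⁻ x, volume {h ∈ Ann n | L < |kDiff k f (σ • h) x / σ ^ k|} ^ (p / q) ≤
        ENNReal.ofReal (K' * L ^ (-p)) := by
  set c1 : ℝ := min 1 (2 ^ (γ - n)) with hc1
  have hc1p : 0 < c1 := by positivity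
  set C0 : ℝ := max 1 (2 ^ ((k : ℝ) + γ / q)) with hC0
  have hC0p : 0 < C0 := by positivity
  refine ⟨c1 ^ (-(p / q)) * K * C0 ^ p, by positivity, fun σ L hσ hL => ?_⟩
  set lam := L * σ ^ (-(γ / q)) / C0 with hlam
  have hl : 0 < lam := by positivity
  have hlev : C0 * lam * σ ^ ((k : ℝ) + γ / q) = L * σ ^ k := by
    rw [hlam, Real.rpow_add hσ, Real.rpow_neg hσ.le, Real.rpow_natCast]; field_simp
  have hpt : ∀ x, volume {h ∈ Ann n | L < |kDiff k f (σ • h) x / σ ^ k|} ^ (p / q) ≤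
      ENNReal.ofReal ((c1 * σ ^ γ) ^ (-(p / q))) * innerInt k k lam (γ / q) γ f x ^ (p / q) := by
    intro x
    have := annulus_le_innerInt hf k (b := γ / q) (γ := γ) hl hσ x
    rw [← hc1, ← hC0, hlev] at this
    have hset : {h ∈ Ann n | L < |kDiff k f (σ • h) x / σ ^ k|} =
        {h ∈ Ann n | L * σ ^ k < |kDiff k f (σ • h) x|} := by
      ext h
      simp only [mem_ofPred_eq, abs_div, abs_of_pos (pow_pos hσ k), lt_div_iff₀ (pow_pos hσ k)]
    rw [hset]
    have h2 := ENNReal.rpow_le_rpow this (by positivity : 0 ≤ p / q)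
    rw [ENNReal.mul_rpow_of_nonneg _ _ (by positivity), ENNReal.ofReal_rpow_of_pos (by positivity)] at h2
    refine le_trans (le_of_eq ?_) (mul_le_mul_right h2 _)
    rw [← mul_assoc, ← ENNReal.ofReal_mul (by positivity), ← Real.rpow_add (by positivity)]
    simp
  refine (lintegral_mono hpt).trans ?_
  rw [lintegral_const_mul' _ _ ENNReal.ofReal_ne_top]
  refine (mul_le_mul_right (h lam hl) _).trans (le_of_eq ?_)
  rw [← ENNReal.ofReal_mul (by positivity)]
  congr 1
  rw [Real.mul_rpow hc1p.le (by positivity), hlam, Real.div_rpow (by positivity) hC0p.le,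
    Real.mul_rpow hL.le (by positivity), ← Real.rpow_mul hσ.le, ← Real.rpow_mul hσ.le,
    Real.rpow_neg hC0p.le, div_inv_eq_mul]
  have : σ ^ (γ * -(p / q)) * σ ^ (-(γ / q) * -p) = 1 := by
    rw [← Real.rpow_add hσ, show γ * -(p / q) + -(γ / q) * -p = 0 by ring, Real.rpow_zero]
  calc c1 ^ (-(p / q)) * σ ^ (γ * -(p / q)) * (K * (L ^ (-p) * σ ^ (-(γ / q) * -p) * C0 ^ p))
      = c1 ^ (-(p / q)) * K * C0 ^ p * L ^ (-p) * (σ ^ (γ * -(p / q)) * σ ^ (-(γ / q) * -p)) := by ring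
    _ = _ := by rw [this, mul_one]

end Pointwise

lemma form_eq_zero {k : ℕ} {a : (Fin n → ℕ) → ℝ} (h : ∀ x : En n, form k a x = 0) :
    ∀ α ∈ idx n k, a α = 0 := by
  set P : MvPolynomial (Fin n) ℝ := ∑ α ∈ idx n k, MvPolynomial.monomial
    (Finsupp.equivFunOnFinite.symm α) ((Nat.multinomial Finset.univ α : ℝ) * a α) with hP
  have h0 : P = 0 := by
    refine MvPolynomial.funext fun x => ?_
    rw [map_zero, ← h (WithLp.toLp 2 x), hP, map_sum, form]
    refine Finset.sum_congr rfl fun α _ => ?_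
    rw [MvPolynomial.eval_monomial, Finsupp.prod_fintype _ _ (fun i => pow_zero _), mono]
    simp only [Finsupp.equivFunOnFinite_symm_apply_apply]
    ring
  intro α hα
  have h1 : MvPolynomial.coeff (Finsupp.equivFunOnFinite.symm α) P = 0 := by rw [h0]; simp
  rw [hP, MvPolynomial.coeff_sum, Finset.sum_eq_single α] at h1
  · rw [MvPolynomial.coeff_monomial, if_pos rfl] at h1
    refine (mul_eq_zero.1 h1).resolve_left ?_
    exact_mod_cast (Nat.multinomial_pos _ _).ne'
  · intro β _ hβ
    rw [MvPolynomial.coeff_monomial, if_neg]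
    intro h; exact hβ (Finsupp.equivFunOnFinite.symm.injective h)
  · exact fun h => absurd hα h

lemma continuous_form (k : ℕ) (a : (Fin n → ℕ) → ℝ) : Continuous (form k a) :=
  continuous_finsetSum _ fun α _ => (continuous_mono α).mul continuous_const

lemma form_smul (k : ℕ) (a : (Fin n → ℕ) → ℝ) (c : ℝ) (h : En n) :
    form k a (c • h) = c ^ k * form k a h := by
  unfold form
  rw [Finset.mul_sum]
  exact Finset.sum_congr rfl fun α hα => by rw [mono_smul α hα]; ring

lemma form_eq_zero_of_Ann {k : ℕ} (hk : 0 < k) {a : (Fin n → ℕ) → ℝ}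
    (h : ∀ x ∈ Ann n, form k a x = 0) : ∀ α ∈ idx n k, a α = 0 := by
  refine form_eq_zero fun x => ?_
  rcases eq_or_ne x 0 with rfl | hx
  · rw [← zero_smul ℝ (0 : En n), form_smul, zero_pow hk.ne', zero_mul]
  · have hx0 : 0 < ‖x‖ := norm_pos_iff.2 hx
    have h1 : x = (2 / 3 * ‖x‖) • ((3 / 2 / ‖x‖) • x) := by
      rw [smul_smul, show 2 / 3 * ‖x‖ * (3 / 2 / ‖x‖) = 1 by field_simp, one_smul]
    have h2 : ‖(3 / 2 / ‖x‖) • x‖ = 3 / 2 := by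
      rw [norm_smul, Real.norm_of_nonneg (by positivity), div_mul_cancel₀ _ hx0.ne']
    rw [h1, form_smul, h _ ⟨by rw [h2]; norm_num, by rw [h2]; norm_num⟩, mul_zero]

lemma bounded_mono_Ann {k : ℕ} (α : Fin n → ℕ) (hα : α ∈ idx n k) :
    ∃ B : ℝ, 0 < B ∧ ∀ h ∈ Ann n, |mono α h| ≤ B := by
  refine ⟨Nat.multinomial Finset.univ α * 2 ^ k, ?_, fun h hh => ?_⟩
  · have := Nat.multinomial_pos Finset.univ α
    positivity
  · refine (abs_mono_le α hα h).trans ?_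
    gcongr
    exact hh.2.le

lemma integrable_of_bounded_Ann {F : En n → ℝ} (hF : Measurable F) {B : ℝ}
    (hB : ∀ h ∈ Ann n, |F h| ≤ B) : Integrable F (volume.restrict (Ann n)) :=
  Integrable.of_bound (C := B) hF.aestronglyMeasurable
    ((ae_restrict_iff' measurableSet_Ann).2 (ae_of_all _ hB))

/-- Functions on the annulus dual to the monomials of degree `k`. -/
lemma exists_dual (n : ℕ) {k : ℕ} (hk : 0 < k) : ∃ η : (Fin n → ℕ) → En n → ℝ, (∀ α, Measurable (η α)) ∧
    (∃ B : ℝ, 0 < B ∧ ∀ α, ∀ h ∈ Ann n, |η α h| ≤ B) ∧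
    ∀ α ∈ idx n k, ∀ β ∈ idx n k,
      ∫ h in Ann n, η α h * mono β h = if α = β then 1 else 0 := by
  set μ := volume.restrict (Ann n) with hμ
  let ι := {α // α ∈ idx n k}
  let G : Matrix ι ι ℝ := fun α β => ∫ h, mono α.1 h * mono β.1 h ∂μ
  have hint : ∀ α β : ι, Integrable (fun h => mono α.1 h * mono β.1 h) μ := by
    intro α β
    obtain ⟨A, hA, h1⟩ := bounded_mono_Ann α.1 α.2
    obtain ⟨B, hB, h2⟩ := bounded_mono_Ann β.1 β.2
    refine integrable_of_bounded_Ann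
      ((continuous_mono _).mul (continuous_mono _)).measurable (B := A * B) fun h hh => ?_
    rw [abs_mul]
    exact mul_le_mul (h1 h hh) (h2 h hh) (abs_nonneg _) hA.le
  have hdet : IsUnit G.det := by
    rw [isUnit_iff_ne_zero]
    intro h0
    obtain ⟨v, hv, hGv⟩ := Matrix.exists_mulVec_eq_zero_iff.2 h0
    refine hv ?_
    set F : En n → ℝ := fun h => ∑ α : ι, v α * mono α.1 h with hF
    have hFc : Continuous F := continuous_finsetSum _ fun α _ =>
      continuous_const.mul (continuous_mono _)
    have hsq : ∀ h, F h * F h = ∑ α : ι, ∑ β : ι, v α * v β * (mono α.1 h * mono β.1 h) := by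
      intro h
      rw [hF, Finset.sum_mul_sum]
      exact Finset.sum_congr rfl fun α _ => Finset.sum_congr rfl fun β _ => by ring
    have hI : ∫ h, F h * F h ∂μ = 0 := by
      simp_rw [hsq]
      rw [integral_finsetSum _ fun α _ => integrable_finsetSum _ fun β _ => (hint α β).const_mul _]
      refine Finset.sum_eq_zero fun α _ => ?_
      rw [integral_finsetSum _ fun β _ => (hint α β).const_mul _]
      have := congrFun hGv α
      simp only [Matrix.mulVec, dotProduct, Pi.zero_apply] at this
      calc _ = v α * ∑ β : ι, G α β * v β := by
            rw [Finset.mul_sum]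
            refine Finset.sum_congr rfl fun β _ => ?_
            rw [integral_const_mul]; ring
        _ = 0 := by rw [this, mul_zero]
    have hFint : Integrable (fun h => F h * F h) μ := by
      simp_rw [hsq]
      exact integrable_finsetSum _ fun α _ => integrable_finsetSum _ fun β _ => (hint α β).const_mul _
    have hae := (integral_eq_zero_iff_of_nonneg (fun h => mul_self_nonneg (F h)) hFint).1 hI
    have hz : ∀ h ∈ Ann n, F h = 0 := by
      have h1 : EqOn (fun h => F h * F h) 0 (Ann n) :=
        Measure.eqOn_open_of_ae_eq hae isOpen_Ann (hFc.mul hFc).continuousOn continuousOn_const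
      intro h hh
      exact mul_self_eq_zero.1 (h1 hh)
    funext α
    let a : (Fin n → ℕ) → ℝ := fun β => if h : β ∈ idx n k then v ⟨β, h⟩ else 0
    have ha : ∀ h, form k a h = F h := by
      intro h
      rw [form, hF, ← Finset.sum_attach]
      refine Finset.sum_congr rfl fun β _ => ?_
      simp only [a, β.2, dif_pos]
      ring
    have := form_eq_zero_of_Ann hk (a := a) (fun x hx => by rw [ha, hz x hx]) α.1 α.2
    simpa [a, α.2] using this
  let η : (Fin n → ℕ) → En n → ℝ := fun α h =>
    if hα : α ∈ idx n k then ∑ β : ι, G⁻¹ ⟨α, hα⟩ β * mono β.1 h else 0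
  refine ⟨η, fun α => ?_, ?_, fun α hα β hβ => ?_⟩
  · by_cases hα : α ∈ idx n k
    · simp only [η, hα, dif_pos]
      exact (continuous_finsetSum _ fun β _ => continuous_const.mul (continuous_mono _)).measurable
    · simp only [η, hα, dif_neg, not_false_eq_true]
      exact measurable_const
  · choose! B hB0 hB using fun (α : Fin n → ℕ) (hα : α ∈ idx n k) => bounded_mono_Ann α hα
    refine ⟨1 + ∑ γ : ι, ∑ β : ι, |G⁻¹ γ β| * B β.1, ?_, fun α h hh => ?_⟩
    · have : 0 ≤ ∑ γ : ι, ∑ β : ι, |G⁻¹ γ β| * B β.1 :=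
        Finset.sum_nonneg fun γ _ => Finset.sum_nonneg fun β _ =>
          mul_nonneg (abs_nonneg _) (hB0 _ β.2).le
      linarith
    · have h0 : ∀ γ : ι, 0 ≤ ∑ β : ι, |G⁻¹ γ β| * B β.1 := fun γ =>
        Finset.sum_nonneg fun β _ => mul_nonneg (abs_nonneg _) (hB0 _ β.2).le
      by_cases hα : α ∈ idx n k
      · simp only [η, hα, dif_pos]
        calc |∑ β : ι, G⁻¹ ⟨α, hα⟩ β * mono β.1 h| ≤ ∑ β : ι, |G⁻¹ ⟨α, hα⟩ β * mono β.1 h| :=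
              Finset.abs_sum_le_sum_abs _ _
          _ ≤ ∑ β : ι, |G⁻¹ ⟨α, hα⟩ β| * B β.1 := by
              refine Finset.sum_le_sum fun β _ => ?_
              rw [abs_mul]
              exact mul_le_mul_of_nonneg_left (hB _ β.2 h hh) (abs_nonneg _)
          _ ≤ ∑ γ : ι, ∑ β : ι, |G⁻¹ γ β| * B β.1 :=
              Finset.single_le_sum (f := fun γ : ι => ∑ β : ι, |G⁻¹ γ β| * B β.1)
                (fun γ _ => h0 γ) (Finset.mem_univ _)
          _ ≤ _ := by linarith
      · simp only [η, hα, dif_neg, not_false_eq_true, abs_zero]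
        have : 0 ≤ ∑ γ : ι, ∑ β : ι, |G⁻¹ γ β| * B β.1 := Finset.sum_nonneg fun γ _ => h0 γ
        linarith
  · simp only [η, hα, dif_pos]
    have h1 : ∀ h, (∑ γ : ι, G⁻¹ ⟨α, hα⟩ γ * mono γ.1 h) * mono β h =
        ∑ γ : ι, G⁻¹ ⟨α, hα⟩ γ * (mono γ.1 h * mono β h) := by
      intro h; rw [Finset.sum_mul]; exact Finset.sum_congr rfl fun γ _ => by ring
    simp_rw [h1]
    rw [integral_finsetSum _ fun γ _ => (hint γ ⟨β, hβ⟩).const_mul _]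
    simp_rw [integral_const_mul]
    have h2 := congrFun (congrFun (Matrix.nonsing_inv_mul G hdet) ⟨α, hα⟩) ⟨β, hβ⟩
    rw [Matrix.mul_apply, Matrix.one_apply] at h2
    simpa [G] using h2

section Pointwise


open scoped Pointwise


/-- A homogeneous polynomial is large on a substantial part of the annulus. -/
lemma exists_level_form (n : ℕ) {k : ℕ} (hk : 0 < k) : ∃ c : ℝ, 0 < c ∧ ∀ a : (Fin n → ℕ) → ℝ,
    0 < ∑ α ∈ idx n k, |a α| →
    ENNReal.ofReal c ≤ volume {h ∈ Ann n | c * ∑ α ∈ idx n k, |a α| ≤ |form k a h|} := by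
  obtain ⟨η, hηm, ⟨B, hB, hηB⟩, hη⟩ := exists_dual n hk
  choose! b hb0 hb using fun (α : Fin n → ℕ) (hα : α ∈ idx n k) => bounded_mono_Ann α hα
  set B1 := 1 + ∑ α ∈ idx n k, b α with hB1
  have hsum : 0 ≤ ∑ α ∈ idx n k, b α := Finset.sum_nonneg fun α hα => (hb0 α hα).le
  have hB1p : 0 < B1 := by linarith
  set V := (volume (Ann n)).toReal with hV
  have hV0 : 0 ≤ V := ENNReal.toReal_nonneg
  set D := (idx n k).card * B with hD
  have hD0 : 0 ≤ D := by positivity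
  refine ⟨1 / (2 * (D + 1) * (V + B1 + 1)), by positivity, fun a ha => ?_⟩
  set c := 1 / (2 * (D + 1) * (V + B1 + 1)) with hc
  have hcp : 0 < c := by positivity
  set N := ∑ α ∈ idx n k, |a α| with hN
  set S := {h ∈ Ann n | c * N ≤ |form k a h|} with hS
  have hSm : MeasurableSet S := measurableSet_Ann.inter
    (measurableSet_le measurable_const (continuous_form k a).measurable.abs)
  have hSA : S ⊆ Ann n := fun h hh => hh.1
  have hStop : volume S ≠ ⊤ := ((measure_mono hSA).trans_lt volume_Ann_lt_top).ne
  have hformB : ∀ h ∈ Ann n, |form k a h| ≤ B1 * N := by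
    intro h hh
    calc |form k a h| ≤ ∑ α ∈ idx n k, |mono α h * a α| := Finset.abs_sum_le_sum_abs _ _
      _ ≤ ∑ α ∈ idx n k, B1 * |a α| := by
          refine Finset.sum_le_sum fun α hα => ?_
          rw [abs_mul]
          refine mul_le_mul_of_nonneg_right ((hb α hα h hh).trans ?_) (abs_nonneg _)
          have := Finset.single_le_sum (f := b) (fun α hα => (hb0 α hα).le) hα
          linarith
      _ = _ := by rw [Finset.mul_sum]
  have hfi : Integrable (form k a) (volume.restrict (Ann n)) :=
    integrable_of_bounded_Ann (continuous_form k a).measurable hformB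
  have hbound : ∫ h in Ann n, |form k a h| ≤ c * N * V + B1 * N * (volume S).toReal := by
    have e : c * N * V + B1 * N * (volume S).toReal =
        ∫ h in Ann n, (c * N + S.indicator (fun _ => B1 * N) h) := by
      rw [integral_add (integrable_const _) ((integrable_const _).indicator hSm), integral_const,
        integral_indicator_const _ hSm]
      simp only [measureReal_def, Measure.restrict_apply_univ, Measure.restrict_apply hSm,
        inter_eq_self_of_subset_left hSA, smul_eq_mul]
      ring
    rw [e]
    refine integral_mono_ae hfi.abs ((integrable_const _).add ((integrable_const _).indicator hSm)) ?_
    refine (ae_restrict_iff' measurableSet_Ann).2 (ae_of_all _ fun h hh => ?_)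
    by_cases h1 : h ∈ S
    · simp only [indicator_of_mem h1]
      have := hformB h hh
      have : 0 ≤ c * N := by positivity
      linarith
    · simp only [indicator_of_notMem h1, add_zero]
      by_contra h2
      exact h1 ⟨hh, (not_le.1 h2).le⟩
  have hcoef : ∀ α ∈ idx n k, |a α| ≤ B * ∫ h in Ann n, |form k a h| := by
    intro α hα
    have hi : ∀ β ∈ idx n k, Integrable (fun h => η α h * mono β h) (volume.restrict (Ann n)) := by
      intro β hβ
      refine integrable_of_bounded_Ann ((hηm α).mul (continuous_mono β).measurable)
        (B := B * b β) fun h hh => ?_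
      rw [abs_mul]
      exact mul_le_mul (hηB α h hh) (hb β hβ h hh) (abs_nonneg _) hB.le
    have h1 : a α = ∫ h in Ann n, η α h * form k a h := by
      have : ∀ h, η α h * form k a h = ∑ β ∈ idx n k, η α h * mono β h * a β := by
        intro h; rw [form, Finset.mul_sum]; exact Finset.sum_congr rfl fun β _ => by ring
      simp_rw [this]
      rw [integral_finsetSum _ fun β hβ => (hi β hβ).mul_const _]
      simp_rw [integral_mul_const]
      rw [Finset.sum_congr rfl fun β hβ => by rw [hη α hα β hβ]]
      simp [hα]
    rw [h1, ← integral_const_mul]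
    refine (abs_integral_le_integral_abs).trans ?_
    refine integral_mono_of_nonneg (ae_of_all _ fun _ => abs_nonneg _) (hfi.abs.const_mul B) ?_
    refine (ae_restrict_iff' measurableSet_Ann).2 (ae_of_all _ fun h hh => ?_)
    simp only [abs_mul]
    exact mul_le_mul_of_nonneg_right (hηB α h hh) (abs_nonneg _)
  have hNle : N ≤ D * (c * N * V + B1 * N * (volume S).toReal) := by
    calc N ≤ ∑ α ∈ idx n k, B * ∫ h in Ann n, |form k a h| := Finset.sum_le_sum hcoef
      _ = D * ∫ h in Ann n, |form k a h| := by rw [Finset.sum_const, nsmul_eq_mul, hD]; ring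
      _ ≤ _ := by gcongr
  set w := (volume S).toReal with hw
  have hw0 : 0 ≤ w := ENNReal.toReal_nonneg
  have h1 : 1 ≤ D * (c * V + B1 * w) := by
    have : N * 1 ≤ N * (D * (c * V + B1 * w)) := by linarith
    exact le_of_mul_le_mul_left this ha
  have h2 : c * (2 * (D + 1) * (V + B1 + 1)) = 1 := by rw [hc]; field_simp
  refine ENNReal.ofReal_le_of_le_toReal ?_
  by_contra hlt
  have h3 : w < c := not_le.1 hlt
  have h4 : D * (c * V + B1 * w) ≤ D * (c * V + B1 * c) := by gcongr
  nlinarith [mul_nonneg hcp.le hD0, mul_nonneg (mul_nonneg hcp.le hD0) hV0,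
    mul_nonneg (mul_nonneg hcp.le hD0) hB1p.le, mul_nonneg hcp.le hV0, mul_pos hcp hB1p]

lemma exists_lintegral_dev_le {k : ℕ} {g : (Fin n → ℕ) → En n → ℝ} (hgm : ∀ α, Measurable (g α))
    {x : En n} (hx : ∀ α ∈ idx n k, Leb (g α) x) {M : ℝ} (hM : 0 < M) :
    ∃ r0 : ℝ, 0 < r0 ∧ ∀ r : ℝ, 0 < r → r < r0 →
      ∫⁻ z in Metric.ball x r, dev k g (fun α => g α x) z ≤ ENNReal.ofReal (M * r ^ n) := by
  have h1 : Tendsto (fun r : ℝ => ∑ α ∈ idx n k, ENNReal.ofReal (1 / r ^ n) *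
      ∫⁻ z in Metric.ball x r, ‖g α z - g α x‖ₑ) (𝓝[>] 0) (𝓝 0) := by
    have := tendsto_finsetSum (idx n k) fun α hα => hx α hα
    simpa using this
  have h2 := h1.eventually_lt_const (show (0 : ℝ≥0∞) < ENNReal.ofReal M by simpa using hM)
  obtain ⟨r0, hr0, H⟩ := mem_nhdsGT_iff_exists_Ioo_subset.1 h2
  refine ⟨r0, hr0, fun r hr hrr => ?_⟩
  have h3 : ∑ α ∈ idx n k, ENNReal.ofReal (1 / r ^ n) *
      ∫⁻ z in Metric.ball x r, ‖g α z - g α x‖ₑ < ENNReal.ofReal M := H ⟨hr, hrr⟩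
  rw [← Finset.mul_sum] at h3
  unfold dev
  rw [lintegral_finsetSum' _ fun α _ => ((hgm α).sub_const _).enorm.aemeasurable]
  calc _ = ENNReal.ofReal (r ^ n) * (ENNReal.ofReal (1 / r ^ n) *
        ∑ α ∈ idx n k, ∫⁻ z in Metric.ball x r, ‖g α z - g α x‖ₑ) := by
        rw [← mul_assoc, ← ENNReal.ofReal_mul (by positivity), mul_one_div_cancel (by positivity),
          ENNReal.ofReal_one, one_mul]
    _ ≤ ENNReal.ofReal (r ^ n) * ENNReal.ofReal M := by gcongr
    _ = _ := by rw [← ENNReal.ofReal_mul (by positivity), mul_comm]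

/-- Taylor expansion in measure on small annuli at Lebesgue points. -/
lemma exists_measure_taylor_le {k : ℕ} (hk : 0 < k) {f : En n → ℝ} {g : (Fin n → ℕ) → En n → ℝ}
    (hf : LocallyIntegrable f volume) (hw : HasWeakDerivs k f g) (hgm : ∀ α, Measurable (g α))
    {x : En n} (hfx : Leb f x) (hx : ∀ α ∈ idx n k, Leb (g α) x) {δ c : ℝ} (hδ : 0 < δ) (hc : 0 < c) :
    ∃ σ0 : ℝ, 0 < σ0 ∧ ∀ σ : ℝ, 0 < σ → σ < σ0 →
      volume {v ∈ Ann n | δ * σ ^ k < |kDiff k f (σ • v) x - σ ^ k * form k (fun α => g α x) v|} ≤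
        ENNReal.ofReal c := by
  obtain ⟨C, hC, H⟩ := measure_level_le n k (t := 1) (s := 1) le_rfl le_rfl (by simpa using hk)
  set M := c * δ / (C * 2 ^ n * 2 ^ k) with hM
  have hMp : 0 < M := by positivity
  obtain ⟨r0, hr0, hr⟩ := exists_lintegral_dev_le hgm hx hMp
  refine ⟨r0 / (2 * (3 * k + 2) + 1), by positivity, fun σ hσ hσ0 => ?_⟩
  rw [lt_div_iff₀ (by positivity)] at hσ0
  set a : (Fin n → ℕ) → ℝ := fun α => g α x with ha
  set S := {v ∈ Ann n | δ * σ ^ k < |kDiff k f (σ • v) x - σ ^ k * form k a v|} with hS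
  have h1 := H f g hf hw hgm a x (2 * σ) M (δ * σ ^ k) (by positivity) hMp (by positivity) hfx
    (fun r hr1 hr2 => by
      simp_rw [ENNReal.rpow_one]
      refine hr r hr1 (lt_of_le_of_lt hr2 ?_)
      nlinarith)
  have hsub : σ • S ⊆ {h : En n | ‖h‖ < 2 * σ ∧ δ * σ ^ k < |kDiff k f h x - form k a h|} := by
    rintro _ ⟨v, hv, rfl⟩
    refine ⟨?_, ?_⟩
    · simp only [norm_smul, Real.norm_of_nonneg hσ.le]
      have := hv.1.2
      nlinarith
    · simp only [form_smul]
      exact hv.2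
  have hvol : volume (σ • S) = ENNReal.ofReal (σ ^ n) * volume S := by
    rw [Measure.addHaar_smul]
    simp [abs_of_pos hσ]
  have h2 : ENNReal.ofReal (σ ^ n) * volume S ≤ ENNReal.ofReal (σ ^ n) * ENNReal.ofReal c := by
    rw [← hvol]
    refine ((measure_mono hsub).trans h1).trans (le_of_eq ?_)
    rw [← ENNReal.ofReal_mul (by positivity)]
    congr 1
    rw [one_div_one, Real.rpow_one, Real.rpow_one, hM, mul_pow, mul_pow]
    field_simp
  exact (ENNReal.mul_le_mul_iff_right (by simpa using by positivity) ENNReal.ofReal_ne_top).1 h2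

end Pointwise

lemma gradLen_le_sum (m : ℕ) (g : (Fin n → ℕ) → En n → ℝ) (x : En n) :
    gradLen m g x ≤ ∑ α ∈ idx n m, |g α x| := by
  rw [gradLen_eq]
  have h0 : 0 ≤ ∑ α ∈ idx n m, |g α x| := Finset.sum_nonneg fun _ _ => abs_nonneg _
  refine Real.sqrt_le_iff.2 ⟨h0, ?_⟩
  rw [sq (∑ α ∈ idx n m, |g α x|), Finset.sum_mul]
  refine Finset.sum_le_sum fun α hα => ?_
  rw [← sq_abs, sq]
  exact mul_le_mul_of_nonneg_left
    (Finset.single_le_sum (f := fun α => |g α x|) (fun _ _ => abs_nonneg _) hα) (abs_nonneg _)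

/-- Pointwise lower bound for `innerInt` along small scales. -/
lemma eventually_le_innerInt {k : ℕ} (hk : 0 < k) {p q γ : ℝ} (hp : 0 < p) (hq : 0 < q) (hγ : γ ≠ 0) :
    ∃ E : ℝ, 0 < E ∧ ∀ (f : En n → ℝ) (g : (Fin n → ℕ) → En n → ℝ), Measurable f →
      LocallyIntegrable f volume → HasWeakDerivs k f g → (∀ α, Measurable (g α)) → ∀ x : En n,
      Leb f x → (∀ α ∈ idx n k, Leb (g α) x) → ∀ᶠ j : ℕ in atTop,
        ENNReal.ofReal (E * (∑ α ∈ idx n k, |g α x|) ^ p) ≤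
          ENNReal.ofReal ((((j : ℝ) + 1) ^ γ) ^ p) *
            innerInt k k (((j : ℝ) + 1) ^ γ) (γ / q) γ f x ^ (p / q) := by
  obtain ⟨c, hc, Hc⟩ := exists_level_form n hk
  set c1 : ℝ := min 1 (2 ^ (γ - n)) with hc1
  have hc1p : 0 < c1 := by positivity
  set C0 : ℝ := max 1 (2 ^ ((k : ℝ) + γ / q)) with hC0
  have hC0p : 0 < C0 := by positivity
  refine ⟨(c1 * (c / 2)) ^ (p / q) * (c / (4 * C0)) ^ p, by positivity,
    fun f g hfm hf hw hgm x hfx hgx => ?_⟩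
  set N := ∑ α ∈ idx n k, |g α x| with hN
  have hN0 : 0 ≤ N := Finset.sum_nonneg fun _ _ => abs_nonneg _
  rcases hN0.eq_or_lt with h0 | hNp
  · refine Eventually.of_forall fun j => ?_
    rw [← h0, Real.zero_rpow hp.ne', mul_zero, ENNReal.ofReal_zero]
    exact zero_le
  obtain ⟨σ0, hσ0, Hσ⟩ := exists_measure_taylor_le hk hf hw hgm hfx hgx
    (show 0 < c / 2 * N by positivity) (show 0 < c / 2 by positivity)
  set κ := c * N / (4 * C0) with hκ
  have hκp : 0 < κ := by positivity
  have hT : Tendsto (fun j : ℕ => κ ^ (q / γ) * ((j : ℝ) + 1) ^ (-q)) atTop (𝓝 0) := by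
    have h1 : Tendsto (fun j : ℕ => (j : ℝ) + 1) atTop atTop :=
      tendsto_atTop_add_const_right _ _ tendsto_natCast_atTop_atTop
    simpa using ((tendsto_rpow_neg_atTop hq).comp h1).const_mul (κ ^ (q / γ))
  filter_upwards [hT.eventually_lt_const hσ0] with j hj
  have hj0 : (0 : ℝ) < (j : ℝ) + 1 := by positivity
  set σ := κ ^ (q / γ) * ((j : ℝ) + 1) ^ (-q) with hσ
  have hσp : 0 < σ := by positivity
  set lam := ((j : ℝ) + 1) ^ γ with hlam
  have hl : 0 < lam := by positivity
  have hσγ : σ ^ γ = (κ / lam) ^ q := by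
    rw [hσ, Real.mul_rpow (by positivity) (by positivity), ← Real.rpow_mul hκp.le,
      ← Real.rpow_mul hj0.le, div_mul_cancel₀ _ hγ, Real.div_rpow hκp.le hl.le, hlam,
      ← Real.rpow_mul hj0.le, show -q * γ = -(γ * q) by ring, Real.rpow_neg hj0.le]
    rfl
  have hσγq : σ ^ (γ / q) = κ / lam := by
    rw [div_eq_mul_one_div, Real.rpow_mul hσp.le, hσγ, ← Real.rpow_mul (by positivity),
      mul_one_div_cancel hq.ne', Real.rpow_one]
  have hlev : C0 * lam * σ ^ ((k : ℝ) + γ / q) = c / 4 * N * σ ^ k := by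
    rw [Real.rpow_add hσp, hσγq, Real.rpow_natCast, hκ]; field_simp
  have hann := annulus_le_innerInt hfm k (b := γ / q) (γ := γ) hl hσp x
  rw [← hc1, ← hC0, hlev] at hann
  set Good := {h ∈ Ann n | c / 4 * N * σ ^ k < |kDiff k f (σ • h) x|} with hGood
  have hsub : {h ∈ Ann n | c * N ≤ |form k (fun α => g α x) h|} ⊆
      {v ∈ Ann n | c / 2 * N * σ ^ k < |kDiff k f (σ • v) x - σ ^ k * form k (fun α => g α x) v|} ∪ Good := by
    rintro h ⟨hA, hh⟩
    by_cases hb : c / 2 * N * σ ^ k < |kDiff k f (σ • h) x - σ ^ k * form k (fun α => g α x) h|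
    · exact Or.inl ⟨hA, hb⟩
    · refine Or.inr ⟨hA, ?_⟩
      have hb := not_lt.1 hb
      have h1 : σ ^ k * (c * N) ≤ |σ ^ k * form k (fun α => g α x) h| := by
        rw [abs_mul, abs_of_pos (pow_pos hσp k)]
        gcongr
      have h2 := abs_sub_abs_le_abs_sub (σ ^ k * form k (fun α => g α x) h) (kDiff k f (σ • h) x)
      rw [abs_sub_comm] at h2
      have h3 : 0 < c * N * σ ^ k := by positivity
      nlinarith
  have hgood : ENNReal.ofReal (c / 2) ≤ volume Good := by
    have h1 := (Hc (fun α => g α x) hNp).trans ((measure_mono hsub).trans (measure_union_le _ _))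
    have h2 : ENNReal.ofReal (c / 2) + ENNReal.ofReal (c / 2) ≤ ENNReal.ofReal (c / 2) + volume Good := by
      rw [← ENNReal.ofReal_add (by positivity) (by positivity), add_halves]
      exact h1.trans (by gcongr; exact Hσ σ hσp hj)
    exact (ENNReal.add_le_add_iff_left ENNReal.ofReal_ne_top).1 h2
  have h3 : ENNReal.ofReal (c1 * σ ^ γ * (c / 2)) ≤ innerInt k k lam (γ / q) γ f x := by
    rw [ENNReal.ofReal_mul (by positivity)]
    exact (mul_le_mul_right hgood _).trans hann
  refine le_trans (le_of_eq ?_) (mul_le_mul_right (ENNReal.rpow_le_rpow h3 (by positivity)) _)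
  rw [ENNReal.ofReal_rpow_of_pos (by positivity), ← ENNReal.ofReal_mul (by positivity)]
  congr 1
  rw [hσγ, show c1 * (κ / lam) ^ q * (c / 2) = (c1 * (c / 2)) * (κ / lam) ^ q by ring,
    Real.mul_rpow (x := c1 * (c / 2)) (by positivity) (by positivity),
    ← Real.rpow_mul (x := κ / lam) (by positivity), mul_div_cancel₀ _ hq.ne',
    Real.div_rpow hκp.le hl.le, hκ,
    show c * N / (4 * C0) = c / (4 * C0) * N by ring, Real.mul_rpow (by positivity) hNp.le]
  field_simp

theorem gradLp_lt_top {k : ℕ} (hk : 0 < k) {p q γ K : ℝ} (hp : 0 < p) (hq : 0 < q) (hγ : γ ≠ 0)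
    {f : En n → ℝ} (hfm : Measurable f) (hf : LocallyIntegrable f volume)
    (h : ∀ lam : ℝ, 0 < lam →
      ∫⁻ x, innerInt k k lam (γ / q) γ f x ^ (p / q) ≤ ENNReal.ofReal (K * lam ^ (-p)))
    {g : (Fin n → ℕ) → En n → ℝ} (hw : HasWeakDerivs k f g) (hgm : ∀ α, Measurable (g α)) :
    gradLp p k g < ⊤ := by
  obtain ⟨E, hE, H⟩ := eventually_le_innerInt (n := n) hk hp hq hγ
  set lam : ℕ → ℝ := fun j => ((j : ℝ) + 1) ^ γ with hlam
  have hl : ∀ j, 0 < lam j := fun j => by simp only [hlam]; positivity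
  have hae : ∀ᵐ x, ENNReal.ofReal (E * (∑ α ∈ idx n k, |g α x|) ^ p) ≤
      liminf (fun j => ENNReal.ofReal (lam j ^ p) *
        innerInt k k (lam j) (γ / q) γ f x ^ (p / q)) atTop := by
    have h1 : ∀ᵐ x, ∀ α ∈ idx n k, Leb (g α) x := (Finset.eventually_all _).2 fun α hα =>
      ae_leb (hw.1 α (mem_idx.1 hα))
    filter_upwards [ae_leb hf, h1] with x hfx hgx
    exact le_liminf_of_le (h := H f g hfm hf hw hgm x hfx hgx)
  have hfin : ∫⁻ x, ENNReal.ofReal (E * (∑ α ∈ idx n k, |g α x|) ^ p) ≤ ENNReal.ofReal K := by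
    refine (lintegral_mono_ae hae).trans ((lintegral_liminf_le fun j =>
      ((measurable_innerInt hfm k _ _ _).pow_const _).const_mul _).trans ?_)
    refine liminf_le_of_le (h := fun b hb => ?_)
    obtain ⟨j, hj⟩ := hb.exists
    refine hj.trans ?_
    rw [lintegral_const_mul' _ _ ENNReal.ofReal_ne_top]
    refine (mul_le_mul_right (h _ (hl j)) _).trans (le_of_eq ?_)
    have := hl j
    rw [← ENNReal.ofReal_mul (by positivity)]
    congr 1
    rw [mul_left_comm, ← Real.rpow_add this, add_neg_cancel, Real.rpow_zero, mul_one]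
  unfold gradLp
  refine ENNReal.rpow_lt_top_of_nonneg (by positivity) (ne_of_lt ?_)
  calc ∫⁻ x, ENNReal.ofReal (gradLen k g x ^ p)
      ≤ ∫⁻ x, ENNReal.ofReal E⁻¹ * ENNReal.ofReal (E * (∑ α ∈ idx n k, |g α x|) ^ p) := by
        refine lintegral_mono fun x => ?_
        rw [← ENNReal.ofReal_mul (by positivity), inv_mul_cancel_left₀ hE.ne']
        exact ENNReal.ofReal_le_ofReal
          (Real.rpow_le_rpow (Real.sqrt_nonneg _) (gradLen_le_sum k g x) hp.le)
    _ ≤ ENNReal.ofReal E⁻¹ * ENNReal.ofReal K := by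
        rw [lintegral_const_mul' _ _ ENNReal.ofReal_ne_top]; gcongr
    _ < ⊤ := ENNReal.mul_lt_top ENNReal.ofReal_lt_top ENNReal.ofReal_lt_top

/-- A bounded measurable function is uniformly approximable by simple functions. -/
lemma exists_simpleFunc_approx {X : Type*} [MeasurableSpace X] {ψ : X → ℝ} (hψ : Measurable ψ)
    {b : ℝ} (hb : ∀ x, |ψ x| ≤ b) {δ : ℝ} (hδ : 0 < δ) :
    ∃ s : SimpleFunc X ℝ, ∀ x, |ψ x - s x| ≤ δ := by
  have hm : Measurable fun x => ⌊ψ x / δ⌋ := (hψ.div_const δ).floor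
  have hfin : (range fun x => ⌊ψ x / δ⌋).Finite := by
    refine (Set.finite_Icc ⌊-b / δ⌋ ⌊b / δ⌋).subset ?_
    rintro _ ⟨x, rfl⟩
    have := abs_le.1 (hb x)
    exact ⟨Int.floor_le_floor (by gcongr; exact this.1), Int.floor_le_floor (by gcongr; exact this.2)⟩
  refine ⟨⟨fun x => δ * (⌊ψ x / δ⌋ : ℤ), fun y => ?_, ?_⟩, fun x => ?_⟩
  · have h : Measurable fun x => δ * ((⌊ψ x / δ⌋ : ℤ) : ℝ) :=
      (measurable_from_top.comp hm).const_mul δ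
    exact h (measurableSet_singleton y)
  · have := hfin.image (fun i : ℤ => δ * (i : ℝ))
    rwa [← range_comp] at this
  · change |ψ x - δ * (⌊ψ x / δ⌋ : ℤ)| ≤ δ
    have h1 := Int.floor_le (ψ x / δ)
    have h2 := Int.lt_floor_add_one (ψ x / δ)
    rw [le_div_iff₀ hδ] at h1
    rw [div_lt_iff₀ hδ] at h2
    rw [abs_le]
    constructor <;> nlinarith

/-- Weak sequential compactness of bounded uniformly integrable sequences. -/
theorem exists_weak_limit {X : Type*} [MeasurableSpace X] (m : Measure X) [IsFiniteMeasure m]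
    {v : ℕ → X → ℝ} (hv : ∀ j, Integrable (v j) m)
    (hUI : ∀ δ : ℝ, 0 < δ → ∃ η : ℝ, 0 < η ∧ ∀ j S, MeasurableSet S → m S ≤ ENNReal.ofReal η →
      |∫ x in S, v j x ∂m| ≤ δ)
    {B : ℝ} (hB : ∀ j, ∫ x, |v j x| ∂m ≤ B) :
    ∃ g : X → ℝ, Integrable g m ∧ ∀ ψ : X → ℝ, Measurable ψ → (∃ b, ∀ x, |ψ x| ≤ b) →
      ∀ l : ℝ, Tendsto (fun j => ∫ x, v j x * ψ x ∂m) atTop (𝓝 l) → ∫ x, g x * ψ x ∂m = l := by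
  set U : Ultrafilter ℕ := hyperfilter ℕ with hUdef
  have hU : (U : Filter ℕ) ≤ atTop := Nat.hyperfilter_le_atTop
  have hB0 : 0 ≤ B := (integral_nonneg fun _ => abs_nonneg _).trans (hB 0)
  have hex : ∀ S : Set X, ∃ l : ℝ, Tendsto (fun j => ∫ x in S, v j x ∂m) U (𝓝 l) := by
    intro S
    have hmem : ∀ j, ∫ x in S, v j x ∂m ∈ Icc (-B) B := by
      intro j
      refine abs_le.1 ?_
      refine abs_integral_le_integral_abs.trans (le_trans ?_ (hB j))
      exact setIntegral_le_integral (hv j).abs (ae_of_all _ fun _ => abs_nonneg _)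
    obtain ⟨l, _, hl⟩ := (isCompact_Icc (a := -B) (b := B)).ultrafilter_le_nhds
      (U.map fun j => ∫ x in S, v j x ∂m)
      (le_principal_iff.2 (Filter.mem_map.2 (Filter.univ_mem' hmem)))
    exact ⟨l, hl⟩
  choose L hL using hex
  have hLadd : ∀ S T : Set X, MeasurableSet T → Disjoint S T → L (S ∪ T) = L S + L T := by
    intro S T hT hST
    refine tendsto_nhds_unique (hL (S ∪ T)) ?_
    refine ((hL S).add (hL T)).congr fun j => ?_
    rw [setIntegral_union hST hT (hv j).integrableOn (hv j).integrableOn]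
  have hL0 : ∀ S : Set X, m S = 0 → L S = 0 := by
    intro S hS
    refine tendsto_nhds_unique (hL S) ?_
    simp [setIntegral_measure_zero _ hS]
  have hLsmall : ∀ δ : ℝ, 0 < δ → ∃ η : ℝ, 0 < η ∧ ∀ S, MeasurableSet S →
      m S ≤ ENNReal.ofReal η → |L S| ≤ δ := by
    intro δ hδ
    obtain ⟨η, hη, H⟩ := hUI δ hδ
    exact ⟨η, hη, fun S hS hmS => le_of_tendsto (hL S).abs (Eventually.of_forall fun j => H j S hS hmS)⟩
  let s : SignedMeasure X :=
    { measureOf' := fun S => if MeasurableSet S then L S else 0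
      empty' := by simp [hL0 ∅ (by simp)]
      not_measurable' := fun S hS => by simp [hS]
      m_iUnion' := fun F hF hd => by
        simp only [hF, if_true, MeasurableSet.iUnion hF]
        have hsum : ∑' i, m (F i) ≠ ⊤ := by
          rw [← measure_iUnion hd hF]; exact measure_ne_top _ _
        have htail := ENNReal.tendsto_tsum_compl_atTop_zero hsum
        rw [HasSum, Metric.tendsto_nhds]
        intro δ hδ
        obtain ⟨η, hη, H⟩ := hLsmall (δ / 2) (by positivity)
        have h1 := htail.eventually_le_const (show (0 : ℝ≥0∞) < ENNReal.ofReal η by simpa using hη)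
        simp only [SummationFilter.unconditional_filter]
        filter_upwards [h1] with T hT
        have hfin : ∀ T : Finset ℕ, L (⋃ i ∈ T, F i) = ∑ i ∈ T, L (F i) := by
          intro T
          induction T using Finset.induction_on with
          | empty => simp [hL0 ∅ (by simp)]
          | insert a T ha ih =>
            rw [Finset.set_biUnion_insert, Finset.sum_insert ha, ← ih]
            refine hLadd _ _ (Finset.measurableSet_biUnion _ fun i _ => hF i) ?_
            rw [disjoint_iUnion₂_right]
            intro i hi
            exact hd (fun h => ha (h ▸ hi))
        set R : Set X := ⋃ i : {i // i ∉ T}, F i with hR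
        have hRm : MeasurableSet R := MeasurableSet.iUnion fun i => hF i
        have hsplit : (⋃ i, F i) = (⋃ i ∈ T, F i) ∪ R := by
          ext x
          simp only [hR, mem_iUnion, mem_union, Subtype.exists]
          constructor
          · rintro ⟨i, hi⟩
            by_cases h : i ∈ T
            · exact Or.inl ⟨i, h, hi⟩
            · exact Or.inr ⟨i, h, hi⟩
          · rintro (⟨i, _, hi⟩ | ⟨i, _, hi⟩) <;> exact ⟨i, hi⟩
        have hdisj : Disjoint (⋃ i ∈ T, F i) R := by
          rw [hR, disjoint_iUnion₂_left]
          intro i hi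
          rw [disjoint_iUnion_right]
          rintro ⟨j, hj⟩
          exact hd (fun h => hj (by rw [show j = i from h.symm]; exact hi))
        rw [hsplit, hLadd _ _ hRm hdisj, hfin, Real.dist_eq]
        have hmR : m R ≤ ENNReal.ofReal η := (measure_iUnion_le _).trans hT
        have := H R hRm hmR
        rw [sub_add_cancel_left, abs_neg]
        linarith }
  have hs : ∀ S, MeasurableSet S → s S = L S := fun S hS => by
    change (if MeasurableSet S then L S else 0) = L S
    rw [if_pos hS]
  have hac : s ≪ᵥ m.toENNRealVectorMeasure := by
    refine VectorMeasure.AbsolutelyContinuous.mk fun S hS h0 => ?_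
    rw [hs S hS]
    rw [Measure.toENNRealVectorMeasure_apply_measurable hS] at h0
    exact hL0 S h0
  set g := s.rnDeriv m with hg
  have hgi : Integrable g m := SignedMeasure.integrable_rnDeriv s m
  have hgS : ∀ S, MeasurableSet S → ∫ x in S, g x ∂m = L S := by
    intro S hS
    rw [← hs S hS, ← withDensityᵥ_apply hgi hS, SignedMeasure.withDensityᵥ_rnDeriv_eq s m hac]
  refine ⟨g, hgi, fun ψ hψ hbψ l hl => ?_⟩
  obtain ⟨b, hb⟩ := hbψ
  have hmul : ∀ {w : X → ℝ}, Integrable w m → ∀ {ψ : X → ℝ}, Measurable ψ → ∀ {b : ℝ},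
      (∀ x, |ψ x| ≤ b) → Integrable (fun x => w x * ψ x) m := by
    intro w hw ψ hψ b hb
    exact hw.mul_bdd hψ.aestronglyMeasurable (c := b) (ae_of_all _ hb)
  have hsb : ∀ φ : SimpleFunc X ℝ, ∃ b, ∀ x, |φ x| ≤ b := fun φ => φ.exists_forall_norm_le
  have hsimple : ∀ φ : SimpleFunc X ℝ,
      Tendsto (fun j => ∫ x, v j x * φ x ∂m) U (𝓝 (∫ x, g x * φ x ∂m)) := by
    intro φ
    induction φ using SimpleFunc.induction with
    | const c hS =>
      rename_i S
      have e : ∀ w : X → ℝ, ∫ x, w x * (SimpleFunc.piecewise S hS (SimpleFunc.const X c)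
          (SimpleFunc.const X 0)) x ∂m = (∫ x in S, w x ∂m) * c := by
        intro w
        rw [← integral_mul_const, ← integral_indicator hS]
        congr 1
        funext x
        by_cases hx : x ∈ S <;> simp [hx]
      simp_rw [e]
      rw [hgS S hS]
      exact (hL S).mul_const c
    | @add f1 f2 hd h1 h2 =>
      obtain ⟨b1, hb1⟩ := hsb f1
      obtain ⟨b2, hb2⟩ := hsb f2
      simp only [SimpleFunc.coe_add, Pi.add_apply, mul_add]
      rw [integral_add (hmul hgi f1.measurable hb1) (hmul hgi f2.measurable hb2)]
      refine (h1.add h2).congr fun j => ?_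
      rw [integral_add (hmul (hv j) f1.measurable hb1) (hmul (hv j) f2.measurable hb2)]
  have happrox : ∀ {w : X → ℝ}, Integrable w m → ∀ {D δ : ℝ}, ∫ x, |w x| ∂m ≤ D → 0 < δ →
      ∀ φ : SimpleFunc X ℝ, (∀ x, |ψ x - φ x| ≤ δ) →
      |∫ x, w x * ψ x ∂m - ∫ x, w x * φ x ∂m| ≤ D * δ := by
    intro w hw D δ hD hδ φ hφ
    obtain ⟨b1, hb1⟩ := hsb φ
    rw [← integral_sub (hmul hw hψ hb) (hmul hw φ.measurable hb1)]
    calc _ ≤ ∫ x, |w x * ψ x - w x * φ x| ∂m := abs_integral_le_integral_abs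
      _ ≤ ∫ x, |w x| * δ ∂m := by
        refine integral_mono_of_nonneg (ae_of_all _ fun _ => abs_nonneg _) (hw.abs.mul_const δ)
          (ae_of_all _ fun x => ?_)
        simp only [← mul_sub, abs_mul]
        exact mul_le_mul_of_nonneg_left (hφ x) (abs_nonneg _)
      _ = (∫ x, |w x| ∂m) * δ := integral_mul_const _ _
      _ ≤ _ := by gcongr
  set G := ∫ x, |g x| ∂m with hG
  have hG0 : 0 ≤ G := integral_nonneg fun _ => abs_nonneg _
  have key : ∀ δ : ℝ, 0 < δ → |l - ∫ x, g x * ψ x ∂m| ≤ (B + G) * δ := by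
    intro δ hδ
    obtain ⟨φ, hφ⟩ := exists_simpleFunc_approx hψ hb hδ
    have h1 : |l - ∫ x, g x * φ x ∂m| ≤ B * δ := by
      refine le_of_tendsto ((hl.mono_left hU).sub (hsimple φ)).abs (Eventually.of_forall fun j => ?_)
      exact happrox (hv j) (hB j) hδ φ hφ
    have h2 := happrox hgi le_rfl hδ φ hφ
    rw [← hG] at h2
    have h3 := abs_sub_le l (∫ x, g x * φ x ∂m) (∫ x, g x * ψ x ∂m)
    rw [abs_sub_comm (∫ x, g x * φ x ∂m)] at h3
    linarith
  by_contra hne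
  have hpos : 0 < |l - ∫ x, g x * ψ x ∂m| := abs_pos.2 (sub_ne_zero.2 (Ne.symm hne))
  have h4 := key (|l - ∫ x, g x * ψ x ∂m| / (2 * (B + G + 1))) (by positivity)
  rw [mul_div_assoc', le_div_iff₀ (by positivity)] at h4
  nlinarith

lemma lintegral_enorm_le_of_level {Y : Type*} [MeasurableSpace Y] (μ : Measure Y) {w : Y → ℝ}
    (hw : Measurable w) {C e : ℝ} (hC : 0 ≤ C) (he : 1 < e)
    (h : ∀ L : ℝ, 0 < L → μ {y | L < |w y|} ≤ ENNReal.ofReal (C * L ^ (-e))) {M : ℝ} (hM : 0 < M) :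
    ∫⁻ y, ‖w y‖ₑ ∂μ ≤ ENNReal.ofReal M * μ univ +
      ENNReal.ofReal (C * (M ^ (1 - e) / (e - 1))) := by
  have h0 : ∫⁻ y, ‖w y‖ₑ ∂μ = ∫⁻ t in Ioi 0, μ {y | t < |w y|} := by
    rw [← lintegral_eq_lintegral_meas_lt μ (ae_of_all _ fun y => abs_nonneg (w y))
      hw.abs.aemeasurable]
    refine lintegral_congr fun y => ?_
    rw [← ofReal_norm, Real.norm_eq_abs]
  rw [h0, ← Ioc_union_Ioi_eq_Ioi hM.le, lintegral_union measurableSet_Ioi (Ioc_disjoint_Ioi le_rfl)]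
  gcongr
  · calc _ ≤ ∫⁻ t in Ioc 0 M, μ univ := lintegral_mono fun t => measure_mono (subset_univ _)
      _ = _ := by simp [mul_comm]
  · have hint : IntegrableOn (fun t : ℝ => C * t ^ (-e)) (Ioi M) :=
      (integrableOn_Ioi_rpow_of_lt (by linarith) hM).const_mul C
    calc _ ≤ ∫⁻ t in Ioi M, ENNReal.ofReal (C * t ^ (-e)) :=
          setLIntegral_mono' measurableSet_Ioi fun t ht => h t (hM.trans ht)
      _ = ENNReal.ofReal (∫ t in Ioi M, C * t ^ (-e)) := by
        rw [ofReal_integral_eq_lintegral_ofReal hint]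
        exact (ae_restrict_iff' measurableSet_Ioi).2 (ae_of_all _ fun t ht => by
          have : 0 < t := hM.trans ht
          positivity)
      _ ≤ _ := by
        refine ENNReal.ofReal_le_ofReal (le_of_eq ?_)
        rw [integral_const_mul, integral_Ioi_rpow_of_lt (by linarith) hM]
        congr 1
        rw [show -e + 1 = 1 - e by ring, show (1 : ℝ) - e = -(e - 1) by ring, div_neg, neg_div,
          neg_neg]

/-- The rescaled difference `Δ_{σ h}^k f (x) / σ^k`. -/
noncomputable def scaled (k : ℕ) (f : En n → ℝ) (σ : ℝ) (z : En n × En n) : ℝ :=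
  kDiff k f (σ • z.2) z.1 / σ ^ k

lemma measurable_scaled {f : En n → ℝ} (hf : Measurable f) (k : ℕ) (σ : ℝ) :
    Measurable (scaled k f σ) := (measurable_kDiff_smul hf k σ).div_const _

lemma exists_measure_scaled_le {k : ℕ} {p q K : ℝ} (hp : 1 < p) (hq : 1 < q) (hK : 0 < K)
    {f : En n → ℝ} (hf : Measurable f) (m : Measure (En n)) [IsFiniteMeasure m] (hm : m ≤ volume)
    (h : ∀ σ L : ℝ, 0 < σ → 0 < L →
      ∫⁻ x, volume {h ∈ Ann n | L < |kDiff k f (σ • h) x / σ ^ k|} ^ (p / q) ≤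
        ENNReal.ofReal (K * L ^ (-p))) :
    ∃ C e : ℝ, 0 < C ∧ 1 < e ∧ ∀ σ L : ℝ, 0 < σ → 0 < L →
      (m.prod (volume.restrict (Ann n))) {z | L < |scaled k f σ z|} ≤
        ENNReal.ofReal (C * L ^ (-e)) := by
  have hset : ∀ σ L : ℝ, MeasurableSet {z | L < |scaled k f σ z|} := fun σ L =>
    measurableSet_lt measurable_const (measurable_scaled hf k σ).abs
  have hprod : ∀ σ L : ℝ, (m.prod (volume.restrict (Ann n))) {z | L < |scaled k f σ z|} =
      ∫⁻ x, volume {h ∈ Ann n | L < |kDiff k f (σ • h) x / σ ^ k|} ∂m := by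
    intro σ L
    rw [Measure.prod_apply (hset σ L)]
    refine lintegral_congr fun x => ?_
    rw [Measure.restrict_apply (measurable_prodMk_left (hset σ L)), inter_comm]
    rfl
  have hq0 : 0 < q := by linarith
  have hr0 : 0 < p / q := div_pos (by linarith) hq0
  set A : ℝ := (volume (Ann n)).toReal with hA
  have hvA : volume (Ann n) = ENNReal.ofReal A := (ENNReal.ofReal_toReal volume_Ann_lt_top.ne).symm
  rcases le_total p q with hle | hle
  · have hr1 : p / q ≤ 1 := (div_le_one hq0).2 hle
    refine ⟨(A + 1) ^ (1 - p / q) * K, p, by positivity, hp, fun σ L hσ hL => ?_⟩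
    rw [hprod]
    calc _ ≤ ∫⁻ x, volume {h ∈ Ann n | L < |kDiff k f (σ • h) x / σ ^ k|} := lintegral_mono' hm le_rfl
      _ ≤ ∫⁻ x, ENNReal.ofReal ((A + 1) ^ (1 - p / q)) *
          volume {h ∈ Ann n | L < |kDiff k f (σ • h) x / σ ^ k|} ^ (p / q) := by
        refine lintegral_mono fun x => ?_
        set a := volume {h ∈ Ann n | L < |kDiff k f (σ • h) x / σ ^ k|} with ha
        have haA : a ≤ ENNReal.ofReal (A + 1) := by
          refine (measure_mono (fun h hh => hh.1)).trans (hvA.le.trans ?_)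
          exact ENNReal.ofReal_le_ofReal (by linarith)
        calc a = a ^ (1 - p / q) * a ^ (p / q) := by
              rw [← ENNReal.rpow_add_of_nonneg _ _ (by linarith) hr0.le]; simp
          _ ≤ _ := by
            rw [← ENNReal.ofReal_rpow_of_pos (by positivity)]
            gcongr
      _ ≤ _ := by
        rw [lintegral_const_mul' _ _ ENNReal.ofReal_ne_top, mul_assoc,
          ENNReal.ofReal_mul (by positivity)]
        gcongr
        exact h σ L hσ hL
  · have hr1 : 1 ≤ p / q := (one_le_div hq0).2 hle
    set V : ℝ := (m univ).toReal with hV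
    have hmV : m univ = ENNReal.ofReal V := (ENNReal.ofReal_toReal (measure_ne_top _ _)).symm
    have hV0 : 0 ≤ V := ENNReal.toReal_nonneg
    refine ⟨V + K, q, by positivity, hq, fun σ L hσ hL => ?_⟩
    rw [hprod]
    set t : ℝ := L ^ (-q) with ht
    have ht0 : 0 < t := by positivity
    have htL : t ^ (1 - p / q) * L ^ (-p) = t := by
      rw [ht, ← Real.rpow_mul hL.le, ← Real.rpow_add hL]
      congr 1
      field_simp
      ring
    calc _ ≤ ∫⁻ x, (ENNReal.ofReal t + ENNReal.ofReal (t ^ (1 - p / q)) *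
          volume {h ∈ Ann n | L < |kDiff k f (σ • h) x / σ ^ k|} ^ (p / q)) ∂m := by
          refine lintegral_mono fun x => ?_
          set a := volume {h ∈ Ann n | L < |kDiff k f (σ • h) x / σ ^ k|} with ha
          rcases le_total a (ENNReal.ofReal t) with h1 | h1
          · exact h1.trans le_self_add
          · refine le_trans ?_ le_add_self
            have hatop : a ≠ ⊤ := ((measure_mono (fun h hh => hh.1)).trans_lt volume_Ann_lt_top).ne
            have ha0 : a ≠ 0 := fun h0 => by
              rw [h0] at h1
              exact ht0.not_ge (by simpa using h1)
            calc a = a ^ (1 - p / q) * a ^ (p / q) := by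
                  rw [← ENNReal.rpow_add _ _ ha0 hatop]; simp
              _ ≤ _ := by
                rw [← ENNReal.ofReal_rpow_of_pos ht0]
                gcongr ?_ * _
                rw [show 1 - p / q = -(p / q - 1) by ring, ENNReal.rpow_neg, ENNReal.rpow_neg]
                exact ENNReal.inv_le_inv.2 (ENNReal.rpow_le_rpow h1 (by linarith))
      _ = ENNReal.ofReal t * m univ + ENNReal.ofReal (t ^ (1 - p / q)) *
          ∫⁻ x, volume {h ∈ Ann n | L < |kDiff k f (σ • h) x / σ ^ k|} ^ (p / q) ∂m := by
        rw [lintegral_add_left measurable_const, lintegral_const,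
          lintegral_const_mul' _ _ ENNReal.ofReal_ne_top]
      _ ≤ ENNReal.ofReal t * ENNReal.ofReal V + ENNReal.ofReal (t ^ (1 - p / q)) *
          ENNReal.ofReal (K * L ^ (-p)) := by
        rw [hmV]
        gcongr
        exact (lintegral_mono' hm le_rfl).trans (h σ L hσ hL)
      _ = _ := by
        rw [← ENNReal.ofReal_mul ht0.le, ← ENNReal.ofReal_mul (by positivity),
          ← ENNReal.ofReal_add (by positivity) (by positivity)]
        congr 1
        linear_combination K * htL

lemma lintegral_scaled_le {k : ℕ} {f : En n → ℝ} (hf : Measurable f) (m : Measure (En n))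
    [IsFiniteMeasure m] {C e : ℝ} (hC : 0 < C) (he : 1 < e) {σ : ℝ} (hσ : 0 < σ)
    (h : ∀ σ L : ℝ, 0 < σ → 0 < L →
      (m.prod (volume.restrict (Ann n))) {z | L < |scaled k f σ z|} ≤
        ENNReal.ofReal (C * L ^ (-e))) {S : Set (En n)} {M : ℝ} (hM : 0 < M) :
    ∫⁻ z, ‖scaled k f σ z‖ₑ ∂((m.restrict S).prod (volume.restrict (Ann n))) ≤
      ENNReal.ofReal M * (m S * volume (Ann n)) + ENNReal.ofReal (C * (M ^ (1 - e) / (e - 1))) := by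
  have := lintegral_enorm_le_of_level ((m.restrict S).prod (volume.restrict (Ann n)))
    (measurable_scaled hf k σ) hC.le he (fun L hL => le_trans
      (Measure.prod_mono Measure.restrict_le_self le_rfl _) (h σ L hσ hL)) hM
  rwa [← univ_prod_univ, Measure.prod_prod, Measure.restrict_apply_univ,
    Measure.restrict_apply_univ] at this

lemma integrable_scaled {k : ℕ} {f : En n → ℝ} (hf : Measurable f) (m : Measure (En n))
    [IsFiniteMeasure m] {C e : ℝ} (hC : 0 < C) (he : 1 < e)
    (h : ∀ σ L : ℝ, 0 < σ → 0 < L →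
      (m.prod (volume.restrict (Ann n))) {z | L < |scaled k f σ z|} ≤
        ENNReal.ofReal (C * L ^ (-e))) {σ : ℝ} (hσ : 0 < σ) :
    Integrable (scaled k f σ) (m.prod (volume.restrict (Ann n))) := by
  refine ⟨(measurable_scaled hf k σ).aestronglyMeasurable, ?_⟩
  have := lintegral_scaled_le hf m hC he hσ h (S := univ) one_pos
  rw [Measure.restrict_univ] at this
  refine lt_of_le_of_lt this ?_
  refine ENNReal.add_lt_top.2 ⟨ENNReal.mul_lt_top ENNReal.ofReal_lt_top
    (ENNReal.mul_lt_top (measure_lt_top _ _) volume_Ann_lt_top), ENNReal.ofReal_lt_top⟩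

/-- The family of averaged rescaled differences is uniformly integrable. -/
lemma uniformIntegrable_average {k : ℕ} {f : En n → ℝ} (hf : Measurable f) (m : Measure (En n))
    [IsFiniteMeasure m] {C e : ℝ} (hC : 0 < C) (he : 1 < e)
    (h : ∀ σ L : ℝ, 0 < σ → 0 < L →
      (m.prod (volume.restrict (Ann n))) {z | L < |scaled k f σ z|} ≤
        ENNReal.ofReal (C * L ^ (-e)))
    {η : En n → ℝ} (hη : Measurable η) {B : ℝ} (hB0 : 0 < B) (hB : ∀ x ∈ Ann n, |η x| ≤ B) :
    (∀ σ, 0 < σ → Integrable (fun z : En n × En n => scaled k f σ z * η z.2)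
      (m.prod (volume.restrict (Ann n)))) ∧
    (∃ D : ℝ, ∀ σ, 0 < σ → ∫ x, |∫ y in Ann n, scaled k f σ (x, y) * η y| ∂m ≤ D) ∧
    ∀ δ : ℝ, 0 < δ → ∃ r : ℝ, 0 < r ∧ ∀ σ, 0 < σ → ∀ S, MeasurableSet S → m S ≤ ENNReal.ofReal r →
      |∫ x in S, (∫ y in Ann n, scaled k f σ (x, y) * η y) ∂m| ≤ δ := by
  have hae : ∀ᵐ y ∂(volume.restrict (Ann n)), |η y| ≤ B :=
    (ae_restrict_iff' measurableSet_Ann).2 (ae_of_all _ hB)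
  have hint : ∀ σ, 0 < σ → Integrable (fun z : En n × En n => scaled k f σ z * η z.2)
      (m.prod (volume.restrict (Ann n))) := fun σ hσ =>
    (integrable_scaled hf m hC he h hσ).mul_bdd (c := B) (hη.comp measurable_snd).aestronglyMeasurable
      (Measure.quasiMeasurePreserving_snd.ae hae)
  have hbound : ∀ σ, 0 < σ → ∀ S, MeasurableSet S → ∀ M : ℝ, 0 < M → ∀ R : ℝ, 0 ≤ R →
      m S ≤ ENNReal.ofReal R →
      ∫ x in S, |∫ y in Ann n, scaled k f σ (x, y) * η y| ∂m ≤
        (M * (R * (volume (Ann n)).toReal) + C * (M ^ (1 - e) / (e - 1))) * B := by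
    intro σ hσ S hS M hM R hR hmS
    have he1 : 0 < e - 1 := by linarith
    rw [integral_eq_lintegral_of_nonneg_ae (ae_of_all _ fun _ => abs_nonneg _)
      ((hint σ hσ).integral_prod_left.abs.aestronglyMeasurable.restrict)]
    refine ENNReal.toReal_le_of_le_ofReal (by positivity) ?_
    calc _ ≤ ∫⁻ x in S, (∫⁻ y in Ann n, ‖scaled k f σ (x, y)‖ₑ * ENNReal.ofReal B) ∂m := by
          refine lintegral_mono fun x => ?_
          rw [← Real.norm_eq_abs, ofReal_norm]
          refine (enorm_integral_le_lintegral_enorm _).trans (lintegral_mono_ae ?_)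
          filter_upwards [hae] with y hy
          rw [enorm_mul]
          gcongr
          rw [← ofReal_norm]
          exact ENNReal.ofReal_le_ofReal hy
      _ = (∫⁻ x in S, (∫⁻ y in Ann n, ‖scaled k f σ (x, y)‖ₑ) ∂m) * ENNReal.ofReal B := by
          simp_rw [lintegral_mul_const' _ _ ENNReal.ofReal_ne_top]
      _ = (∫⁻ z, ‖scaled k f σ z‖ₑ ∂((m.restrict S).prod (volume.restrict (Ann n)))) *
            ENNReal.ofReal B := by
          rw [lintegral_prod _ (measurable_scaled hf k σ).enorm.aemeasurable]
      _ ≤ (ENNReal.ofReal M * (ENNReal.ofReal R * ENNReal.ofReal (volume (Ann n)).toReal) +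
            ENNReal.ofReal (C * (M ^ (1 - e) / (e - 1)))) * ENNReal.ofReal B := by
          gcongr
          refine (lintegral_scaled_le hf m hC he hσ h hM).trans ?_
          rw [ENNReal.ofReal_toReal volume_Ann_lt_top.ne]
          gcongr
      _ = _ := by
          rw [← ENNReal.ofReal_mul hR, ← ENNReal.ofReal_mul hM.le,
            ← ENNReal.ofReal_add (by positivity) (by positivity), ← ENNReal.ofReal_mul (by positivity)]
  refine ⟨hint, ⟨(1 * ((m univ).toReal * (volume (Ann n)).toReal) + C * (1 ^ (1 - e) / (e - 1))) * B,
    fun σ hσ => ?_⟩, fun δ hδ => ?_⟩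
  · have := hbound σ hσ univ MeasurableSet.univ 1 one_pos (m univ).toReal ENNReal.toReal_nonneg
      (by rw [ENNReal.ofReal_toReal (measure_ne_top _ _)])
    rwa [Measure.restrict_univ] at this
  · have hlim : Tendsto (fun M : ℝ => C * (M ^ (1 - e) / (e - 1)) * B) atTop (𝓝 0) := by
      have := ((tendsto_rpow_neg_atTop (y := e - 1) (by linarith)).div_const (e - 1)).const_mul C
      simpa using this.mul_const B
    obtain ⟨M, hM1, hM⟩ := ((hlim.eventually_le_const (half_pos hδ)).and
      (eventually_gt_atTop 0)).exists
    set A := (volume (Ann n)).toReal with hA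
    have hA0 : 0 ≤ A := ENNReal.toReal_nonneg
    refine ⟨δ / 2 / (M * A * B + 1), by positivity, fun σ hσ S hS hmS => ?_⟩
    refine abs_integral_le_integral_abs.trans ((hbound σ hσ S hS M hM _ (by positivity) hmS).trans ?_)
    have : δ / 2 / (M * A * B + 1) * (M * A * B) ≤ δ / 2 := by
      rw [div_mul_eq_mul_div, div_le_iff₀ (by positivity)]
      nlinarith
    nlinarith

lemma iter_dirD_eq_form {φ : En n → ℝ} (hφ : Smooth φ) (x h : En n) (k : ℕ) :
    (dirD h)^[k] φ x = form k (fun β => mpd β φ x) h := iter_dirD_eq hφ x h k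

lemma exists_form_mpd_le {φ : En n → ℝ} (hφ : Smooth φ) (hc : HasCompactSupport φ) (k : ℕ) :
    ∃ C : ℝ, 0 ≤ C ∧ ∀ z, ∀ h ∈ Ann n, |form k (fun β => mpd β φ z) h| ≤ C := by
  have h1 : ∀ α : Fin n → ℕ, ∃ D : ℝ, ∀ z, ‖mpd α φ z‖ ≤ D := fun α =>
    (hasCompactSupport_mpd hc α).exists_bound_of_continuous (ContDiff.continuous (hφ.mpd α))
  choose D hD using h1
  refine ⟨∑ α ∈ idx n k, Nat.multinomial Finset.univ α * 2 ^ k * D α, ?_, fun z h hh => ?_⟩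
  · refine Finset.sum_nonneg fun α _ => ?_
    have := (norm_nonneg _).trans (hD α 0)
    positivity
  · refine (Finset.abs_sum_le_sum_abs _ _).trans (Finset.sum_le_sum fun α hα => ?_)
    rw [abs_mul]
    refine mul_le_mul ((abs_mono_le α hα h).trans ?_) (hD α z) (abs_nonneg _) (by positivity)
    gcongr
    exact hh.2.le

lemma kDiff_eq_zero_of_lt {φ : En n → ℝ} {R : ℝ} (hR : ∀ z, R < ‖z‖ → φ z = 0) (k : ℕ) {h y : En n}
    (hy : R + k * ‖h‖ < ‖y‖) : kDiff k φ h y = 0 := by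
  refine Finset.sum_eq_zero fun j hj => ?_
  rw [hR, mul_zero]
  have hj' : (j : ℝ) ≤ k := by exact_mod_cast Nat.lt_succ_iff.1 (Finset.mem_range.1 hj)
  have h1 : ‖y‖ ≤ ‖y + (j : ℝ) • h‖ + ‖(j : ℝ) • h‖ := by
    simpa using norm_sub_le (y + (j : ℝ) • h) ((j : ℝ) • h)
  have h2 : ‖(j : ℝ) • h‖ ≤ k * ‖h‖ := by
    rw [norm_smul, Real.norm_natCast]
    gcongr
  linarith

lemma exists_kDiff_dominated {φ : En n → ℝ} (hφ : Smooth φ) (hc : HasCompactSupport φ) (k : ℕ) :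
    ∃ C R : ℝ, 0 ≤ C ∧ ∀ σ : ℝ, 0 < σ → σ ≤ 1 → ∀ h ∈ Ann n, ∀ y,
      |kDiff k φ ((-σ) • h) y / σ ^ k| ≤ (Metric.closedBall 0 R).indicator (fun _ => C) y := by
  obtain ⟨C, hC, hb⟩ := exists_form_mpd_le hφ hc k
  obtain ⟨R, hR⟩ : ∃ R : ℝ, ∀ z, R < ‖z‖ → φ z = 0 := by
    obtain ⟨R, hR⟩ := hc.isBounded.subset_closedBall 0
    refine ⟨R, fun z hz => image_eq_zero_of_notMem_tsupport fun hz' => ?_⟩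
    have := hR hz'
    rw [mem_closedBall_zero_iff] at this
    linarith
  refine ⟨C, R + k * 2, hC, fun σ hσ hσ1 h hh y => ?_⟩
  by_cases hy : y ∈ Metric.closedBall (0 : En n) (R + k * 2)
  · rw [indicator_of_mem hy, abs_div, abs_of_pos (pow_pos hσ k), div_le_iff₀ (pow_pos hσ k)]
    have := abs_kDiff_sub_le hφ k y ((-σ) • h) 0 (C * σ ^ k) fun τ _ => by
      rw [sub_zero, iter_dirD_eq_form hφ, form_smul, abs_mul, abs_pow, abs_neg, abs_of_pos hσ, mul_comm]
      gcongr
      exact hb _ h hh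
    simpa using this
  · rw [indicator_of_notMem hy, kDiff_eq_zero_of_lt hR]
    · simp
    · rw [mem_closedBall_zero_iff, not_le] at hy
      refine lt_of_le_of_lt ?_ hy
      have h2 : ‖(-σ) • h‖ ≤ 2 := by
        rw [norm_smul, norm_neg, Real.norm_eq_abs, abs_of_pos hσ]
        nlinarith [hh.2, norm_nonneg h]
      gcongr

lemma tendsto_kDiff_div {φ : En n → ℝ} (hφ : Smooth φ) (k : ℕ) (h y : En n) :
    Tendsto (fun σ : ℝ => kDiff k φ ((-σ) • h) y / σ ^ k) (𝓝[>] 0)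
      (𝓝 ((-1) ^ k * form k (fun β => mpd β φ y) h)) := by
  rw [Metric.tendsto_nhds]
  intro δ hδ
  have hcont : Continuous fun z => form k (fun β => mpd β φ z) h :=
    continuous_finsetSum _ fun β _ => continuous_const.mul (ContDiff.continuous (hφ.mpd β))
  obtain ⟨r, hr, hball⟩ := Metric.continuousAt_iff.1 (hcont.continuousAt (x := y)) (δ / 2) (half_pos hδ)
  have hsmall : ∀ᶠ σ : ℝ in 𝓝[>] 0, k * (σ * ‖h‖) < r := by
    have : Tendsto (fun σ : ℝ => k * (σ * ‖h‖)) (𝓝 0) (𝓝 (k * (0 * ‖h‖))) :=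
      (tendsto_id.mul_const _).const_mul _
    rw [zero_mul, mul_zero] at this
    exact (this.mono_left nhdsWithin_le_nhds).eventually_lt_const hr
  filter_upwards [hsmall, self_mem_nhdsWithin] with σ hs hσ
  have hσ : 0 < σ := hσ
  have key := abs_kDiff_sub_le hφ k y ((-σ) • h) ((-σ) ^ k * form k (fun β => mpd β φ y) h)
    (δ / 2 * σ ^ k) fun τ hτ => by
      rw [iter_dirD_eq_form hφ, form_smul, ← mul_sub, abs_mul, abs_pow, abs_neg, abs_of_pos hσ, mul_comm]
      gcongr
      refine (hball ?_).le
      rw [dist_self_add_left, norm_smul, norm_smul, norm_neg, Real.norm_eq_abs, Real.norm_eq_abs,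
        abs_of_pos hσ, abs_of_nonneg hτ.1]
      refine lt_of_le_of_lt ?_ hs
      gcongr
      exact hτ.2
  have hpos := pow_pos hσ k
  rw [Real.dist_eq]
  have e : kDiff k φ ((-σ) • h) y / σ ^ k - (-1) ^ k * form k (fun β => mpd β φ y) h =
      (kDiff k φ ((-σ) • h) y - (-σ) ^ k * form k (fun β => mpd β φ y) h) / σ ^ k := by
    rw [show (-σ) ^ k = (-1) ^ k * σ ^ k by rw [← mul_pow]; ring]
    field_simp
  rw [e, abs_div, abs_of_pos hpos, div_lt_iff₀ hpos]
  nlinarith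

lemma integral_mul_kDiff {f φ : En n → ℝ} (hf : LocallyIntegrable f volume)
    (hφ : Continuous φ) (hc : HasCompactSupport φ) (k : ℕ) (h : En n) :
    ∫ x, kDiff k f h x * φ x = ∫ y, f y * kDiff k φ (-h) y := by
  have hi : ∀ c : En n, Integrable (fun y => f y * φ (y - c)) := by
    intro c
    have := hf.integrable_smul_left_of_hasCompactSupport (g := fun y => φ (y - c)) (by fun_prop)
      (hc.comp_homeomorph (Homeomorph.subRight c))
    simpa [mul_comm] using this
  have hi' : ∀ c : En n, Integrable (fun x => f (x + c) * φ x) := fun c => by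
    simpa using (hi c).comp_add_right c
  have he : ∀ c : En n, ∫ x, f (x + c) * φ x = ∫ y, f y * φ (y - c) := fun c => by
    rw [← integral_add_right_eq_self (fun y => f y * φ (y - c)) c]
    simp
  unfold kDiff
  simp_rw [Finset.sum_mul, Finset.mul_sum]
  have e1 : ∀ (j : ℕ) (x : En n), (-1 : ℝ) ^ (k - j) * (k.choose j : ℝ) * f (x + (j : ℝ) • h) * φ x =
      (-1 : ℝ) ^ (k - j) * (k.choose j : ℝ) * (f (x + (j : ℝ) • h) * φ x) := fun j x => by ring
  have e2 : ∀ (j : ℕ) (y : En n), f y * ((-1 : ℝ) ^ (k - j) * (k.choose j : ℝ) * φ (y + (j : ℝ) • -h)) =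
      (-1 : ℝ) ^ (k - j) * (k.choose j : ℝ) * (f y * φ (y - (j : ℝ) • h)) := fun j y => by
    rw [smul_neg, ← sub_eq_add_neg]; ring
  simp_rw [e1, e2]
  rw [integral_finsetSum _ fun j _ => (hi' _).const_mul _,
    integral_finsetSum _ fun j _ => (hi _).const_mul _]
  refine Finset.sum_congr rfl fun j _ => ?_
  rw [integral_const_mul, integral_const_mul, he]

lemma integral_scaled_mul {f φ : En n → ℝ} (hf : LocallyIntegrable f volume)
    (hφ : Continuous φ) (hc : HasCompactSupport φ) (k : ℕ) (σ : ℝ) (h : En n) :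
    ∫ x, scaled k f σ (x, h) * φ x = ∫ y, f y * (kDiff k φ ((-σ) • h) y / σ ^ k) := by
  have := integral_mul_kDiff hf hφ hc k (σ • h)
  rw [neg_smul]
  simp only [scaled, div_mul_eq_mul_div, mul_div_assoc']
  rw [integral_div, integral_div, this]

/-- Averaging the rescaled differences against a dual kernel recovers a partial derivative. -/
lemma tendsto_integral_scaled {k : ℕ} {f φ : En n → ℝ} (hfm : Measurable f)
    (hf : LocallyIntegrable f volume) (hφ : Smooth φ) (hc : HasCompactSupport φ)
    {η : En n → ℝ} (hη : Measurable η) {B : ℝ} (hB : ∀ h ∈ Ann n, |η h| ≤ B)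
    {α : Fin n → ℕ} (hα : α ∈ idx n k)
    (hdual : ∀ β ∈ idx n k, ∫ h in Ann n, η h * mono β h = if α = β then 1 else 0) :
    Tendsto (fun σ : ℝ => ∫ h in Ann n, η h * ∫ x, scaled k f σ (x, h) * φ x) (𝓝[>] 0)
      (𝓝 ((-1) ^ k * ∫ x, f x * mpd α φ x)) := by
  obtain ⟨C, R, hC, hdom⟩ := exists_kDiff_dominated hφ hc k
  have hφc : Continuous φ := ContDiff.continuous hφ
  have hσ : ∀ᶠ σ : ℝ in 𝓝[>] 0, 0 < σ ∧ σ ≤ 1 := by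
    filter_upwards [Ioc_mem_nhdsGT (show (0 : ℝ) < 1 by norm_num)] with σ hσ using hσ
  set bd : En n → ℝ := (Metric.closedBall 0 R).indicator (fun y => |f y| * C) with hbd
  have hbdi : Integrable bd := by
    rw [hbd, integrable_indicator_iff Metric.isClosed_closedBall.measurableSet]
    exact ((hf.integrableOn_isCompact (isCompact_closedBall _ _)).abs).mul_const C
  have hle : ∀ σ : ℝ, 0 < σ → σ ≤ 1 → ∀ h ∈ Ann n, ∀ y,
      ‖f y * (kDiff k φ ((-σ) • h) y / σ ^ k)‖ ≤ bd y := by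
    intro σ h0 h1 h hh y
    have := hdom σ h0 h1 h hh y
    rw [norm_mul, Real.norm_eq_abs, Real.norm_eq_abs]
    refine (mul_le_mul_of_nonneg_left this (abs_nonneg _)).trans (le_of_eq ?_)
    by_cases hy : y ∈ Metric.closedBall (0 : En n) R <;> simp [hbd, hy]
  have hmeas : ∀ σ (h : En n), AEStronglyMeasurable
      (fun y => f y * (kDiff k φ ((-σ) • h) y / σ ^ k)) volume := by
    intro σ h
    refine (hfm.mul ?_).aestronglyMeasurable
    exact ((measurable_kDiff_smul hφc.measurable k (-σ)).comp measurable_prodMk_right).div_const _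
  have hinner : ∀ h ∈ Ann n, Tendsto (fun σ : ℝ => ∫ x, scaled k f σ (x, h) * φ x) (𝓝[>] 0)
      (𝓝 (∫ y, f y * ((-1) ^ k * form k (fun β => mpd β φ y) h))) := by
    intro h hh
    simp_rw [integral_scaled_mul hf hφc hc k]
    refine tendsto_integral_filter_of_dominated_convergence bd (Eventually.of_forall fun σ => hmeas σ h)
      ?_ hbdi (ae_of_all _ fun y => (tendsto_kDiff_div hφ k h y).const_mul _)
    filter_upwards [hσ] with σ hs
    exact ae_of_all _ (hle σ hs.1 hs.2 h hh)
  have hlim : ∀ h, ∫ y, f y * ((-1) ^ k * form k (fun β => mpd β φ y) h) =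
      (-1) ^ k * ∑ β ∈ idx n k, mono β h * ∫ y, f y * mpd β φ y := by
    intro h
    have hi : ∀ β : Fin n → ℕ, Integrable (fun y => f y * mpd β φ y) := fun β => by
      simpa [mul_comm] using hf.integrable_smul_left_of_hasCompactSupport
        (ContDiff.continuous (hφ.mpd β)) (hasCompactSupport_mpd hc β)
    simp only [form, Finset.mul_sum]
    have e : ∀ (β : Fin n → ℕ) (y : En n), f y * ((-1) ^ k * (mono β h * mpd β φ y)) =
        ((-1) ^ k * mono β h) * (f y * mpd β φ y) := fun β y => by ring
    simp_rw [e]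
    rw [integral_finsetSum _ fun β _ => (hi β).const_mul _]
    refine Finset.sum_congr rfl fun β _ => ?_
    rw [integral_const_mul, mul_assoc]
  have htarget : ∫ h in Ann n, η h * ∫ y, f y * ((-1) ^ k * form k (fun β => mpd β φ y) h) =
      (-1) ^ k * ∫ x, f x * mpd α φ x := by
    simp_rw [hlim]
    have e : ∀ h : En n, η h * ((-1) ^ k * ∑ β ∈ idx n k, mono β h * ∫ y, f y * mpd β φ y) =
        ∑ β ∈ idx n k, (η h * mono β h) * ((-1) ^ k * ∫ y, f y * mpd β φ y) := fun h => by
      simp only [Finset.mul_sum]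
      exact Finset.sum_congr rfl fun β _ => by ring
    simp_rw [e]
    have hi : ∀ β ∈ idx n k, Integrable (fun h => η h * mono β h) (volume.restrict (Ann n)) := by
      intro β hβ
      obtain ⟨D, hD, hDb⟩ := bounded_mono_Ann β hβ
      refine integrable_of_bounded_Ann (B := B * D) (hη.mul (continuous_mono β).measurable) fun h hh => ?_
      rw [abs_mul]
      exact mul_le_mul (hB h hh) (hDb h hh) (abs_nonneg _) ((abs_nonneg _).trans (hB h hh))
    rw [integral_finsetSum _ fun β hβ => (hi β hβ).mul_const _]
    simp_rw [integral_mul_const]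
    rw [Finset.sum_eq_single α]
    · rw [hdual α hα, if_pos rfl, one_mul]
    · intro β hβ hne
      rw [hdual β hβ, if_neg (Ne.symm hne), zero_mul]
    · exact fun h => absurd hα h
  rw [← htarget]
  refine tendsto_integral_filter_of_dominated_convergence (fun _ => B * ∫ y, bd y)
    (Eventually.of_forall fun σ => ?_) ?_ (integrable_const _)
    ((ae_restrict_iff' measurableSet_Ann).2 (ae_of_all _ fun h hh => (hinner h hh).const_mul _))
  · refine (hη.stronglyMeasurable.mul ?_).aestronglyMeasurable
    exact StronglyMeasurable.integral_prod_left (f := fun x h => scaled k f σ (x, h) * φ x)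
      ((measurable_scaled hfm k σ).mul (hφc.measurable.comp measurable_fst)).stronglyMeasurable
  · filter_upwards [hσ] with σ hs
    refine (ae_restrict_iff' measurableSet_Ann).2 (ae_of_all _ fun h hh => ?_)
    rw [norm_mul, integral_scaled_mul hf hφc hc k]
    refine mul_le_mul (hB h hh) ?_ (norm_nonneg _) ((abs_nonneg _).trans (hB h hh))
    exact norm_integral_le_of_norm_le hbdi (ae_of_all _ (hle σ hs.1 hs.2 h hh))

/-- An integrable weight with values in `(0, 1]`. -/
noncomputable def weight (x : En n) : ℝ := (1 + ‖x‖) ^ (-((n : ℝ) + 1))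

lemma weight_pos (x : En n) : 0 < weight x := Real.rpow_pos_of_pos (by positivity) _

lemma weight_le_one (x : En n) : weight x ≤ 1 :=
  Real.rpow_le_one_of_one_le_of_nonpos (by linarith [norm_nonneg x]) (by linarith [n.cast_nonneg (α := ℝ)])

lemma continuous_weight : Continuous (weight : En n → ℝ) :=
  Continuous.rpow_const (by fun_prop) fun x => Or.inl (by positivity)

lemma integrable_weight : Integrable (weight : En n → ℝ) := by
  have := integrable_one_add_norm (E := En n) (μ := volume) (r := (n : ℝ) + 1) (by simp)
  exact this

/-- Lebesgue measure with the weight `weight` as density. -/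
noncomputable def wvol (n : ℕ) : Measure (En n) :=
  volume.withDensity fun x => ENNReal.ofReal (weight x)

lemma measurable_ofReal_weight : Measurable fun x : En n => ENNReal.ofReal (weight x) :=
  continuous_weight.measurable.ennreal_ofReal

instance : IsFiniteMeasure (wvol n) := by
  refine isFiniteMeasure_withDensity ?_
  rw [← ofReal_integral_eq_lintegral_ofReal integrable_weight (ae_of_all _ fun x => (weight_pos x).le)]
  exact ENNReal.ofReal_ne_top

lemma wvol_le : wvol n ≤ volume := by
  refine (withDensity_mono (g := 1) (ae_of_all _ fun x => ?_)).trans_eq withDensity_one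
  simpa using weight_le_one x

lemma integral_wvol (u : En n → ℝ) : ∫ x, u x ∂(wvol n) = ∫ x, weight x * u x := by
  rw [wvol, integral_withDensity_eq_integral_toReal_smul measurable_ofReal_weight (by simp)]
  simp [ENNReal.toReal_ofReal (weight_pos _).le]

lemma integral_wvol_mul_div (u φ : En n → ℝ) :
    ∫ x, u x * (φ x / weight x) ∂(wvol n) = ∫ x, u x * φ x := by
  rw [integral_wvol]
  refine integral_congr_ae (ae_of_all _ fun x => ?_)
  have := (weight_pos x).ne'
  field_simp

lemma locallyIntegrable_of_integrable_wvol {u : En n → ℝ} (hu : Integrable u (wvol n)) :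
    LocallyIntegrable u volume := by
  rw [wvol, integrable_withDensity_iff_integrable_smul' measurable_ofReal_weight (by simp)] at hu
  have h1 : Integrable (fun x => weight x * u x) := by
    refine hu.congr (ae_of_all _ fun x => ?_)
    simp [ENNReal.toReal_ofReal (weight_pos x).le]
  have h2 := (h1.locallyIntegrable.locallyIntegrableOn univ).continuousOn_mul
    (continuous_weight.inv₀ fun x => (weight_pos x).ne').continuousOn isOpen_univ.isLocallyClosed
  rw [locallyIntegrableOn_univ] at h2
  refine h2.congr (ae_of_all _ fun x => ?_)
  have := (weight_pos x).ne'
  simp only [Pi.inv_apply]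
  field_simp

lemma exists_weakDeriv {k : ℕ} {f : En n → ℝ} (hfm : Measurable f)
    (hf : LocallyIntegrable f volume) {C e : ℝ} (hC : 0 < C) (he : 1 < e)
    (h : ∀ σ L : ℝ, 0 < σ → 0 < L →
      ((wvol n).prod (volume.restrict (Ann n))) {z | L < |scaled k f σ z|} ≤
        ENNReal.ofReal (C * L ^ (-e)))
    {η : En n → ℝ} (hη : Measurable η) {B : ℝ} (hB0 : 0 < B) (hB : ∀ h ∈ Ann n, |η h| ≤ B)
    {α : Fin n → ℕ} (hα : α ∈ idx n k)
    (hdual : ∀ β ∈ idx n k, ∫ h in Ann n, η h * mono β h = if α = β then 1 else 0) :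
    ∃ g : En n → ℝ, LocallyIntegrable g volume ∧ ∀ φ : En n → ℝ, ContDiff ℝ (⊤ : ℕ∞) φ →
      HasCompactSupport φ → ∫ x, f x * mpd α φ x = (-1 : ℝ) ^ k * ∫ x, g x * φ x := by
  obtain ⟨hint, ⟨D, hD⟩, hUI⟩ := uniformIntegrable_average hfm (wvol n) hC he h hη hB0 hB
  have hσ : ∀ j : ℕ, (0 : ℝ) < 1 / ((j : ℝ) + 1) := fun j => by positivity
  have hlim : Tendsto (fun j : ℕ => 1 / ((j : ℝ) + 1)) atTop (𝓝[>] 0) :=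
    tendsto_nhdsWithin_iff.2 ⟨tendsto_one_div_add_atTop_nhds_zero_nat, Eventually.of_forall hσ⟩
  obtain ⟨g, hg, hgψ⟩ := exists_weak_limit (wvol n)
    (v := fun j x => ∫ y in Ann n, scaled k f (1 / ((j : ℝ) + 1)) (x, y) * η y)
    (fun j => (hint _ (hσ j)).integral_prod_left)
    (fun δ hδ => by
      obtain ⟨r, hr, H⟩ := hUI δ hδ
      exact ⟨r, hr, fun j => H _ (hσ j)⟩) (fun j => hD _ (hσ j))
  refine ⟨g, locallyIntegrable_of_integrable_wvol hg, fun φ hφ hc => ?_⟩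
  have hφc : Continuous φ := hφ.continuous
  have hψc : Continuous fun x => φ x / weight x :=
    hφc.div continuous_weight fun x => (weight_pos x).ne'
  have hψs : HasCompactSupport fun x => φ x / weight x := by
    refine hc.mono fun x hx => ?_
    contrapose! hx
    simp only [Function.mem_support, not_not] at hx ⊢
    rw [hx, zero_div]
  obtain ⟨b, hb⟩ := hψs.exists_bound_of_continuous hψc
  have hswap : ∀ σ : ℝ, 0 < σ →
      ∫ x, (∫ y in Ann n, scaled k f σ (x, y) * η y) * (φ x / weight x) ∂(wvol n) =
        ∫ y in Ann n, η y * ∫ x, scaled k f σ (x, y) * φ x := by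
    intro σ hs
    have hi : Integrable (fun z : En n × En n => scaled k f σ z * η z.2 * (φ z.1 / weight z.1))
        ((wvol n).prod (volume.restrict (Ann n))) :=
      (hint σ hs).mul_bdd (c := b) (hψc.measurable.comp measurable_fst).aestronglyMeasurable
        (ae_of_all _ fun z => hb z.1)
    simp_rw [← integral_mul_const]
    rw [integral_integral_swap (f := fun x y => scaled k f σ (x, y) * η y * (φ x / weight x)) hi]
    refine integral_congr_ae (ae_of_all _ fun y => ?_)
    change ∫ x, scaled k f σ (x, y) * η y * (φ x / weight x) ∂(wvol n) =
      η y * ∫ x, scaled k f σ (x, y) * φ x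
    rw [integral_wvol_mul_div, ← integral_const_mul]
    refine integral_congr_ae (ae_of_all _ fun x => ?_)
    change scaled k f σ (x, y) * η y * φ x = η y * (scaled k f σ (x, y) * φ x)
    ring
  have hT := (tendsto_integral_scaled hfm hf hφ hc hη hB hα hdual).comp hlim
  have := hgψ _ hψc.measurable ⟨b, hb⟩ _ (hT.congr fun j => (hswap _ (hσ j)).symm)
  rw [integral_wvol_mul_div] at this
  rw [this, ← mul_assoc, ← mul_pow]
  simp

theorem exists_hasWeakDerivs {k : ℕ} (hk : 0 < k) {p q γ K : ℝ} (hp : 1 < p) (hq : 1 < q)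
    (hK : 0 < K) {f : En n → ℝ} (hfm : Measurable f) (hf : LocallyIntegrable f volume)
    (h : ∀ lam : ℝ, 0 < lam →
      ∫⁻ x, innerInt k k lam (γ / q) γ f x ^ (p / q) ≤ ENNReal.ofReal (K * lam ^ (-p))) :
    ∃ g : (Fin n → ℕ) → En n → ℝ, HasWeakDerivs k f g := by
  obtain ⟨K', hK', hlev⟩ := exists_lintegral_level_le (by linarith) (by linarith) hfm hK h
  obtain ⟨C, e, hC, he, hm⟩ := exists_measure_scaled_le hp hq hK' hfm (wvol n) wvol_le hlev
  obtain ⟨η, hη, ⟨B, hB0, hB⟩, hdual⟩ := exists_dual n hk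
  have hex : ∀ α : Fin n → ℕ, ∃ g : En n → ℝ, (∑ i, α i) = k → LocallyIntegrable g volume ∧
      ∀ φ : En n → ℝ, ContDiff ℝ (⊤ : ℕ∞) φ → HasCompactSupport φ →
        ∫ x, f x * mpd α φ x = (-1 : ℝ) ^ k * ∫ x, g x * φ x := by
    intro α
    by_cases hα : (∑ i, α i) = k
    · obtain ⟨g, hg⟩ := exists_weakDeriv hfm hf hC he hm (hη α) hB0 (hB α) (mem_idx.2 hα)
        (hdual α (mem_idx.2 hα))
      exact ⟨g, fun _ => hg⟩
    · exact ⟨0, fun h => absurd h hα⟩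
  choose g hg using hex
  exact ⟨g, fun α hα => (hg α hα).1, fun α hα => (hg α hα).2⟩

theorem exists_weakDerivs_gradLp_lt_top {k : ℕ} (hk : 0 < k) {p q γ : ℝ} (hp : 1 < p) (hq : 1 < q)
    (hγ : γ ≠ 0) {f : En n → ℝ} (hf : LocallyIntegrable f volume)
    (h : (⨆ lam ∈ Ioi (0 : ℝ), bsvy k k p q (γ / q) γ f lam) < ⊤) :
    ∃ g : (Fin n → ℕ) → En n → ℝ, HasWeakDerivs k f g ∧ gradLp p k g < ⊤ := by
  have hp0 : 0 < p := by linarith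
  have hsm := hf.aestronglyMeasurable
  set f' := hsm.mk f with hf'
  have hff' : f =ᵐ[volume] f' := hsm.ae_eq_mk
  have hfm : Measurable f' := hsm.stronglyMeasurable_mk.measurable
  have hf'i : LocallyIntegrable f' volume := hf.congr hff'
  simp_rw [bsvy_congr_ae hff'] at h
  obtain ⟨K, hK, hle⟩ := exists_lintegral_innerInt_le hp0 h
  obtain ⟨g, hg⟩ := exists_hasWeakDerivs hk hp hq hK hfm hf'i hle
  obtain ⟨g', hg', hgm, -⟩ := exists_measurable_weakDerivs hg
  exact ⟨g', hasWeakDerivs_congr_ae hff'.symm hg',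
    gradLp_lt_top hk hp0 (by linarith) hγ hfm hf'i hle hg' hgm⟩

end BSVY

/-- BSVY characterization of the homogeneous Sobolev space `Ẇ^{k,p}`. -/
theorem statement2 (n k : ℕ) (hn : 0 < n) (hk : 0 < k) (p q γ : ℝ)
    (hp : 1 < p) (hq : 1 < q) (hpq : (n : ℝ) * (1 / p - 1 / q) < (k : ℝ))
    (hγ : γ ≠ 0) (f : En n → ℝ) (hf : LocallyIntegrable f volume) :
    (∃ g : (Fin n → ℕ) → En n → ℝ, HasWeakDerivs k f g ∧ gradLp p k g < ⊤) ↔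
      (⨆ lam ∈ Ioi (0 : ℝ), bsvy k k p q (γ / q) γ f lam) < ⊤ := by
  exact ⟨fun ⟨_, hw, hg⟩ => BSVY.iSup_bsvy_lt_top hn hk hp hq hpq hγ hf hw hg,
    BSVY.exists_weakDerivs_gradLp_lt_top hk hp hq hγ hf⟩
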